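/- Kato–Ponce inequality: Let d ≥ 1, s ≥ 0, and let 1 < p, p₁, q₁, p₂, q₂ < ∞ satisfy 1/p = 1/p₁ + 1/q₁ = 1/p₂ + 1/q₂. Then there exists a constant C, depending only on d, s and the exponents, such that for all Schwartz functions f, g on ℝ^d: ‖Λ^s(fg)‖_{L^p} ≤ C (‖Λ^s f‖_{L^{p₁}} ‖g‖_{L^{q₁}} + ‖f‖_{L^{p₂}} ‖Λ^s g‖_{L^{q₂}}). -/

import Mathlib

open MeasureTheory SchwartzMap
open scoped ENNReal FourierTransform RealInnerProductSpace

/-- `Λ^s h (x) = ∫ e^{2πi⟨x,ξ⟩} ‖ξ‖^s 𝓕h(ξ) dξ`, with the convention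
`𝓕h(ξ) = ∫ e^{−2πi⟨x,ξ⟩} h(x) dx`. -/
noncomputable def lam (d : ℕ) (s : ℝ) (h : EuclideanSpace ℝ (Fin d) → ℂ) :
    EuclideanSpace ℝ (Fin d) → ℂ :=
  fun x => ∫ ξ : EuclideanSpace ℝ (Fin d),
    Complex.exp (((2 * Real.pi * ⟪x, ξ⟫) : ℝ) * Complex.I) * (‖ξ‖ ^ s : ℝ) * 𝓕 h ξ

set_option linter.unusedSectionVars false

namespace KatoPonce

section Marcinkiewicz

open Set

lemma lintegral_Ioo_rpow {a r : ℝ} (ha : 0 ≤ a) (hr : 0 < r) :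
    ∫⁻ t in Ioo 0 a, ENNReal.ofReal (t ^ (r - 1)) = ENNReal.ofReal (a ^ r / r) := by
  have hi : IntervalIntegrable (fun t : ℝ => t ^ (r - 1)) volume 0 a :=
    intervalIntegral.intervalIntegrable_rpow' (by linarith)
  rw [← ofReal_integral_eq_lintegral_ofReal, ← integral_Ioc_eq_integral_Ioo,
    ← intervalIntegral.integral_of_le ha, integral_rpow (Or.inl (by linarith))]
  · simp [Real.zero_rpow hr.ne']
  · exact ((intervalIntegrable_iff_integrableOn_Ioc_of_le ha).1 hi).mono_set Ioo_subset_Ioc_self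
  · exact (ae_restrict_mem measurableSet_Ioo).mono fun t ht => Real.rpow_nonneg ht.1.le _

lemma lintegral_Ioi_rpow {a r : ℝ} (ha : 0 < a) (hr : 0 < r) :
    ∫⁻ t in Ioi a, ENNReal.ofReal (t ^ (-r - 1)) = ENNReal.ofReal (a ^ (-r) / r) := by
  rw [← ofReal_integral_eq_lintegral_ofReal, integral_Ioi_rpow_of_lt (by linarith) ha]
  · congr 1
    rw [sub_add_cancel, div_neg, neg_div, neg_neg]
  · exact integrableOn_Ioi_rpow_of_lt (by linarith) ha
  · exact (ae_restrict_mem measurableSet_Ioi).mono fun t ht => Real.rpow_nonneg (ha.trans ht).le _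

lemma rpow_eq_lintegral_indicator {p : ℝ} (hp : 0 < p) (a : ℝ≥0∞) :
    a ^ p = ∫⁻ t in Ioi (0 : ℝ), {t : ℝ | ENNReal.ofReal t < a}.indicator
      (fun t => ENNReal.ofReal (p * t ^ (p - 1))) t := by
  have key : ∀ b : ℝ, 0 ≤ b → ∫⁻ t in Ioo 0 b, ENNReal.ofReal (p * t ^ (p - 1)) =
      ENNReal.ofReal (b ^ p) := by
    intro b hb
    simp_rw [ENNReal.ofReal_mul hp.le]
    rw [lintegral_const_mul' _ _ ENNReal.ofReal_ne_top, lintegral_Ioo_rpow hb hp,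
      ← ENNReal.ofReal_mul hp.le]
    congr 1
    field_simp
  have hm : MeasurableSet {t : ℝ | ENNReal.ofReal t < a} :=
    measurableSet_lt ENNReal.measurable_ofReal measurable_const
  rw [lintegral_indicator hm, Measure.restrict_restrict hm]
  rcases eq_or_ne a ⊤ with rfl | ha
  · rw [ENNReal.top_rpow_of_pos hp]
    refine (ENNReal.eq_top_of_forall_nnreal_le fun r => ?_).symm
    have h1 := key ((r : ℝ) ^ (1 / p)) (by positivity)
    rw [← Real.rpow_mul r.coe_nonneg, one_div_mul_cancel hp.ne', Real.rpow_one,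
      ENNReal.ofReal_coe_nnreal]
      at h1
    rw [← h1]
    refine lintegral_mono_set fun t ht => ⟨ENNReal.ofReal_lt_top, ht.1⟩
  · lift a to NNReal using ha
    have : {t : ℝ | ENNReal.ofReal t < a} ∩ Ioi 0 = Ioo 0 (a : ℝ) := by
      ext t
      simp only [mem_inter_iff, mem_ofPred_eq, mem_Ioi, mem_Ioo]
      constructor
      · rintro ⟨h1, h2⟩
        refine ⟨h2, ?_⟩
        rw [← ENNReal.ofReal_coe_nnreal, ENNReal.ofReal_lt_ofReal_iff'] at h1
        exact h1.1
      · rintro ⟨h1, h2⟩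
        refine ⟨?_, h1⟩
        rw [← ENNReal.ofReal_coe_nnreal, ENNReal.ofReal_lt_ofReal_iff']
        exact ⟨h2, h1.trans h2⟩
    rw [this, key _ a.coe_nonneg, ← ENNReal.ofReal_rpow_of_nonneg a.coe_nonneg hp.le,
      ENNReal.ofReal_coe_nnreal]

/-- Marcinkiewicz interpolation between weak type `(1, 1)` and weak type `(q, q)`, stated for the
distribution functions. -/
theorem lintegral_rpow_le_of_weak_type {α : Type*} [MeasurableSpace α] {μ : Measure α} [SFinite μ]
    {F : α → ℝ} {G : α → ℝ≥0∞} (hF : Measurable F) (hF0 : ∀ x, 0 ≤ F x) (hG : Measurable G)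
    {p q : ℝ} (hp : 1 < p) (hpq : p < q) (A B : ℝ≥0∞)
    (h : ∀ t : ℝ, 0 < t → μ {x | ENNReal.ofReal (2 * t) < G x} ≤
      A * ENNReal.ofReal t⁻¹ * ∫⁻ x in {x | t < F x}, ENNReal.ofReal (F x) ∂μ +
      B * ENNReal.ofReal (t ^ (-q)) * ∫⁻ x in {x | F x ≤ t}, ENNReal.ofReal (F x) ^ q ∂μ) :
    ∫⁻ x, G x ^ p ∂μ ≤ 2 ^ p * ENNReal.ofReal p *
      (A * ENNReal.ofReal (p - 1)⁻¹ + B * ENNReal.ofReal (q - p)⁻¹) *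
      ∫⁻ x, ENNReal.ofReal (F x) ^ p ∂μ := by
  have hp0 : 0 < p := by linarith
  have hq0 : 0 < q := by linarith
  have e1 : ∀ x, G x ^ p = 2 ^ p * ∫⁻ t in Ioi (0 : ℝ),
      {t : ℝ | ENNReal.ofReal (2 * t) < G x}.indicator
      (fun t => ENNReal.ofReal (p * t ^ (p - 1))) t := by
    intro x
    have h2 : G x = 2 * (G x / 2) := by
      rw [ENNReal.mul_div_cancel (by norm_num) (by norm_num)]
    have h3 : {t : ℝ | ENNReal.ofReal (2 * t) < G x} = {t : ℝ | ENNReal.ofReal t < G x / 2} := by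
      ext t
      simp only [mem_ofPred_eq]
      rw [ENNReal.lt_div_iff_mul_lt (by norm_num) (by norm_num), mul_comm 2 t,
        ENNReal.ofReal_mul' (by norm_num)]
      norm_num
    rw [h3, ← rpow_eq_lintegral_indicator hp0, ← ENNReal.mul_rpow_of_nonneg _ _ hp0.le, ← h2]
  simp_rw [e1]
  rw [lintegral_const_mul' _ _ (by finiteness)]
  have mG : MeasurableSet {z : α × ℝ | ENNReal.ofReal (2 * z.2) < G z.1} :=
    measurableSet_lt (by fun_prop) (by fun_prop)
  have m1 : Measurable (Function.uncurry fun (x : α) (t : ℝ) =>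
      {t : ℝ | ENNReal.ofReal (2 * t) < G x}.indicator
      (fun t => ENNReal.ofReal (p * t ^ (p - 1))) t) := by
    have : Measurable fun z : α × ℝ => ENNReal.ofReal (p * z.2 ^ (p - 1)) := by fun_prop
    exact this.indicator mG
  rw [lintegral_lintegral_swap m1.aemeasurable]
  have e2 : ∀ t ∈ Ioi (0 : ℝ), ∫⁻ x, {t : ℝ | ENNReal.ofReal (2 * t) < G x}.indicator
      (fun t => ENNReal.ofReal (p * t ^ (p - 1))) t ∂μ ≤
      ENNReal.ofReal p * (A * ∫⁻ x, {z : α × ℝ | z.2 < F z.1}.indicator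
        (fun z => ENNReal.ofReal (F z.1) * ENNReal.ofReal (z.2 ^ (p - 1 - 1))) (x, t) ∂μ +
        B * ∫⁻ x, {z : α × ℝ | F z.1 ≤ z.2}.indicator
        (fun z => ENNReal.ofReal (F z.1) ^ q * ENNReal.ofReal (z.2 ^ (-(q - p) - 1))) (x, t) ∂μ)
      := by
    intro t ht
    have ht0 : 0 < t := ht
    have i1 : ∫⁻ x, {t : ℝ | ENNReal.ofReal (2 * t) < G x}.indicator
      (fun t => ENNReal.ofReal (p * t ^ (p - 1))) t ∂μ =
        ENNReal.ofReal (p * t ^ (p - 1)) * μ {x | ENNReal.ofReal (2 * t) < G x} := by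
      rw [← lintegral_indicator_const (measurableSet_lt measurable_const hG)]
      rfl
    have i2 : ∫⁻ x, {z : α × ℝ | z.2 < F z.1}.indicator
        (fun z => ENNReal.ofReal (F z.1) * ENNReal.ofReal (z.2 ^ (p - 1 - 1))) (x, t) ∂μ =
        (∫⁻ x in {x | t < F x}, ENNReal.ofReal (F x) ∂μ) * ENNReal.ofReal (t ^ (p - 1 - 1)) := by
      rw [← lintegral_mul_const' _ _ ENNReal.ofReal_ne_top,
        ← lintegral_indicator (measurableSet_lt measurable_const hF)]
      rfl
    have i3 : ∫⁻ x, {z : α × ℝ | F z.1 ≤ z.2}.indicator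
        (fun z => ENNReal.ofReal (F z.1) ^ q * ENNReal.ofReal (z.2 ^ (-(q - p) - 1))) (x, t) ∂μ =
        (∫⁻ x in {x | F x ≤ t}, ENNReal.ofReal (F x) ^ q ∂μ) *
          ENNReal.ofReal (t ^ (-(q - p) - 1)) := by
      rw [← lintegral_mul_const' _ _ ENNReal.ofReal_ne_top,
        ← lintegral_indicator (measurableSet_le hF measurable_const)]
      rfl
    rw [i1, i2, i3, ENNReal.ofReal_mul hp0.le, mul_assoc]
    gcongr
    refine (mul_le_mul_right (h t ht) _).trans (le_of_eq ?_)
    have r1 : t ^ (p - 1 - 1) = t ^ (p - 1) * t⁻¹ := by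
      rw [Real.rpow_sub_one ht0.ne', div_eq_mul_inv]
    have r2 : t ^ (-(q - p) - 1) = t ^ (p - 1) * t ^ (-q) := by
      rw [← Real.rpow_add ht0]; ring_nf
    rw [r1, r2, ENNReal.ofReal_mul (by positivity), ENNReal.ofReal_mul (by positivity)]
    ring
  have mA : Measurable ({z : α × ℝ | z.2 < F z.1}.indicator
        (fun z => ENNReal.ofReal (F z.1) * ENNReal.ofReal (z.2 ^ (p - 1 - 1)))) :=
    Measurable.indicator (by fun_prop) (measurableSet_lt (by fun_prop) (by fun_prop))
  have mB : Measurable ({z : α × ℝ | F z.1 ≤ z.2}.indicator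
        (fun z => ENNReal.ofReal (F z.1) ^ q * ENNReal.ofReal (z.2 ^ (-(q - p) - 1)))) :=
    Measurable.indicator (by fun_prop) (measurableSet_le (by fun_prop) (by fun_prop))
  have jA : ∫⁻ t in Ioi (0 : ℝ), ∫⁻ x, {z : α × ℝ | z.2 < F z.1}.indicator
        (fun z => ENNReal.ofReal (F z.1) * ENNReal.ofReal (z.2 ^ (p - 1 - 1))) (x, t) ∂μ =
      ENNReal.ofReal (p - 1)⁻¹ * ∫⁻ x, ENNReal.ofReal (F x) ^ p ∂μ := by
    rw [← lintegral_lintegral_swap (f := fun x t => {z : α × ℝ | z.2 < F z.1}.indicator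
        (fun z => ENNReal.ofReal (F z.1) * ENNReal.ofReal (z.2 ^ (p - 1 - 1))) (x, t))
        mA.aemeasurable, ← lintegral_const_mul' _ _ ENNReal.ofReal_ne_top]
    refine lintegral_congr fun x => ?_
    have : ∀ t ∈ Ioi (0 : ℝ), {z : α × ℝ | z.2 < F z.1}.indicator
        (fun z => ENNReal.ofReal (F z.1) * ENNReal.ofReal (z.2 ^ (p - 1 - 1))) (x, t) =
        ENNReal.ofReal (F x) * (Ioo 0 (F x)).indicator
          (fun t => ENNReal.ofReal (t ^ (p - 1 - 1))) t := by
      intro t ht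
      by_cases htF : t < F x
      · rw [indicator_of_mem (show (x, t) ∈ {z : α × ℝ | z.2 < F z.1} from htF),
          indicator_of_mem (show t ∈ Ioo 0 (F x) from ⟨ht, htF⟩)]
      · rw [indicator_of_notMem (show (x, t) ∉ {z : α × ℝ | z.2 < F z.1} from htF),
          indicator_of_notMem (show t ∉ Ioo 0 (F x) from fun h => htF h.2), mul_zero]
    rw [setLIntegral_congr_fun measurableSet_Ioi this, lintegral_const_mul' _ _
      ENNReal.ofReal_ne_top, lintegral_indicator measurableSet_Ioo,
      Measure.restrict_restrict measurableSet_Ioo, inter_eq_left.2 Ioo_subset_Ioi_self,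
      lintegral_Ioo_rpow (hF0 x) (by linarith), ENNReal.ofReal_rpow_of_nonneg (hF0 x) hp0.le,
      ← ENNReal.ofReal_mul (hF0 x), ← ENNReal.ofReal_mul (by simp; linarith)]
    congr 1
    have : F x ^ p = F x * F x ^ (p - 1) := by
      rcases (hF0 x).eq_or_lt with h0 | h0
      · rw [← h0, Real.zero_rpow hp0.ne', zero_mul]
      · rw [mul_comm, ← Real.rpow_add_one h0.ne', sub_add_cancel]
    rw [this]
    ring
  have jB : ∫⁻ t in Ioi (0 : ℝ), ∫⁻ x, {z : α × ℝ | F z.1 ≤ z.2}.indicator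
        (fun z => ENNReal.ofReal (F z.1) ^ q * ENNReal.ofReal (z.2 ^ (-(q - p) - 1))) (x, t) ∂μ =
      ENNReal.ofReal (q - p)⁻¹ * ∫⁻ x, ENNReal.ofReal (F x) ^ p ∂μ := by
    rw [← lintegral_lintegral_swap (f := fun x t => {z : α × ℝ | F z.1 ≤ z.2}.indicator
        (fun z => ENNReal.ofReal (F z.1) ^ q * ENNReal.ofReal (z.2 ^ (-(q - p) - 1))) (x, t))
        mB.aemeasurable, ← lintegral_const_mul' _ _ ENNReal.ofReal_ne_top]
    refine lintegral_congr fun x => ?_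
    rcases (hF0 x).eq_or_lt with h0 | h0
    · simp [← h0, ENNReal.zero_rpow_of_pos, hq0, hp0, indicator]
    have : ∀ t ∈ Ioi (0 : ℝ), {z : α × ℝ | F z.1 ≤ z.2}.indicator
        (fun z => ENNReal.ofReal (F z.1) ^ q * ENNReal.ofReal (z.2 ^ (-(q - p) - 1))) (x, t) =
        ENNReal.ofReal (F x) ^ q * (Ici (F x)).indicator
          (fun t => ENNReal.ofReal (t ^ (-(q - p) - 1))) t := by
      intro t ht
      by_cases htF : F x ≤ t
      · rw [indicator_of_mem (show (x, t) ∈ {z : α × ℝ | F z.1 ≤ z.2} from htF),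
          indicator_of_mem (show t ∈ Ici (F x) from htF)]
      · rw [indicator_of_notMem (show (x, t) ∉ {z : α × ℝ | F z.1 ≤ z.2} from htF),
          indicator_of_notMem (show t ∉ Ici (F x) from htF), mul_zero]
    rw [setLIntegral_congr_fun measurableSet_Ioi this, lintegral_const_mul' _ _
      (by finiteness), lintegral_indicator measurableSet_Ici,
      Measure.restrict_restrict measurableSet_Ici, inter_eq_left.2 (Ici_subset_Ioi.2 h0),
      Measure.restrict_congr_set Ioi_ae_eq_Ici.symm, lintegral_Ioi_rpow h0 (by linarith),
      ENNReal.ofReal_rpow_of_nonneg (hF0 x) hp0.le, ENNReal.ofReal_rpow_of_nonneg (hF0 x) hq0.le,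
      ← ENNReal.ofReal_mul (by positivity), ← ENNReal.ofReal_mul (by simp; linarith)]
    congr 1
    have : F x ^ p = F x ^ q * F x ^ (-(q - p)) := by
      rw [← Real.rpow_add h0]; ring_nf
    rw [this]
    ring
  calc _ ≤ 2 ^ p * ∫⁻ t in Ioi (0 : ℝ), ENNReal.ofReal p *
        (A * ∫⁻ x, {z : α × ℝ | z.2 < F z.1}.indicator
        (fun z => ENNReal.ofReal (F z.1) * ENNReal.ofReal (z.2 ^ (p - 1 - 1))) (x, t) ∂μ +
        B * ∫⁻ x, {z : α × ℝ | F z.1 ≤ z.2}.indicator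
        (fun z => ENNReal.ofReal (F z.1) ^ q * ENNReal.ofReal (z.2 ^ (-(q - p) - 1))) (x, t) ∂μ)
        := by
        refine mul_le_mul_right ?_ _
        exact setLIntegral_mono' measurableSet_Ioi e2
    _ = _ := by
        have mA' := mA.lintegral_prod_left' (μ := μ)
        have mB' := mB.lintegral_prod_left' (μ := μ)
        rw [lintegral_const_mul' _ _ ENNReal.ofReal_ne_top, lintegral_add_left (mA'.const_mul A),
          lintegral_const_mul _ mA', lintegral_const_mul _ mB', jA, jB]
        ring

end Marcinkiewicz

section Maximal

open Set Metric Module Filter Topology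

variable {E : Type*} [NormedAddCommGroup E] [InnerProductSpace ℝ E] [FiniteDimensional ℝ E]
  [MeasurableSpace E] [BorelSpace E]

/-- The centred Hardy–Littlewood maximal function. -/
noncomputable def maximal (u : E → ℝ≥0∞) (x : E) : ℝ≥0∞ :=
  ⨆ (r : ℝ) (_ : 0 < r), (volume (closedBall x r))⁻¹ * ∫⁻ y in closedBall x r, u y

lemma volume_closedBall_pos (x : E) {r : ℝ} (hr : 0 < r) : volume (closedBall x r) ≠ 0 :=
  (measure_closedBall_pos volume x hr).ne'

lemma volume_closedBall_ne_top (x : E) (r : ℝ) : volume (closedBall x r) ≠ ⊤ :=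
  measure_closedBall_lt_top.ne

lemma volume_closedBall_mul (x y : E) {c r : ℝ} (hc : 0 ≤ c) (hr : 0 ≤ r) :
    volume (closedBall x (c * r)) =
      ENNReal.ofReal c ^ finrank ℝ E * volume (closedBall y r) := by
  rw [Measure.addHaar_closedBall' _ _ (by positivity), Measure.addHaar_closedBall' _ y hr,
    ← mul_assoc, mul_pow, ENNReal.ofReal_mul (by positivity), ENNReal.ofReal_pow hc]

lemma setLIntegral_closedBall_le_maximal (u : E → ℝ≥0∞) (x : E) {r : ℝ} (hr : 0 < r) :
    ∫⁻ y in closedBall x r, u y ≤ volume (closedBall x r) * maximal u x := by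
  have h : (volume (closedBall x r))⁻¹ * ∫⁻ y in closedBall x r, u y ≤ maximal u x :=
    le_iSup₂ (f := fun (r : ℝ) (_ : 0 < r) =>
      (volume (closedBall x r))⁻¹ * ∫⁻ y in closedBall x r, u y) r hr
  rwa [mul_comm, ← div_eq_mul_inv, ENNReal.div_le_iff (volume_closedBall_pos x hr)
    (volume_closedBall_ne_top x r), mul_comm] at h

lemma lt_maximal_iff {u : E → ℝ≥0∞} {x : E} {c : ℝ≥0∞} : c < maximal u x ↔
    ∃ r : ℝ, 0 < r ∧ c * volume (closedBall x r) < ∫⁻ y in closedBall x r, u y := by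
  simp only [maximal, lt_iSup_iff, exists_prop]
  refine exists_congr fun r => and_congr_right fun hr => ?_
  rw [mul_comm, ← div_eq_mul_inv,
    ENNReal.lt_div_iff_mul_lt (Or.inl (volume_closedBall_pos x hr))
      (Or.inl (volume_closedBall_ne_top x r))]

lemma isOpen_lt_maximal (u : E → ℝ≥0∞) {c : ℝ≥0∞} (hc : c ≠ ⊤) : IsOpen {x | c < maximal u x} := by
  rw [isOpen_iff_mem_nhds]
  intro x hx
  obtain ⟨r, hr, h⟩ := lt_maximal_iff.1 hx
  have hcont : Tendsto (fun δ : ℝ => c * (ENNReal.ofReal ((r + δ) ^ finrank ℝ E) *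
      volume (closedBall (0 : E) 1))) (𝓝[>] 0) (𝓝 (c * volume (closedBall x r))) := by
    rw [Measure.addHaar_closedBall' _ _ hr.le]
    refine ENNReal.Tendsto.const_mul (ENNReal.Tendsto.mul_const ?_
      (Or.inr (volume_closedBall_ne_top _ _))) (Or.inr hc)
    have : Continuous fun δ : ℝ => ENNReal.ofReal ((r + δ) ^ finrank ℝ E) :=
      ENNReal.continuous_ofReal.comp (by fun_prop)
    simpa using (this.tendsto 0).mono_left nhdsWithin_le_nhds
  obtain ⟨δ, hδ, hδ0⟩ := ((hcont.eventually_lt_const h).and self_mem_nhdsWithin).exists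
  have hδ0 : 0 < δ := hδ0
  refine mem_of_superset (ball_mem_nhds x hδ0) fun y hy => ?_
  refine lt_maximal_iff.2 ⟨r + δ, by linarith, ?_⟩
  rw [Measure.addHaar_closedBall' _ _ (by linarith)]
  refine hδ.trans_le (lintegral_mono_set (closedBall_subset_closedBall' ?_))
  rw [dist_comm]
  linarith [mem_ball.1 hy]

lemma measurable_maximal (u : E → ℝ≥0∞) : Measurable (maximal u) := by
  refine measurable_of_Ioi fun c => ?_
  rcases eq_or_ne c ⊤ with rfl | hc
  · simp
  · exact (isOpen_lt_maximal u hc).measurableSet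

lemma maximal_add_le {u v : E → ℝ≥0∞} (hu : Measurable u) (x : E) :
    maximal (fun y => u y + v y) x ≤ maximal u x + maximal v x := by
  refine iSup₂_le fun r hr => ?_
  rw [lintegral_add_left hu, mul_add]
  gcongr
  · exact le_iSup₂ (f := fun (r : ℝ) (_ : 0 < r) =>
      (volume (closedBall x r))⁻¹ * ∫⁻ y in closedBall x r, u y) r hr
  · exact le_iSup₂ (f := fun (r : ℝ) (_ : 0 < r) =>
      (volume (closedBall x r))⁻¹ * ∫⁻ y in closedBall x r, v y) r hr

lemma maximal_mono {u v : E → ℝ≥0∞} (h : ∀ x, u x ≤ v x) (x : E) : maximal u x ≤ maximal v x :=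
  iSup₂_mono fun _ _ => mul_le_mul_right (lintegral_mono h) _

lemma maximal_le_of_le {u : E → ℝ≥0∞} {c : ℝ≥0∞} (h : ∀ x, u x ≤ c) (x : E) :
    maximal u x ≤ c := by
  refine iSup₂_le fun r hr => ?_
  calc _ ≤ (volume (closedBall x r))⁻¹ * ∫⁻ y in closedBall x r, c := by
        gcongr with y; exact h y
    _ = c := by
        rw [setLIntegral_const, mul_comm c, ← mul_assoc, ENNReal.inv_mul_cancel
          (volume_closedBall_pos x hr) (volume_closedBall_ne_top x r), one_mul]

/-- A bound on the radii of the balls of bounded volume. -/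
lemma exists_radius_bound [Nontrivial E] {c : ℝ≥0∞} (hc : c ≠ ⊤) :
    ∃ R : ℝ, ∀ (x : E) (r : ℝ), volume (closedBall x r) ≤ c → r ≤ R := by
  set w := volume (closedBall (0 : E) 1) with hw
  have hw0 : w ≠ 0 := volume_closedBall_pos _ one_pos
  have hwt : w ≠ ⊤ := volume_closedBall_ne_top _ _
  refine ⟨max 1 (c / w).toReal, fun x r h => ?_⟩
  by_cases hr : r ≤ 1
  · exact hr.trans (le_max_left _ _)
  refine le_trans ?_ (le_max_right _ _)
  rw [Measure.addHaar_closedBall' _ _ (by linarith), ← ENNReal.le_div_iff_mul_le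
    (Or.inl hw0) (Or.inl hwt)] at h
  have h2 : r ≤ r ^ finrank ℝ E := le_self_pow₀ (by linarith) finrank_pos.ne'
  have h3 := ENNReal.toReal_mono (ENNReal.div_ne_top hc hw0) h
  rw [ENNReal.toReal_ofReal (pow_nonneg (by linarith) _)] at h3
  exact h2.trans h3

/-- The weak type `(1, 1)` inequality for the Hardy–Littlewood maximal function. -/
theorem mul_volume_lt_maximal_le [Nontrivial E] (u : E → ℝ≥0∞) {c : ℝ≥0∞} (hc0 : c ≠ 0)
    (hc : c ≠ ⊤) : c * volume {x | c < maximal u x} ≤ 5 ^ finrank ℝ E * ∫⁻ x, u x := by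
  rcases eq_or_ne (∫⁻ x, u x) ⊤ with hu | hu
  · rw [hu, ENNReal.mul_top (by positivity)]; exact le_top
  have hx : ∀ x : E, ∃ r : ℝ, x ∈ {x | c < maximal u x} → 0 < r ∧
      c * volume (closedBall x r) < ∫⁻ y in closedBall x r, u y := by
    intro x
    by_cases h : x ∈ {x | c < maximal u x}
    · obtain ⟨r, hr⟩ := lt_maximal_iff.1 h
      exact ⟨r, fun _ => hr⟩
    · exact ⟨0, fun h' => (h h').elim⟩
  choose r hr using hx
  obtain ⟨R, hR⟩ := exists_radius_bound (E := E) (ENNReal.div_ne_top hu hc0)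
  obtain ⟨t, ht, hdisj, hcov⟩ := Vitali.exists_disjoint_subfamily_covering_enlargement_closedBall
    {x | c < maximal u x} (fun x => x) r R (fun x hx => hR x _ (by
      rw [ENNReal.le_div_iff_mul_le (Or.inl hc0) (Or.inl hc), mul_comm]
      exact (hr x hx).2.le.trans (setLIntegral_le_lintegral _ _))) 5 (by norm_num)
  have htc : t.Countable := hdisj.countable_of_nonempty_interior fun x hx => by
    exact ⟨x, ball_subset_interior_closedBall (mem_ball_self (hr x (ht hx)).1)⟩
  have hsub : {x | c < maximal u x} ⊆ ⋃ x ∈ t, closedBall x (5 * r x) := fun x hx => by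
    obtain ⟨y, hy, hxy⟩ := hcov x hx
    exact mem_biUnion hy (hxy (mem_closedBall_self (hr x hx).1.le))
  calc c * volume {x | c < maximal u x} ≤ c * ∑' x : t, volume (closedBall (x : E) (5 * r x)) := by
        gcongr
        exact (measure_mono hsub).trans (measure_biUnion_le _ htc _)
    _ = ∑' x : t, 5 ^ finrank ℝ E * (c * volume (closedBall (x : E) (r x))) := by
        rw [← ENNReal.tsum_mul_left]
        congr 1 with x
        rw [volume_closedBall_mul (x : E) (x : E) (by norm_num) (hr x (ht x.2)).1.le]
        norm_num
        ring
    _ ≤ ∑' x : t, 5 ^ finrank ℝ E * ∫⁻ y in closedBall (x : E) (r x), u y := by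
        gcongr with x
        exact (hr x (ht x.2)).2.le
    _ = 5 ^ finrank ℝ E * ∫⁻ y in ⋃ x ∈ t, closedBall (x : E) (r x), u y := by
        rw [ENNReal.tsum_mul_left, lintegral_biUnion htc
          (fun x _ => isClosed_closedBall.measurableSet) hdisj]
    _ ≤ _ := mul_le_mul_right (setLIntegral_le_lintegral _ _) _

/-- The Hardy–Littlewood maximal inequality. -/
theorem exists_lintegral_maximal_rpow_le [Nontrivial E] {p : ℝ} (hp : 1 < p) :
    ∃ C : ℝ≥0∞, C ≠ ⊤ ∧ ∀ f : E → ℝ, Measurable f → (∀ x, 0 ≤ f x) →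
      ∫⁻ x, maximal (fun y => ENNReal.ofReal (f y)) x ^ p ≤
        C * ∫⁻ x, ENNReal.ofReal (f x) ^ p := by
  refine ⟨_, ?_, fun f hf hf0 => lintegral_rpow_le_of_weak_type hf hf0 (measurable_maximal _) hp
    (lt_add_one p) (5 ^ finrank ℝ E) 0 fun t ht => ?_⟩
  · finiteness
  have hle : ∀ x, maximal (fun y => ENNReal.ofReal (f y)) x ≤
      maximal ({x | t < f x}.indicator fun y => ENNReal.ofReal (f y)) x + ENNReal.ofReal t := by
    intro x
    have hm : Measurable ({x | t < f x}.indicator fun y => ENNReal.ofReal (f y)) :=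
      (by fun_prop : Measurable _).indicator (measurableSet_lt measurable_const hf)
    calc _ ≤ maximal (fun y => {x | t < f x}.indicator (fun y => ENNReal.ofReal (f y)) y +
          ENNReal.ofReal t) x := maximal_mono (fun y => by
            by_cases hy : t < f y
            · rw [indicator_of_mem (by exact hy)]; exact le_self_add
            · rw [indicator_of_notMem (by exact hy), zero_add]
              exact ENNReal.ofReal_le_ofReal (not_lt.1 hy)) x
      _ ≤ _ := (maximal_add_le hm x).trans (by gcongr; exact maximal_le_of_le (fun _ => le_rfl) x)
  have ht' : ENNReal.ofReal t ≠ 0 := by simpa using ht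
  have h1 := mul_volume_lt_maximal_le ({x | t < f x}.indicator fun y => ENNReal.ofReal (f y))
    ht' ENNReal.ofReal_ne_top
  rw [lintegral_indicator (measurableSet_lt measurable_const hf)] at h1
  rw [zero_mul, zero_mul, add_zero, ENNReal.ofReal_inv_of_pos ht, mul_right_comm,
    ← div_eq_mul_inv, ENNReal.le_div_iff_mul_le (Or.inl ht') (Or.inl ENNReal.ofReal_ne_top),
    mul_comm]
  refine le_trans ?_ h1
  refine mul_le_mul_right (measure_mono fun x hx => ?_) _
  have hx : ENNReal.ofReal (2 * t) < _ := hx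
  have := hx.trans_le (hle x)
  rw [two_mul, ENNReal.ofReal_add ht.le ht.le] at this
  exact (ENNReal.add_lt_add_iff_right ENNReal.ofReal_ne_top).1 this

end Maximal

section Domination

open Set Metric Module

variable {E : Type*} [NormedAddCommGroup E] [InnerProductSpace ℝ E] [FiniteDimensional ℝ E]
  [MeasurableSpace E] [BorelSpace E]

/-- The `L¹`-normalized dyadic dilation of a kernel. -/
noncomputable def dilate (k : E → ℂ) (j : ℤ) (x : E) : ℂ :=
  ((((2 : ℝ) ^ j) ^ finrank ℝ E : ℝ) : ℂ) * k ((2 : ℝ) ^ j • x)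

/-- Convolution with a dyadic dilation of a kernel. -/
noncomputable def conv (k : E → ℂ) (j : ℤ) (f : E → ℂ) (x : E) : ℂ :=
  ∫ y, dilate k j (x - y) * f y

lemma exists_pow_near (a : ℝ) (ha : 0 ≤ a) : ∃ m : ℕ, a ≤ 2 ^ m ∧ (2 : ℝ) ^ m ≤ 2 * (1 + a) := by
  obtain ⟨n, h1, h2⟩ := exists_nat_pow_near (x := 1 + a) (y := 2) (by linarith) (by norm_num)
  exact ⟨n + 1, by linarith, by rw [pow_succ]; linarith⟩

lemma exists_decay (k : 𝓢(E, ℂ)) (m : ℕ) :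
    ∃ C : ℝ, 0 < C ∧ ∀ x, (1 + ‖x‖) ^ m * ‖k x‖ ≤ C := by
  have key := fun x => SchwartzMap.one_add_le_sup_seminorm_apply (𝕜 := ℂ) (m := (m, 0)) le_rfl
    le_rfl k x
  simp only [norm_iteratedFDeriv_zero] at key
  exact ⟨_, lt_of_le_of_lt (abs_nonneg _) (lt_add_one _), fun x =>
    (key x).trans ((le_abs_self _).trans (lt_add_one _).le)⟩

/-- Convolution with an integrably decaying dilated kernel is controlled by the maximal function,
uniformly in the scale. -/
theorem exists_lintegral_dilate_le_maximal (k : 𝓢(E, ℂ)) :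
    ∃ A : ℝ≥0∞, A ≠ ⊤ ∧ ∀ (j : ℤ) (u : E → ℝ≥0∞), Measurable u → ∀ x,
      ∫⁻ y, ‖dilate k j (x - y)‖ₑ * u y ≤ A * maximal u x := by
  set n := finrank ℝ E
  obtain ⟨C, hC, hk⟩ := exists_decay k (n + 1)
  refine ⟨ENNReal.ofReal (C * 2 ^ (n + 1)) * 2 * volume (closedBall (0 : E) 1), ?_,
    fun j u hu x => ?_⟩
  · have := volume_closedBall_ne_top (0 : E) 1
    finiteness
  set l : ℝ := (2 : ℝ) ^ j with hl
  have hl0 : 0 < l := by positivity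
  have hpt : ∀ y, ‖dilate k j (x - y)‖ₑ * u y ≤
      ∑' m : ℕ, ENNReal.ofReal (C * 2 ^ (n + 1) * l ^ n * ((2 : ℝ) ^ m)⁻¹ ^ (n + 1)) *
        (closedBall x (2 ^ m * l⁻¹)).indicator u y := by
    intro y
    obtain ⟨m, h1, h2⟩ := exists_pow_near ‖l • (x - y)‖ (norm_nonneg _)
    refine le_trans ?_ (ENNReal.le_tsum m)
    have hy : y ∈ closedBall x (2 ^ m * l⁻¹) := by
      rw [mem_closedBall, dist_comm, dist_eq_norm, ← div_eq_mul_inv, le_div_iff₀ hl0]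
      rwa [norm_smul, Real.norm_of_nonneg hl0.le, mul_comm] at h1
    rw [indicator_of_mem hy]
    gcongr
    rw [← ofReal_norm]
    refine ENNReal.ofReal_le_ofReal ?_
    rw [dilate, norm_mul, Complex.norm_real, Real.norm_of_nonneg (by positivity), ← hl]
    have h3 := hk (l • (x - y))
    have h4 : ((2 : ℝ) ^ m) ^ (n + 1) ≤ 2 ^ (n + 1) * (1 + ‖l • (x - y)‖) ^ (n + 1) := by
      rw [← mul_pow]; gcongr
    have h5 : ‖k (l • (x - y))‖ ≤ C * 2 ^ (n + 1) * ((2 : ℝ) ^ m)⁻¹ ^ (n + 1) := by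
      rw [inv_pow, ← div_eq_mul_inv, le_div_iff₀ (by positivity)]
      calc _ ≤ ‖k (l • (x - y))‖ * (2 ^ (n + 1) * (1 + ‖l • (x - y)‖) ^ (n + 1)) := by gcongr
        _ = (1 + ‖l • (x - y)‖) ^ (n + 1) * ‖k (l • (x - y))‖ * 2 ^ (n + 1) := by ring
        _ ≤ _ := by gcongr
    calc _ ≤ l ^ n * (C * 2 ^ (n + 1) * ((2 : ℝ) ^ m)⁻¹ ^ (n + 1)) := by gcongr
      _ = _ := by ring
  calc ∫⁻ y, ‖dilate k j (x - y)‖ₑ * u y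
      ≤ ∫⁻ y, ∑' m : ℕ, ENNReal.ofReal (C * 2 ^ (n + 1) * l ^ n * ((2 : ℝ) ^ m)⁻¹ ^ (n + 1)) *
        (closedBall x (2 ^ m * l⁻¹)).indicator u y := lintegral_mono hpt
    _ = ∑' m : ℕ, ENNReal.ofReal (C * 2 ^ (n + 1) * l ^ n * ((2 : ℝ) ^ m)⁻¹ ^ (n + 1)) *
        ∫⁻ y in closedBall x (2 ^ m * l⁻¹), u y := by
        rw [lintegral_tsum fun m => ((hu.indicator
          isClosed_closedBall.measurableSet).const_mul _).aemeasurable]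
        congr 1 with m
        rw [lintegral_const_mul' _ _ ENNReal.ofReal_ne_top,
          lintegral_indicator isClosed_closedBall.measurableSet]
    _ ≤ ∑' m : ℕ, ENNReal.ofReal (C * 2 ^ (n + 1)) * (2⁻¹ : ℝ≥0∞) ^ m *
        volume (closedBall (0 : E) 1) * maximal u x := by
        refine ENNReal.tsum_le_tsum fun m => ?_
        refine (mul_le_mul_right (setLIntegral_closedBall_le_maximal u x (by positivity)) _).trans
          (le_of_eq ?_)
        rw [Measure.addHaar_closedBall' _ _ (by positivity), ← mul_assoc, ← mul_assoc,
          ← ENNReal.ofReal_mul (by positivity)]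
        have : C * 2 ^ (n + 1) * l ^ n * ((2 : ℝ) ^ m)⁻¹ ^ (n + 1) * (2 ^ m * l⁻¹) ^ n =
            C * 2 ^ (n + 1) * (2⁻¹ : ℝ) ^ m := by
          rw [mul_pow, inv_pow l, inv_pow (2 : ℝ), pow_succ ((2 : ℝ) ^ m)⁻¹, inv_pow]
          field_simp
        rw [this, ENNReal.ofReal_mul (by positivity), ENNReal.ofReal_pow (by positivity),
          ENNReal.ofReal_inv_of_pos (by norm_num), ENNReal.ofReal_ofNat]
    _ = _ := by
        rw [ENNReal.tsum_mul_right, ENNReal.tsum_mul_right, ENNReal.tsum_mul_left,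
          ENNReal.tsum_geometric, ENNReal.one_sub_inv_two, inv_inv]

theorem exists_enorm_conv_le_maximal (k : 𝓢(E, ℂ)) :
    ∃ A : ℝ≥0∞, A ≠ ⊤ ∧ ∀ (j : ℤ) (f : E → ℂ), Measurable f → ∀ x,
      ‖conv k j f x‖ₑ ≤ A * maximal (fun y => ‖f y‖ₑ) x := by
  obtain ⟨A, hA, h⟩ := exists_lintegral_dilate_le_maximal k
  refine ⟨A, hA, fun j f hf x => ?_⟩
  refine (enorm_integral_le_lintegral_enorm _).trans ?_
  simp_rw [enorm_mul]
  exact h j _ hf.enorm x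

end Domination

section CZDecomposition

open Set Metric Module Filter Topology

variable {E : Type*} [NormedAddCommGroup E] [InnerProductSpace ℝ E] [FiniteDimensional ℝ E]
  [MeasurableSpace E] [BorelSpace E]

lemma ae_le_maximal {u : E → ℝ≥0∞} (hu : Measurable u) (hi : ∫⁻ x, u x ≠ ⊤) :
    ∀ᵐ x, u x ≤ maximal u x := by
  filter_upwards [(IsUnifLocDoublingMeasure.vitaliFamily (volume : Measure E)
    1).ae_tendsto_lintegral_div hu.aemeasurable hi] with x hx
  have h := IsUnifLocDoublingMeasure.tendsto_closedBall_filterAt (volume : Measure E) (K := 1)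
    (x := x) (l := 𝓝[>] (0 : ℝ)) (fun _ => x) id tendsto_id (by
      filter_upwards [self_mem_nhdsWithin] with r hr
      exact mem_closedBall_self (by simpa using (mem_Ioi.1 hr).le))
  refine le_of_tendsto (hx.comp h) ?_
  filter_upwards [self_mem_nhdsWithin] with r hr
  simp only [Function.comp, id, div_eq_mul_inv]
  rw [mul_comm]
  exact le_iSup₂ (f := fun (r : ℝ) (_ : 0 < r) =>
      (volume (closedBall x r))⁻¹ * ∫⁻ y in closedBall x r, u y) r hr

/-- A Calderón–Zygmund covering of the level sets of the maximal function. -/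
lemma exists_cz_covering [Nontrivial E] {u : E → ℝ≥0∞} (hi : ∫⁻ x, u x ≠ ⊤)
    {c : ℝ≥0∞} (hc0 : c ≠ 0) (hc : c ≠ ⊤) :
    ∃ (S : Set E) (r : E → ℝ) (P : E → Set E), S.Countable ∧ (∀ x ∈ S, 0 < r x) ∧
      S.PairwiseDisjoint (fun x => closedBall x (r x)) ∧
      (∀ x ∈ S, closedBall x (r x) ⊆ {x | c < maximal u x}) ∧
      (∀ x ∈ S, MeasurableSet (P x)) ∧ S.PairwiseDisjoint P ∧
      (∀ x ∈ S, P x ⊆ closedBall x (5 * r x)) ∧ (⋃ x ∈ S, P x) = {x | c < maximal u x} ∧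
      ∀ x ∈ S, ∫⁻ y in P x, u y ≤ c * (15 ^ finrank ℝ E * volume (closedBall x (r x))) := by
  set Ω := {x | c < maximal u x} with hΩ
  have hΩo : IsOpen Ω := isOpen_lt_maximal u hc
  have hΩv : volume Ω ≠ ⊤ := by
    intro h
    have := mul_volume_lt_maximal_le u hc0 hc
    rw [← hΩ, h, ENNReal.mul_top hc0, top_le_iff] at this
    exact (ENNReal.mul_ne_top (by finiteness) hi) this
  have hne : Ωᶜ.Nonempty := by
    by_contra h
    rw [not_nonempty_iff_eq_empty, compl_empty_iff] at h
    exact hΩv (h ▸ measure_univ_of_isAddLeftInvariant volume)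
  set r : E → ℝ := fun x => infDist x Ωᶜ / 10 with hr
  have hr0 : ∀ x ∈ Ω, 0 < r x := fun x hx => by
    have := (hΩo.isClosed_compl.notMem_iff_infDist_pos hne).1 (notMem_compl_iff.2 hx)
    simp only [hr]; linarith
  have hsub : ∀ x ∈ Ω, closedBall x (5 * r x) ⊆ Ω := fun x hx y hy => by
    by_contra h
    have h1 := infDist_le_dist_of_mem (x := x) (mem_compl h)
    have h2 := mem_closedBall'.1 hy
    have h3 := hr0 x hx
    simp only [hr] at h2 h3
    linarith
  have hsub' : ∀ x ∈ Ω, closedBall x (r x) ⊆ Ω := fun x hx =>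
    (closedBall_subset_closedBall (by linarith [hr0 x hx])).trans (hsub x hx)
  obtain ⟨R, hR⟩ := exists_radius_bound (E := E) hΩv
  obtain ⟨S, hS, hdisj, hcov⟩ := Vitali.exists_disjoint_subfamily_covering_enlargement_closedBall
    Ω (fun x => x) r R (fun x hx => hR x _ (measure_mono (hsub' x hx))) 5 (by norm_num)
  have hSc : S.Countable := hdisj.countable_of_nonempty_interior fun x hx =>
    ⟨x, ball_subset_interior_closedBall (mem_ball_self (hr0 x (hS hx)))⟩
  obtain ⟨e, he⟩ := Set.countable_iff_exists_injOn.1 hSc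
  set P : E → Set E := fun x =>
    closedBall x (5 * r x) \ ⋃ y ∈ {y ∈ S | e y < e x}, closedBall y (5 * r y)
  refine ⟨S, r, P, hSc, fun x hx => hr0 x (hS hx), hdisj, fun x hx => hsub' x (hS hx),
    fun x _ => ?_, ?_, fun x _ => sdiff_subset, ?_, ?_⟩
  · exact isClosed_closedBall.measurableSet.diff (MeasurableSet.biUnion
      (hSc.mono (sep_subset _ _)) fun y _ => isClosed_closedBall.measurableSet)
  · have key : ∀ x ∈ S, ∀ y ∈ S, e x < e y → Disjoint (P x) (P y) := fun x hx y hy h =>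
      Set.disjoint_left.2 fun z hz hz' => hz'.2 (mem_biUnion (x := x) ⟨hx, h⟩ hz.1)
    intro x hx y hy hxy
    rcases lt_trichotomy (e x) (e y) with h | h | h
    · exact key x hx y hy h
    · exact (hxy (he hx hy h)).elim
    · exact (key y hy x hx h).symm
  · refine Subset.antisymm (iUnion₂_subset fun x hx => sdiff_subset.trans (hsub x (hS hx)))
      fun x hx => ?_
    obtain ⟨y, hy, hxy⟩ := hcov x hx
    have hex : ∃ n, ∃ y ∈ S, e y = n ∧ x ∈ closedBall y (5 * r y) :=
      ⟨e y, y, hy, rfl, hxy (mem_closedBall_self (hr0 x hx).le)⟩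
    classical
    obtain ⟨z, hz, hzn, hxz⟩ := Nat.find_spec hex
    refine mem_biUnion hz ⟨hxz, fun h => ?_⟩
    obtain ⟨w, hw, hxw⟩ := mem_iUnion₂.1 h
    exact Nat.find_min hex (hzn ▸ hw.2) ⟨w, hw.1, rfl, hxw⟩
  · intro x hx
    have hx0 := hr0 x (hS hx)
    obtain ⟨z, hz, hxz⟩ := hΩo.isClosed_compl.exists_infDist_eq_dist hne x
    calc ∫⁻ y in P x, u y ≤ ∫⁻ y in closedBall z (15 * r x), u y := by
          refine lintegral_mono_set (sdiff_subset.trans (closedBall_subset_closedBall' ?_))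
          rw [← hxz]; simp only [hr]; linarith
      _ ≤ volume (closedBall z (15 * r x)) * maximal u z :=
          setLIntegral_closedBall_le_maximal u z (by linarith)
      _ ≤ volume (closedBall z (15 * r x)) * c :=
        mul_le_mul_right (not_lt.1 (show ¬ c < maximal u z from hz)) _
      _ = _ := by
          rw [volume_closedBall_mul z x (by norm_num) hx0.le, mul_comm]; norm_num

end CZDecomposition

section CZDecomposition

open Set Metric Module Filter Topology

lemma summable_indicator_of_pairwise_disjoint {α ι V : Type*} [NormedAddCommGroup V]
    {A : ι → Set α} (hA : Pairwise fun i j => Disjoint (A i) (A j)) (φ : ι → α → V) (y : α) :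
    Summable fun i => (A i).indicator (φ i) y := by
  refine summable_of_hasFiniteSupport (Set.Subsingleton.finite fun i hi j hj => ?_)
  by_contra h
  exact Set.disjoint_left.1 (hA h) (mem_of_indicator_ne_zero hi) (mem_of_indicator_ne_zero hj)

lemma tsum_indicator_of_mem {α ι V : Type*} [NormedAddCommGroup V]
    {A : ι → Set α} (hA : Pairwise fun i j => Disjoint (A i) (A j)) (φ : ι → α → V) {y : α}
    {i : ι} (hi : y ∈ A i) : ∑' i, (A i).indicator (φ i) y = φ i y := by
  rw [tsum_eq_single i fun j hj => indicator_of_notMem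
    (fun h => Set.disjoint_left.1 (hA hj) h hi) _, indicator_of_mem hi]

variable {E : Type*} [NormedAddCommGroup E] [InnerProductSpace ℝ E] [FiniteDimensional ℝ E]
  [MeasurableSpace E] [BorelSpace E]
  {V : Type*} [NormedAddCommGroup V] [NormedSpace ℝ V] [CompleteSpace V]

/-- The Calderón–Zygmund decomposition of an integrable function at height `c`. -/
lemma exists_cz_decomposition [Nontrivial E] {f : E → V} (hf : StronglyMeasurable f)
    (hi : Integrable f) {c : ℝ≥0∞} (hc0 : c ≠ 0) (hc : c ≠ ⊤) :
    ∃ (S : Set E) (r : E → ℝ) (g : E → V) (b : S → E → V), S.Countable ∧ (∀ x ∈ S, 0 < r x) ∧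
      StronglyMeasurable g ∧ (∀ x, StronglyMeasurable (b x)) ∧
      (∀ᵐ y, ‖g y‖ₑ ≤ 2 * 15 ^ finrank ℝ E * c) ∧ (∫⁻ y, ‖g y‖ₑ ≤ 2 * ∫⁻ y, ‖f y‖ₑ) ∧
      (∀ y, HasSum (fun x => b x y) (f y - g y)) ∧
      (∀ (x : S), ∀ y ∉ closedBall (x : E) (5 * r x), b x y = 0) ∧
      (∀ x, ∫ y, b x y = 0) ∧ (∑' x, ∫⁻ y, ‖b x y‖ₑ ≤ 2 * ∫⁻ y, ‖f y‖ₑ) ∧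
      (c * ∑' x : S, volume (closedBall (x : E) (r x)) ≤ 5 ^ finrank ℝ E * ∫⁻ y, ‖f y‖ₑ) := by
  set u : E → ℝ≥0∞ := fun y => ‖f y‖ₑ with hu
  have hum : Measurable u := hf.enorm
  have hui : ∫⁻ x, u x ≠ ⊤ := hi.2.ne
  obtain ⟨S, r, P, hSc, hr, hBd, hBΩ, hPm, hPd, hPB, hPΩ, hPu⟩ := exists_cz_covering hui hc0 hc
  set Ω := {x | c < maximal u x} with hΩ
  have hΩm : MeasurableSet Ω := measurableSet_lt measurable_const (measurable_maximal u)
  have : Countable S := hSc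
  set B : S → Set E := fun x => closedBall (x : E) (r x) with hB
  set Q : S → Set E := fun x => P x with hQ
  have hBd' : Pairwise fun i j => Disjoint (B i) (B j) := fun i j h =>
    hBd i.2 j.2 (Subtype.coe_injective.ne h)
  have hQd' : Pairwise fun i j => Disjoint (Q i) (Q j) := fun i j h =>
    hPd i.2 j.2 (Subtype.coe_injective.ne h)
  have hQΩ : ⋃ x, Q x = Ω := by rw [← hPΩ, biUnion_eq_iUnion]
  have hBm : ∀ x, MeasurableSet (B x) := fun x => isClosed_closedBall.measurableSet
  have hQm : ∀ x, MeasurableSet (Q x) := fun x => hPm x x.2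
  have hB0 : ∀ x, volume (B x) ≠ 0 := fun x => volume_closedBall_pos _ (hr x x.2)
  have hBt : ∀ x, volume (B x) ≠ ⊤ := fun x => volume_closedBall_ne_top _ _
  set a : S → V := fun x => (volume (B x)).toReal⁻¹ • ∫ y in Q x, f y with ha
  have hae : ∀ x, volume (B x) * ‖a x‖ₑ ≤ ∫⁻ y in Q x, u y := fun x => by
    rw [ha, enorm_smul, Real.enorm_of_nonneg (by positivity), ENNReal.ofReal_inv_of_pos
      (ENNReal.toReal_pos (hB0 x) (hBt x)), ENNReal.ofReal_toReal (hBt x), ← mul_assoc,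
      ENNReal.mul_inv_cancel (hB0 x) (hBt x), one_mul]
    exact enorm_integral_le_lintegral_enorm _
  have hac : ∀ x, ‖a x‖ₑ ≤ 15 ^ finrank ℝ E * c := fun x => by
    have h1 := (hae x).trans (hPu x x.2)
    rw [mul_comm, ← ENNReal.le_div_iff_mul_le (Or.inl (hB0 x)) (Or.inl (hBt x))] at h1
    refine h1.trans (le_of_eq ?_)
    rw [← mul_assoc, mul_div_assoc, ENNReal.div_self (hB0 x) (hBt x), mul_one, mul_comm]
  have hQsum : ∑' x, ∫⁻ y in Q x, u y ≤ ∫⁻ y, u y := by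
    rw [← lintegral_iUnion hQm hQd']
    exact setLIntegral_le_lintegral _ _
  set s : E → V := fun y => ∑' x, (B x).indicator (fun _ => a x) y with hs
  have hsm : StronglyMeasurable s := by
    refine stronglyMeasurable_of_tendsto (atTop : Filter (Finset S))
      (f := fun F y => ∑ x ∈ F, (B x).indicator (fun _ => a x) y) (fun F => ?_) ?_
    · exact Finset.stronglyMeasurable_fun_sum _ fun x _ =>
        stronglyMeasurable_const.indicator (hBm x)
    · exact tendsto_pi_nhds.2 fun y =>
        (summable_indicator_of_pairwise_disjoint hBd' _ y).hasSum
  have hsc : ∀ y, ‖s y‖ₑ ≤ 15 ^ finrank ℝ E * c := fun y => by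
    by_cases h : ∃ x, y ∈ B x
    · obtain ⟨x, hx⟩ := h
      rw [hs]
      simp only
      rw [tsum_indicator_of_mem hBd' (fun x _ => a x) hx]
      exact hac x
    · have : s y = 0 := by
        simp only [hs]
        rw [tsum_congr (fun x => indicator_of_notMem (fun hx => h ⟨x, hx⟩) _), tsum_zero]
      simp [this]
  have hsi : ∫⁻ y, ‖s y‖ₑ ≤ ∫⁻ y, u y := by
    calc _ ≤ ∫⁻ y, ∑' x, (B x).indicator (fun _ => ‖a x‖ₑ) y := by
          refine lintegral_mono fun y => enorm_tsum_le_tsum_enorm.trans (le_of_eq ?_)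
          congr 1 with x
          exact enorm_indicator_eq_indicator_enorm _ _
      _ = ∑' x, volume (B x) * ‖a x‖ₑ := by
          rw [lintegral_tsum fun x => (measurable_const.indicator (hBm x)).aemeasurable]
          congr 1 with x
          rw [lintegral_indicator_const (hBm x), mul_comm]
      _ ≤ _ := (ENNReal.tsum_le_tsum hae).trans hQsum
  have hgle : ∀ y, ‖Ωᶜ.indicator f y + s y‖ₑ ≤ Ωᶜ.indicator u y + ‖s y‖ₑ := fun y =>
    (enorm_add_le _ _).trans (by rw [enorm_indicator_eq_indicator_enorm])
  refine ⟨S, r, fun y => Ωᶜ.indicator f y + s y,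
    fun x y => (Q x).indicator f y - (B x).indicator (fun _ => a x) y, hSc, hr,
    (hf.indicator hΩm.compl).add hsm,
    fun x => (hf.indicator (hQm x)).sub (stronglyMeasurable_const.indicator (hBm x)),
    ?_, ?_, fun y => ?_, fun x y hy => ?_, fun x => ?_, ?_, ?_⟩
  · filter_upwards [ae_le_maximal hum hui] with y hy
    refine (hgle y).trans ?_
    have h1 : Ωᶜ.indicator u y ≤ 15 ^ finrank ℝ E * c := by
      by_cases h : c < maximal u y
      · rw [indicator_of_notMem (by simpa [hΩ] using h)]; exact zero_le
      · rw [indicator_of_mem (by simpa [hΩ] using h)]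
        refine (hy.trans (not_lt.1 h)).trans (le_mul_of_one_le_left zero_le ?_)
        exact one_le_pow₀ (by norm_num)
    calc _ ≤ 15 ^ finrank ℝ E * c + 15 ^ finrank ℝ E * c := add_le_add h1 (hsc y)
      _ = _ := by ring
  · calc _ ≤ ∫⁻ y, (Ωᶜ.indicator u y + ‖s y‖ₑ) := lintegral_mono hgle
      _ = (∫⁻ y in Ωᶜ, u y) + ∫⁻ y, ‖s y‖ₑ := by
          rw [lintegral_add_left (hum.indicator hΩm.compl), lintegral_indicator hΩm.compl]
      _ ≤ _ := by
          rw [two_mul]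
          exact add_le_add (setLIntegral_le_lintegral _ _) hsi
  · have h1 : ∑' x, (Q x).indicator f y = Ω.indicator f y := by
      by_cases h : y ∈ Ω
      · rw [indicator_of_mem h]
        obtain ⟨x, hx⟩ := mem_iUnion.1 (hQΩ ▸ h)
        exact tsum_indicator_of_mem hQd' (fun _ => f) hx
      · rw [indicator_of_notMem h, tsum_congr (fun x => indicator_of_notMem
          (fun hx => h (hQΩ ▸ mem_iUnion_of_mem x hx)) _), tsum_zero]
    have h2 : f y - (Ωᶜ.indicator f y + s y) = Ω.indicator f y - s y := by
      have := congrFun (indicator_self_add_compl Ω f) y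
      simp only [Pi.add_apply] at this
      rw [← this]
      abel
    rw [h2, ← h1]
    exact (summable_indicator_of_pairwise_disjoint hQd' (fun _ => f) y).hasSum.sub
      (summable_indicator_of_pairwise_disjoint hBd' (fun x _ => a x) y).hasSum
  · change (Q x).indicator f y - (B x).indicator (fun _ => a x) y = 0
    rw [indicator_of_notMem (fun h => hy (hPB x x.2 h)), indicator_of_notMem (fun h => hy
      (closedBall_subset_closedBall (by linarith [hr x x.2]) h)), sub_zero]
  · rw [integral_sub (hi.indicator (hQm x)) ((integrable_indicator_iff (hBm x)).2
      (integrableOn_const (hBt x) enorm_ne_top)),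
      integral_indicator (hQm x), integral_indicator_const _ (hBm x), ha, smul_smul]
    rw [measureReal_def, mul_inv_cancel₀ (ENNReal.toReal_pos (hB0 x) (hBt x)).ne', one_smul,
      sub_self]
  · calc _ ≤ ∑' x, 2 * ∫⁻ y in Q x, u y := ENNReal.tsum_le_tsum fun x => ?_
      _ ≤ _ := by rw [ENNReal.tsum_mul_left]; exact mul_le_mul_right hQsum _
    calc _ ≤ ∫⁻ y, ((Q x).indicator u y + (B x).indicator (fun _ => ‖a x‖ₑ) y) := by
          refine lintegral_mono fun y => (enorm_sub_le).trans (le_of_eq ?_)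
          rw [enorm_indicator_eq_indicator_enorm, enorm_indicator_eq_indicator_enorm]
      _ = (∫⁻ y in Q x, u y) + volume (B x) * ‖a x‖ₑ := by
          rw [lintegral_add_left (hum.indicator (hQm x)), lintegral_indicator (hQm x),
            lintegral_indicator_const (hBm x), mul_comm (volume _)]
      _ ≤ _ := by rw [two_mul]; exact add_le_add_right (hae x) _
  · rw [← measure_iUnion hBd' hBm]
    refine (mul_le_mul_right (measure_mono ?_) _).trans (mul_volume_lt_maximal_le u hc0 hc)
    exact iUnion_subset fun x => hBΩ x x.2

end CZDecomposition

section CZOperator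

open Set Metric Module Filter Topology

variable {E : Type*} [NormedAddCommGroup E] [InnerProductSpace ℝ E] [FiniteDimensional ℝ E]
  [MeasurableSpace E] [BorelSpace E]
  {V : Type*} [NormedAddCommGroup V] [NormedSpace ℂ V]
  {W : Type*} [NormedAddCommGroup W] [NormedSpace ℂ W]

/-- The convolution operator with an operator-valued kernel. -/
noncomputable def convOp (K : E → V →L[ℂ] W) (f : E → V) (x : E) : W :=
  ∫ y, K (x - y) (f y)

lemma stronglyMeasurable_kernel {K : E → V →L[ℂ] W} (hK : Continuous K) {f : E → V}
    (hf : StronglyMeasurable f) :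
    StronglyMeasurable fun p : E × E => K (p.1 - p.2) (f p.2) :=
  isBoundedBilinearMap_apply.continuous.comp_stronglyMeasurable
    ((hK.comp (continuous_fst.sub continuous_snd)).stronglyMeasurable.prodMk
      (hf.comp_measurable measurable_snd))

lemma stronglyMeasurable_kernel_right {K : E → V →L[ℂ] W} (hK : Continuous K) {f : E → V}
    (hf : StronglyMeasurable f) (x : E) : StronglyMeasurable fun y => K (x - y) (f y) :=
  (stronglyMeasurable_kernel hK hf).comp_measurable measurable_prodMk_left

lemma stronglyMeasurable_convOp {K : E → V →L[ℂ] W} (hK : Continuous K) {f : E → V}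
    (hf : StronglyMeasurable f) : StronglyMeasurable (convOp K f) :=
  (stronglyMeasurable_kernel hK hf).integral_prod_right

lemma integrable_kernel {K : E → V →L[ℂ] W} (hK : Continuous K) {B : ℝ} (hB : ∀ x, ‖K x‖ ≤ B)
    {f : E → V} (hf : StronglyMeasurable f) (hi : Integrable f) (x : E) :
    Integrable fun y => K (x - y) (f y) :=
  (hi.norm.const_mul B).mono' (stronglyMeasurable_kernel_right hK hf x).aestronglyMeasurable
    (ae_of_all _ fun y => ((K (x - y)).le_opNorm (f y)).trans
      (mul_le_mul_of_nonneg_right (hB _) (norm_nonneg _)))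

lemma convOp_add {K : E → V →L[ℂ] W} {f g : E → V} {x : E}
    (hf : Integrable fun y => K (x - y) (f y)) (hg : Integrable fun y => K (x - y) (g y)) :
    convOp K (fun y => f y + g y) x = convOp K f x + convOp K g x := by
  simp only [convOp, map_add]
  exact integral_add hf hg

/-- Off the doubled ball, the image of a mean-zero function supported in a ball is controlled by
the Hörmander condition. -/
lemma lintegral_convOp_compl_le [CompleteSpace V] [CompleteSpace W] {K : E → V →L[ℂ] W}
    (hK : Continuous K) {B : ℝ}
    (hB : ∀ x, ‖K x‖ ≤ B) {A : ℝ≥0∞}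
    (hH : ∀ y, ∫⁻ x in {x | 2 * ‖y‖ < ‖x‖}, ‖K (x - y) - K x‖ₑ ≤ A)
    {b : E → V} (hb : StronglyMeasurable b) (hi : Integrable b) (h0 : ∫ y, b y = 0) {c : E} {R : ℝ}
    (hs : ∀ y ∉ closedBall c R, b y = 0) :
    ∫⁻ x in (closedBall c (2 * R))ᶜ, ‖convOp K b x‖ₑ ≤ A * ∫⁻ y, ‖b y‖ₑ := by
  have hm : Measurable fun p : E × E => ‖K (p.1 - p.2) - K (p.1 - c)‖ₑ * ‖b p.2‖ₑ :=
    ((hK.comp (continuous_fst.sub continuous_snd)).sub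
      (hK.comp (continuous_fst.sub continuous_const))).enorm.measurable.mul
        (hb.enorm.comp measurable_snd)
  have h1 : ∀ x, ‖convOp K b x‖ₑ ≤ ∫⁻ y, ‖K (x - y) - K (x - c)‖ₑ * ‖b y‖ₑ := by
    intro x
    have : convOp K b x = ∫ y, (K (x - y) - K (x - c)) (b y) := by
      simp only [sub_apply]
      rw [integral_sub (integrable_kernel hK hB hb hi x) ((K (x - c)).integrable_comp hi),
        ContinuousLinearMap.integral_comp_comm _ hi, h0, map_zero, sub_zero, convOp]
    rw [this]
    exact (enorm_integral_le_lintegral_enorm _).trans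
      (lintegral_mono fun y => ContinuousLinearMap.le_opENorm _ _)
  calc _ ≤ ∫⁻ x in (closedBall c (2 * R))ᶜ, ∫⁻ y, ‖K (x - y) - K (x - c)‖ₑ * ‖b y‖ₑ :=
        lintegral_mono h1
    _ = ∫⁻ y, ∫⁻ x in (closedBall c (2 * R))ᶜ, ‖K (x - y) - K (x - c)‖ₑ * ‖b y‖ₑ :=
        lintegral_lintegral_swap hm.aemeasurable
    _ ≤ ∫⁻ y, A * ‖b y‖ₑ := by
        refine lintegral_mono fun y => ?_
        by_cases hy : y ∈ closedBall c R
        · rw [lintegral_mul_const' _ _ enorm_ne_top]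
          gcongr
          have h2 := hH (y - c)
          rw [← (measurePreserving_sub_right (volume : Measure E) c).setLIntegral_comp_preimage_emb
            (MeasurableEquiv.subRight c).measurableEmbedding] at h2
          simp only [sub_sub_sub_cancel_right] at h2
          refine (lintegral_mono_set fun x hx => ?_).trans h2
          simp only [mem_compl_iff, mem_closedBall, not_le, dist_eq_norm] at hx hy
          simp only [preimage_ofPred_eq, mem_ofPred_eq]
          linarith
        · simp [hs y hy]
    _ = _ := lintegral_const_mul _ hb.enorm

/-- The weak type `(1, 1)` bound for Calderón–Zygmund convolution operators. -/
theorem mul_volume_lt_convOp_le [Nontrivial E] [CompleteSpace V] [CompleteSpace W]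
    {K : E → V →L[ℂ] W} (hK : Continuous K) {B : ℝ} (hB : ∀ x, ‖K x‖ ≤ B) {A : ℝ≥0∞}
    (hH : ∀ y, ∫⁻ x in {x | 2 * ‖y‖ < ‖x‖}, ‖K (x - y) - K x‖ₑ ≤ A)
    (hL : ∀ f : E → V, StronglyMeasurable f →
      ∫⁻ x, ‖convOp K f x‖ₑ ^ (2 : ℝ) ≤ A * ∫⁻ x, ‖f x‖ₑ ^ (2 : ℝ))
    {f : E → V} (hf : StronglyMeasurable f) (hi : Integrable f) {c : ℝ≥0∞} (hc0 : c ≠ 0)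
    (hc : c ≠ ⊤) :
    c * volume {x | c < ‖convOp K f x‖ₑ} ≤
      (50 ^ finrank ℝ E + 16 * 15 ^ finrank ℝ E * A + 4 * A) * ∫⁻ x, ‖f x‖ₑ := by
  set n := finrank ℝ E
  set I := ∫⁻ x, ‖f x‖ₑ with hI
  have hIt : I ≠ ⊤ := hi.2.ne
  obtain ⟨S, r, g, b, hSc, hr, hg, hb, hgc, hgi, hfgb, hbs, hb0, hbi, hSr⟩ :=
    exists_cz_decomposition hf hi hc0 hc
  have : Countable S := hSc
  have hgint : Integrable g := ⟨hg.aestronglyMeasurable, hgi.trans_lt (by finiteness)⟩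
  have hbt : ∀ x, ∫⁻ y, ‖b x y‖ₑ ≠ ⊤ := fun x =>
    ((ENNReal.le_tsum x).trans_lt (hbi.trans_lt (by finiteness))).ne
  have hbint : ∀ x, Integrable (b x) := fun x => ⟨(hb x).aestronglyMeasurable, (hbt x).lt_top⟩
  have hle : ∀ x, ‖convOp K f x‖ₑ ≤ ‖convOp K g x‖ₑ + ∑' z, ‖convOp K (b z) x‖ₑ := by
    intro x
    have h1 : convOp K f x - convOp K g x = ∫ y, ∑' z, K (x - y) (b z y) := by
      rw [convOp, convOp, ← integral_sub (integrable_kernel hK hB hf hi x)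
        (integrable_kernel hK hB hg hgint x)]
      congr 1 with y
      rw [← map_sub]
      exact ((K (x - y)).hasSum (hfgb y)).tsum_eq.symm
    have h2 : ∫ y, ∑' z, K (x - y) (b z y) = ∑' z, convOp K (b z) x := by
      refine integral_tsum (fun z =>
        (stronglyMeasurable_kernel_right hK (hb z) x).aestronglyMeasurable) ?_
      have h3 : ∀ z, ∫⁻ y, ‖K (x - y) (b z y)‖ₑ ≤ ENNReal.ofReal B * ∫⁻ y, ‖b z y‖ₑ := fun z => by
        rw [← lintegral_const_mul _ (hb z).enorm]
        refine lintegral_mono fun y => (ContinuousLinearMap.le_opENorm _ _).trans ?_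
        gcongr
        rw [← ofReal_norm]
        exact ENNReal.ofReal_le_ofReal (hB _)
      refine ((ENNReal.tsum_le_tsum h3).trans_lt ?_).ne
      rw [ENNReal.tsum_mul_left]
      exact ENNReal.mul_lt_top ENNReal.ofReal_lt_top (hbi.trans_lt (by finiteness))
    calc ‖convOp K f x‖ₑ = ‖convOp K g x + (convOp K f x - convOp K g x)‖ₑ := by
          rw [add_sub_cancel]
      _ ≤ ‖convOp K g x‖ₑ + ‖convOp K f x - convOp K g x‖ₑ := enorm_add_le _ _
      _ ≤ _ := by
          rw [h1, h2]
          exact add_le_add_right enorm_tsum_le_tsum_enorm _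
  set U : Set E := ⋃ x : S, closedBall (x : E) (2 * (5 * r x)) with hU
  have hUm : MeasurableSet U := MeasurableSet.iUnion fun x => isClosed_closedBall.measurableSet
  have hU1 : c * volume U ≤ 50 ^ n * I := by
    calc _ ≤ c * ∑' x : S, 10 ^ n * volume (closedBall (x : E) (r x)) := by
          refine mul_le_mul_right ((measure_iUnion_le _).trans (ENNReal.tsum_le_tsum fun x => ?_)) _
          rw [← mul_assoc, volume_closedBall_mul (x : E) (x : E) (by norm_num) (hr x x.2).le,
            (by norm_num : ENNReal.ofReal (2 * 5) = 10)]
      _ = 10 ^ n * (c * ∑' x : S, volume (closedBall (x : E) (r x))) := by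
          rw [ENNReal.tsum_mul_left]; ring
      _ ≤ 10 ^ n * (5 ^ n * I) := mul_le_mul_right hSr _
      _ = _ := by rw [← mul_assoc, ← mul_pow]; norm_num
  have hG : c * volume {x | c / 2 ≤ ‖convOp K g x‖ₑ} ≤ 16 * 15 ^ n * A * I := by
    have h1 : (c / 2) ^ (2 : ℝ) * volume {x | c / 2 ≤ ‖convOp K g x‖ₑ} ≤
        c * (4 * 15 ^ n * A * I) := by
      calc _ = (c / 2) ^ (2 : ℝ) *
            volume {x | (c / 2) ^ (2 : ℝ) ≤ ‖convOp K g x‖ₑ ^ (2 : ℝ)} := by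
            simp only [ENNReal.rpow_le_rpow_iff two_pos]
        _ ≤ ∫⁻ x, ‖convOp K g x‖ₑ ^ (2 : ℝ) :=
            mul_meas_ge_le_lintegral ((stronglyMeasurable_convOp hK hg).enorm.pow_const _) _
        _ ≤ A * ∫⁻ x, ‖g x‖ₑ ^ (2 : ℝ) := hL g hg
        _ ≤ A * ∫⁻ x, 2 * 15 ^ n * c * ‖g x‖ₑ := by
            refine mul_le_mul_right (lintegral_mono_ae ?_) _
            filter_upwards [hgc] with x hx
            rw [ENNReal.rpow_two, sq]
            exact mul_le_mul_left hx _
        _ ≤ A * (2 * 15 ^ n * c * (2 * I)) := by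
            rw [lintegral_const_mul _ hg.enorm]
            exact mul_le_mul_right (mul_le_mul_right hgi _) _
        _ = _ := by ring
    have h2 : (c / 2) ^ (2 : ℝ) = c * (c / 4) := by
      rw [ENNReal.rpow_two, sq, div_eq_mul_inv, div_eq_mul_inv, (by norm_num : (4 : ℝ≥0∞) = 2 * 2),
        ENNReal.mul_inv (by simp) (by simp)]
      ring
    rw [h2, mul_assoc, ENNReal.mul_le_mul_iff_right hc0 hc] at h1
    calc _ = 4 * (c / 4 * volume {x | c / 2 ≤ ‖convOp K g x‖ₑ}) := by
          rw [← mul_assoc, ENNReal.mul_div_cancel (by norm_num) (by norm_num)]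
      _ ≤ 4 * (4 * 15 ^ n * A * I) := mul_le_mul_right h1 _
      _ = _ := by ring
  have hBd : c * volume {x | x ∈ Uᶜ ∧ c / 2 ≤ ∑' z, ‖convOp K (b z) x‖ₑ} ≤ 4 * A * I := by
    have hm : Measurable fun x => ∑' z, ‖convOp K (b z) x‖ₑ :=
      Measurable.tsum fun z => (stronglyMeasurable_convOp hK (hb z)).enorm
    have h1 : c / 2 * volume {x | x ∈ Uᶜ ∧ c / 2 ≤ ∑' z, ‖convOp K (b z) x‖ₑ} ≤ 2 * A * I := by
      calc _ = c / 2 * (volume.restrict Uᶜ) {x | c / 2 ≤ ∑' z, ‖convOp K (b z) x‖ₑ} := by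
            rw [Measure.restrict_apply (measurableSet_le measurable_const hm), inter_comm]
            rfl
        _ ≤ ∫⁻ x in Uᶜ, ∑' z, ‖convOp K (b z) x‖ₑ := mul_meas_ge_le_lintegral hm _
        _ = ∑' z, ∫⁻ x in Uᶜ, ‖convOp K (b z) x‖ₑ :=
            lintegral_tsum fun z => (stronglyMeasurable_convOp hK (hb z)).enorm.aemeasurable
        _ ≤ ∑' z, A * ∫⁻ y, ‖b z y‖ₑ := by
            refine ENNReal.tsum_le_tsum fun z => (lintegral_mono_set ?_).trans
              (lintegral_convOp_compl_le hK hB hH (hb z) (hbint z) (hb0 z) (hbs z))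
            exact compl_subset_compl.2 (subset_iUnion_of_subset z subset_rfl)
        _ ≤ _ := by
            rw [ENNReal.tsum_mul_left]
            exact (mul_le_mul_right hbi _).trans (le_of_eq (by ring))
    calc _ = 2 * (c / 2 * volume {x | x ∈ Uᶜ ∧ c / 2 ≤ ∑' z, ‖convOp K (b z) x‖ₑ}) := by
          rw [← mul_assoc, ENNReal.mul_div_cancel (by norm_num) (by norm_num)]
      _ ≤ 2 * (2 * A * I) := mul_le_mul_right h1 _
      _ = _ := by ring
  have hsub : {x | c < ‖convOp K f x‖ₑ} ⊆ U ∪ {x | c / 2 ≤ ‖convOp K g x‖ₑ} ∪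
      {x | x ∈ Uᶜ ∧ c / 2 ≤ ∑' z, ‖convOp K (b z) x‖ₑ} := by
    intro x hx
    by_contra h
    simp only [mem_union, mem_ofPred_eq, not_or, not_and, not_le, mem_compl_iff] at h hx
    have := hx.trans_le (hle x)
    exact absurd this (not_lt.2 ((add_le_add h.1.2.le (h.2 h.1.1).le).trans
      (ENNReal.add_halves c).le))
  calc _ ≤ c * (volume U + volume {x | c / 2 ≤ ‖convOp K g x‖ₑ} +
        volume {x | x ∈ Uᶜ ∧ c / 2 ≤ ∑' z, ‖convOp K (b z) x‖ₑ}) := by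
        refine mul_le_mul_right ((measure_mono hsub).trans ((measure_union_le _ _).trans ?_)) _
        exact add_le_add_left (measure_union_le _ _) _
    _ ≤ _ := by
        rw [mul_add, mul_add, add_mul, add_mul]
        exact add_le_add (add_le_add hU1 hG) hBd

/-- `L^p` bounds, `1 < p < 2`, for Calderón–Zygmund convolution operators. -/
theorem lintegral_convOp_rpow_le [Nontrivial E] [CompleteSpace V] [CompleteSpace W]
    {K : E → V →L[ℂ] W} (hK : Continuous K) {B : ℝ} (hB : ∀ x, ‖K x‖ ≤ B) (hKi : Integrable K)
    {A : ℝ≥0∞} (hH : ∀ y, ∫⁻ x in {x | 2 * ‖y‖ < ‖x‖}, ‖K (x - y) - K x‖ₑ ≤ A)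
    (hL : ∀ f : E → V, StronglyMeasurable f →
      ∫⁻ x, ‖convOp K f x‖ₑ ^ (2 : ℝ) ≤ A * ∫⁻ x, ‖f x‖ₑ ^ (2 : ℝ))
    {p : ℝ} (hp : 1 < p) (hp2 : p < 2)
    {f : E → V} (hf : StronglyMeasurable f) (hfp : ∫⁻ x, ‖f x‖ₑ ^ p ≠ ⊤) :
    ∫⁻ x, ‖convOp K f x‖ₑ ^ p ≤ 2 ^ p * ENNReal.ofReal p *
      ((50 ^ finrank ℝ E + 16 * 15 ^ finrank ℝ E * A + 4 * A) * ENNReal.ofReal (p - 1)⁻¹ +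
        A * ENNReal.ofReal (2 - p)⁻¹) * ∫⁻ x, ‖f x‖ₑ ^ p := by
  simp_rw [← ofReal_norm (f _)]
  refine lintegral_rpow_le_of_weak_type (F := fun x => ‖f x‖) hf.norm.measurable
    (fun _ => norm_nonneg _) (stronglyMeasurable_convOp hK hf).enorm hp hp2 _ _ fun t ht => ?_
  have hm1 : MeasurableSet {x | t < ‖f x‖} := measurableSet_lt measurable_const hf.norm.measurable
  have hm2 : MeasurableSet {x | ‖f x‖ ≤ t} := measurableSet_le hf.norm.measurable measurable_const
  have ht0 : ENNReal.ofReal t ≠ 0 := by simpa using ht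
  set f₁ := {x | t < ‖f x‖}.indicator f with hf₁
  set f₂ := {x | ‖f x‖ ≤ t}.indicator f with hf₂
  have hf1m : StronglyMeasurable f₁ := hf.indicator hm1
  have hf2m : StronglyMeasurable f₂ := hf.indicator hm2
  have hsum : ∀ y, f y = f₁ y + f₂ y := fun y => by
    by_cases h : t < ‖f y‖
    · rw [hf₁, hf₂, indicator_of_mem (by exact h), indicator_of_notMem (by simpa using h), add_zero]
    · rw [hf₁, hf₂, indicator_of_notMem (by exact h), indicator_of_mem (by simpa using h), zero_add]
  have hi1 : Integrable f₁ := by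
    refine ⟨hf1m.aestronglyMeasurable, ?_⟩
    have h1 : ∀ y, ENNReal.ofReal t ^ (p - 1) * ‖f₁ y‖ₑ ≤ ‖f y‖ₑ ^ p := fun y => by
      by_cases h : t < ‖f y‖
      · rw [hf₁, indicator_of_mem (by exact h)]
        calc _ ≤ ‖f y‖ₑ ^ (p - 1) * ‖f y‖ₑ ^ (1 : ℝ) := by
              rw [ENNReal.rpow_one]
              refine mul_le_mul_left (ENNReal.rpow_le_rpow ?_ (by linarith)) _
              rw [← ofReal_norm]; exact ENNReal.ofReal_le_ofReal h.le
          _ = _ := by rw [← ENNReal.rpow_add_of_nonneg _ _ (by linarith) one_pos.le]; congr 1; ring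
      · rw [hf₁, indicator_of_notMem (by exact h)]; simp
    have h2 := lintegral_mono h1 (μ := volume)
    rw [lintegral_const_mul _ hf1m.enorm] at h2
    refine lt_top_iff_ne_top.2 fun h => hfp (top_le_iff.1 ?_)
    change ∫⁻ y, ‖f₁ y‖ₑ = ⊤ at h
    rwa [h, ENNReal.mul_top] at h2
    exact (ENNReal.rpow_pos (pos_iff_ne_zero.2 ht0) ENNReal.ofReal_ne_top).ne'
  have hk2 : ∀ x, Integrable fun y => K (x - y) (f₂ y) := fun x =>
    ((hKi.comp_sub_left x).norm.mul_const t).mono'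
      (stronglyMeasurable_kernel_right hK hf2m x).aestronglyMeasurable
      (ae_of_all _ fun y => ((K (x - y)).le_opNorm _).trans
        (mul_le_mul_of_nonneg_left (by
          by_cases h : ‖f y‖ ≤ t
          · rw [hf₂, indicator_of_mem (by exact h)]; exact h
          · rw [hf₂, indicator_of_notMem (by exact h), norm_zero]; exact ht.le) (norm_nonneg _)))
  have hle : ∀ x, ‖convOp K f x‖ₑ ≤ ‖convOp K f₁ x‖ₑ + ‖convOp K f₂ x‖ₑ := fun x => by
    have : convOp K f x = convOp K f₁ x + convOp K f₂ x := by
      rw [← convOp_add (integrable_kernel hK hB hf1m hi1 x) (hk2 x)]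
      exact congrArg (convOp K · x) (funext hsum)
    rw [this]
    exact enorm_add_le _ _
  have hw1 : volume {x | ENNReal.ofReal t < ‖convOp K f₁ x‖ₑ} ≤
      (50 ^ finrank ℝ E + 16 * 15 ^ finrank ℝ E * A + 4 * A) * ENNReal.ofReal t⁻¹ *
        ∫⁻ x in {x | t < ‖f x‖}, ENNReal.ofReal ‖f x‖ := by
    have h := mul_volume_lt_convOp_le hK hB hH hL hf1m hi1 ht0 ENNReal.ofReal_ne_top
    rw [hf₁] at h
    simp_rw [enorm_indicator_eq_indicator_enorm] at h
    rw [lintegral_indicator hm1, mul_comm, ← ENNReal.le_div_iff_mul_le (Or.inl ht0)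
      (Or.inl ENNReal.ofReal_ne_top), div_eq_mul_inv, ← ENNReal.ofReal_inv_of_pos ht,
      mul_right_comm] at h
    simpa only [ofReal_norm] using h
  have hw2 : volume {x | ENNReal.ofReal t ≤ ‖convOp K f₂ x‖ₑ} ≤
      A * ENNReal.ofReal (t ^ (-2 : ℝ)) *
        ∫⁻ x in {x | ‖f x‖ ≤ t}, ENNReal.ofReal ‖f x‖ ^ (2 : ℝ) := by
    have h1 : ENNReal.ofReal t ^ (2 : ℝ) * volume {x | ENNReal.ofReal t ≤ ‖convOp K f₂ x‖ₑ} ≤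
        A * ∫⁻ x in {x | ‖f x‖ ≤ t}, ENNReal.ofReal ‖f x‖ ^ (2 : ℝ) := by
      calc _ = ENNReal.ofReal t ^ (2 : ℝ) *
            volume {x | ENNReal.ofReal t ^ (2 : ℝ) ≤ ‖convOp K f₂ x‖ₑ ^ (2 : ℝ)} := by
            simp only [ENNReal.rpow_le_rpow_iff two_pos]
        _ ≤ ∫⁻ x, ‖convOp K f₂ x‖ₑ ^ (2 : ℝ) :=
            mul_meas_ge_le_lintegral ((stronglyMeasurable_convOp hK hf2m).enorm.pow_const _) _
        _ ≤ A * ∫⁻ x, ‖f₂ x‖ₑ ^ (2 : ℝ) := hL f₂ hf2m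
        _ = _ := by
            rw [← lintegral_indicator hm2]
            congr 2 with x
            by_cases h : ‖f x‖ ≤ t
            · rw [hf₂, indicator_of_mem (by exact h), indicator_of_mem (by exact h), ofReal_norm]
            · rw [hf₂, indicator_of_notMem (by exact h), indicator_of_notMem (by exact h)]; simp
    rw [ENNReal.ofReal_rpow_of_pos ht, mul_comm, ← ENNReal.le_div_iff_mul_le
      (Or.inl (by simpa using ht.ne')) (Or.inl ENNReal.ofReal_ne_top),
      div_eq_mul_inv, ← ENNReal.ofReal_inv_of_pos (by positivity), mul_right_comm,
      ← Real.rpow_neg ht.le] at h1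
    exact h1
  refine (measure_mono (t := {x | ENNReal.ofReal t < ‖convOp K f₁ x‖ₑ} ∪
    {x | ENNReal.ofReal t ≤ ‖convOp K f₂ x‖ₑ}) fun x hx => ?_).trans
    ((measure_union_le _ _).trans (add_le_add hw1 hw2))
  by_contra h
  simp only [mem_union, mem_ofPred_eq, not_or, not_le, not_lt] at h hx
  rw [two_mul, ENNReal.ofReal_add ht.le ht.le] at hx
  exact absurd (hx.trans_le (hle x)) (not_lt.2 (add_le_add h.1 h.2.le))

end CZOperator

section Hormander

open Set Metric Module Filter Topology

lemma exists_sum_min_le : ∃ C : ℝ, 0 < C ∧ ∀ (J : Finset ℤ) (a : ℝ), 0 < a →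
    ∑ j ∈ J, min ((2 : ℝ) ^ j * a) ((2 : ℝ) ^ j * a)⁻¹ ≤ C := by
  set g : ℤ → ℝ := fun n => 2 * (1 / 2) ^ n.natAbs with hg
  have hgs : Summable g := by
    refine Summable.of_nat_of_neg ?_ ?_ <;>
    · simp only [hg, Int.natAbs_neg, Int.natAbs_natCast]
      exact summable_geometric_two.mul_left 2
  have hg0 : ∀ n, 0 ≤ g n := fun n => by positivity
  have h0 : 0 ≤ ∑' n, g n := tsum_nonneg hg0
  refine ⟨(∑' n, g n) + 1, by linarith, fun J a ha => ?_⟩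
  set m := Int.log 2 a
  have h1 : (2 : ℝ) ^ m ≤ a := by exact_mod_cast Int.zpow_log_le_self one_lt_two ha
  have h2 : a < (2 : ℝ) ^ (m + 1) := by exact_mod_cast Int.lt_zpow_succ_log_self one_lt_two a
  have hle : ∀ j : ℤ, min ((2 : ℝ) ^ j * a) ((2 : ℝ) ^ j * a)⁻¹ ≤ g (j + m) := by
    intro j
    rcases le_total 0 (j + m) with h | h
    · refine (min_le_right _ _).trans ?_
      obtain ⟨n, hn⟩ := Int.eq_ofNat_of_zero_le h
      have h3 : (2 : ℝ) ^ n ≤ 2 ^ j * a := by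
        rw [← zpow_natCast, ← hn, zpow_add₀ two_ne_zero]
        gcongr
      rw [hg]
      simp only [hn, Int.natAbs_natCast, one_div, inv_pow]
      calc _ ≤ ((2 : ℝ) ^ n)⁻¹ := inv_anti₀ (by positivity) h3
        _ ≤ _ := le_mul_of_one_le_left (by positivity) one_le_two
    · refine (min_le_left _ _).trans ?_
      obtain ⟨n, hn⟩ := Int.eq_ofNat_of_zero_le (neg_nonneg.2 h)
      have hn' : j + m = -(n : ℤ) := by rw [← hn]; ring
      rw [hg]
      simp only [hn', Int.natAbs_neg, Int.natAbs_natCast, one_div, inv_pow]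
      calc (2 : ℝ) ^ j * a ≤ 2 ^ j * 2 ^ (m + 1) := by gcongr
        _ = 2 * ((2 : ℝ) ^ n)⁻¹ := by
          rw [← zpow_add₀ two_ne_zero, ← add_assoc, hn', zpow_add₀ two_ne_zero, zpow_neg,
            zpow_natCast]
          ring
  calc _ ≤ ∑ j ∈ J, g (j + m) := Finset.sum_le_sum fun j _ => hle j
    _ ≤ ∑' j, g (j + m) := (((Equiv.addRight m).summable_iff (f := g)).2 hgs).sum_le_tsum _
        fun j _ => hg0 _
    _ = ∑' j, g j := (Equiv.addRight m).tsum_eq g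
    _ ≤ _ := by linarith

variable {E : Type*} [NormedAddCommGroup E] [InnerProductSpace ℝ E] [FiniteDimensional ℝ E]
  [MeasurableSpace E] [BorelSpace E]

lemma exists_lintegral_translate_sub_le (k : 𝓢(E, ℂ)) : ∃ C : ℝ≥0∞, C ≠ ⊤ ∧
    ∀ w, ∫⁻ z, ‖k (z - w) - k z‖ₑ ≤ C * ‖w‖ₑ := by
  set k' : 𝓢(E, E →L[ℝ] ℂ) := SchwartzMap.fderivCLM ℝ E ℂ k with hk'
  refine ⟨∫⁻ z, ‖k' z‖ₑ, k'.integrable.2.ne, fun w => ?_⟩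
  have hpt : ∀ z, ‖k (z - w) - k z‖ₑ ≤ ∫⁻ t in Ioc (0 : ℝ) 1, ‖k' (z - t • w)‖ₑ * ‖w‖ₑ := by
    intro z
    have hd : ∀ t : ℝ, HasDerivAt (fun t : ℝ => k (z - t • w)) (k' (z - t • w) (-w)) t := by
      intro t
      have h1 : HasDerivAt (fun t : ℝ => z - t • w) (-w) t := by
        simpa using ((hasDerivAt_id t).smul_const w).const_sub z
      exact (k.differentiableAt.hasFDerivAt (x := z - t • w)).comp_hasDerivAt t h1
    have hc : Continuous fun t : ℝ => k' (z - t • w) (-w) := by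
      have := k'.continuous
      fun_prop
    have := intervalIntegral.integral_eq_sub_of_hasDerivAt (a := 0) (b := 1) (fun t _ => hd t)
      (hc.intervalIntegrable _ _)
    rw [one_smul, zero_smul, sub_zero, intervalIntegral.integral_of_le zero_le_one] at this
    rw [← this]
    refine (enorm_integral_le_lintegral_enorm _).trans (lintegral_mono fun t => ?_)
    simpa using (k' (z - t • w)).le_opENorm (-w)
  have hm : Measurable fun p : E × ℝ => ‖k' (p.1 - p.2 • w)‖ₑ * ‖w‖ₑ := by
    have := k'.continuous
    exact (by fun_prop : Continuous fun p : E × ℝ => k' (p.1 - p.2 • w)).enorm.measurable.mul_const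
      _
  calc _ ≤ ∫⁻ z, ∫⁻ t in Ioc (0 : ℝ) 1, ‖k' (z - t • w)‖ₑ * ‖w‖ₑ := lintegral_mono hpt
    _ = ∫⁻ t in Ioc (0 : ℝ) 1, ∫⁻ z, ‖k' (z - t • w)‖ₑ * ‖w‖ₑ :=
        lintegral_lintegral_swap hm.aemeasurable
    _ = ∫⁻ t in Ioc (0 : ℝ) 1, (∫⁻ z, ‖k' z‖ₑ) * ‖w‖ₑ := by
        congr 1 with t
        rw [lintegral_mul_const' _ _ enorm_ne_top,
          lintegral_sub_right_eq_self (fun z => ‖k' z‖ₑ)]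
    _ = _ := by simp

lemma exists_lintegral_tail_le (k : 𝓢(E, ℂ)) : ∃ C : ℝ≥0∞, C ≠ ⊤ ∧
    ∀ w ≠ 0, ∫⁻ z in {z | 2 * ‖w‖ < ‖z‖}, ‖k (z - w) - k z‖ₑ ≤ C * ‖w‖ₑ⁻¹ := by
  set D := ∫⁻ z, ‖z‖ₑ * ‖k z‖ₑ with hD
  have hDt : D ≠ ⊤ := by
    have h := (k.integrable_pow_mul volume 1).2.ne
    simpa [HasFiniteIntegral, enorm_mul] using h
  refine ⟨2 * D, by finiteness, fun w hw => ?_⟩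
  have hw0 : ‖w‖ₑ ≠ 0 := by simpa using hw
  have htail : ∫⁻ z in {z | ‖w‖ < ‖z‖}, ‖k z‖ₑ ≤ D * ‖w‖ₑ⁻¹ := by
    rw [← div_eq_mul_inv, ENNReal.le_div_iff_mul_le (Or.inl hw0) (Or.inl enorm_ne_top), mul_comm,
      ← lintegral_const_mul' _ _ enorm_ne_top]
    refine (setLIntegral_mono' (measurableSet_lt measurable_const measurable_norm) fun z hz =>
      mul_le_mul_left (enorm_le_iff_norm_le.2 (le_of_lt hz)) _).trans
        (setLIntegral_le_lintegral _ _)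
  calc _ ≤ ∫⁻ z in {z | 2 * ‖w‖ < ‖z‖}, (‖k (z - w)‖ₑ + ‖k z‖ₑ) :=
        lintegral_mono fun z => enorm_sub_le
    _ = (∫⁻ z in {z | 2 * ‖w‖ < ‖z‖}, ‖k (z - w)‖ₑ) + ∫⁻ z in {z | 2 * ‖w‖ < ‖z‖}, ‖k z‖ₑ :=
        lintegral_add_right _ k.continuous.enorm.measurable
    _ ≤ (∫⁻ z in {z | ‖w‖ < ‖z‖}, ‖k z‖ₑ) + ∫⁻ z in {z | ‖w‖ < ‖z‖}, ‖k z‖ₑ := by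
        gcongr ?_ + ?_
        · rw [← (measurePreserving_sub_right (volume : Measure E) w).setLIntegral_comp_preimage_emb
            (MeasurableEquiv.subRight w).measurableEmbedding (fun z => ‖k z‖ₑ) {z | ‖w‖ < ‖z‖}]
          refine lintegral_mono_set fun z hz => ?_
          have hz : 2 * ‖w‖ < ‖z‖ := hz
          change ‖w‖ < ‖z - w‖
          linarith [norm_sub_norm_le z w]
        · refine lintegral_mono_set fun z hz => ?_
          have hz : 2 * ‖w‖ < ‖z‖ := hz
          change ‖w‖ < ‖z‖
          linarith [norm_nonneg w]
    _ ≤ D * ‖w‖ₑ⁻¹ + D * ‖w‖ₑ⁻¹ := add_le_add htail htail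
    _ = _ := by ring

lemma lintegral_smul_comp (f : E → ℝ≥0∞) {l : ℝ} (hl : 0 < l) :
    ENNReal.ofReal (l ^ finrank ℝ E) * ∫⁻ x, f (l • x) = ∫⁻ x, f x := by
  have h1 : Measure.map (l • ·) (volume : Measure E) =
      ENNReal.ofReal (l ^ finrank ℝ E)⁻¹ • volume := by
    rw [Measure.map_addHaar_smul volume hl.ne', abs_of_pos (by positivity)]
  have h2 := (Homeomorph.smulOfNeZero l hl.ne').measurableEmbedding.lintegral_map
    (μ := (volume : Measure E)) f
  change ∫⁻ x, f x ∂(Measure.map (l • ·) (volume : Measure E)) = ∫⁻ x, f (l • x) at h2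
  rw [← h2, h1, lintegral_smul_measure, smul_eq_mul, ← mul_assoc,
    ← ENNReal.ofReal_mul (by positivity), mul_inv_cancel₀ (by positivity), ENNReal.ofReal_one,
    one_mul]

lemma lintegral_dilate_sub (k : 𝓢(E, ℂ)) (j : ℤ) (y : E) :
    ∫⁻ x in {x | 2 * ‖y‖ < ‖x‖}, ‖dilate k j (x - y) - dilate k j x‖ₑ =
      ∫⁻ z in {z | 2 * ‖(2 : ℝ) ^ j • y‖ < ‖z‖}, ‖k (z - (2 : ℝ) ^ j • y) - k z‖ₑ := by
  set l : ℝ := 2 ^ j with hl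
  have hl0 : 0 < l := by positivity
  have hm : ∀ y : E, MeasurableSet {x : E | 2 * ‖y‖ < ‖x‖} := fun y =>
    measurableSet_lt measurable_const measurable_norm
  rw [← lintegral_indicator (hm _), ← lintegral_indicator (hm _), 
    ← lintegral_smul_comp ({z | 2 * ‖l • y‖ < ‖z‖}.indicator _) hl0,
      ← lintegral_const_mul' _ _ ENNReal.ofReal_ne_top]
  congr 1 with x
  have hiff : l • x ∈ {z : E | 2 * ‖l • y‖ < ‖z‖} ↔ x ∈ {x : E | 2 * ‖y‖ < ‖x‖} := by
    simp only [mem_ofPred_eq, norm_smul, Real.norm_of_nonneg hl0.le]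
    rw [mul_left_comm, mul_lt_mul_iff_right₀ hl0]
  by_cases hx : x ∈ {x : E | 2 * ‖y‖ < ‖x‖}
  · rw [indicator_of_mem hx, indicator_of_mem (hiff.2 hx), dilate, dilate, ← mul_sub, enorm_mul,
      smul_sub]
    congr 1
    rw [← ofReal_norm, Complex.norm_real, Real.norm_of_nonneg (by positivity)]
  · rw [indicator_of_notMem hx, indicator_of_notMem (fun h => hx (hiff.1 h)), mul_zero]

/-- The Hörmander condition for dyadic families of dilations, uniformly in the family. -/
theorem exists_sum_lintegral_dilate_sub_le (k : 𝓢(E, ℂ)) : ∃ A : ℝ≥0∞, A ≠ ⊤ ∧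
    ∀ (J : Finset ℤ) (y : E), ∑ j ∈ J, ∫⁻ x in {x | 2 * ‖y‖ < ‖x‖},
      ‖dilate k j (x - y) - dilate k j x‖ₑ ≤ A := by
  obtain ⟨C₁, hC₁, h1⟩ := exists_lintegral_translate_sub_le k
  obtain ⟨C₂, hC₂, h2⟩ := exists_lintegral_tail_le k
  obtain ⟨C, hC, h3⟩ := exists_sum_min_le
  refine ⟨(C₁ + C₂) * ENNReal.ofReal C, by finiteness, fun J y => ?_⟩
  rcases eq_or_ne y 0 with rfl | hy
  · simp
  have hle : ∀ j : ℤ, ∫⁻ x in {x | 2 * ‖y‖ < ‖x‖}, ‖dilate k j (x - y) - dilate k j x‖ₑ ≤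
      (C₁ + C₂) * ENNReal.ofReal (min ((2 : ℝ) ^ j * ‖y‖) ((2 : ℝ) ^ j * ‖y‖)⁻¹) := fun j => by
    have hn : ‖(2 : ℝ) ^ j • y‖ = 2 ^ j * ‖y‖ := by
      rw [norm_smul, Real.norm_of_nonneg (by positivity)]
    have hpos : 0 < (2 : ℝ) ^ j * ‖y‖ := by positivity
    rw [lintegral_dilate_sub, (ENNReal.ofReal_mono).map_min]
    rcases min_choice (ENNReal.ofReal (2 ^ j * ‖y‖)) (ENNReal.ofReal ((2 : ℝ) ^ j * ‖y‖)⁻¹) with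
      h | h <;> rw [h]
    · refine (setLIntegral_le_lintegral _ _).trans ((h1 _).trans ?_)
      rw [← ofReal_norm, hn]
      exact mul_le_mul_left le_self_add _
    · refine (h2 _ (smul_ne_zero (by positivity) hy)).trans ?_
      rw [← ofReal_norm, hn, ENNReal.ofReal_inv_of_pos hpos]
      exact mul_le_mul_left le_add_self _
  calc _ ≤ ∑ j ∈ J, (C₁ + C₂) *
        ENNReal.ofReal (min ((2 : ℝ) ^ j * ‖y‖) ((2 : ℝ) ^ j * ‖y‖)⁻¹) :=
        Finset.sum_le_sum fun j _ => hle j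
    _ = (C₁ + C₂) * ENNReal.ofReal (∑ j ∈ J, min ((2 : ℝ) ^ j * ‖y‖) ((2 : ℝ) ^ j * ‖y‖)⁻¹) := by
        rw [← Finset.mul_sum, ENNReal.ofReal_sum_of_nonneg fun j _ => by positivity]
    _ ≤ _ := mul_le_mul_right (ENNReal.ofReal_le_ofReal (h3 J _ (norm_pos_iff.2 hy))) _

end Hormander

section Plancherel

open Set Metric Module Filter Topology

variable {E : Type*} [NormedAddCommGroup E] [InnerProductSpace ℝ E] [FiniteDimensional ℝ E]
  [MeasurableSpace E] [BorelSpace E]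

lemma exists_dilate_eq (k : 𝓢(E, ℂ)) (j : ℤ) : ∃ k' : 𝓢(E, ℂ), ⇑k' = dilate k j := by
  refine ⟨((((2 : ℝ) ^ j) ^ finrank ℝ E : ℝ) : ℂ) • compCLMOfContinuousLinearEquiv ℂ
    (ContinuousLinearEquiv.smulLeft (R₁ := ℝ) (Units.mk0 ((2 : ℝ) ^ j) (by positivity))) k, ?_⟩
  ext x
  simp [dilate, Units.smul_def]

lemma continuous_dilate {k : E → ℂ} (hk : Continuous k) (j : ℤ) : Continuous (dilate k j) := by
  unfold dilate
  fun_prop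

lemma fourier_dilate (k : E → ℂ) (j : ℤ) (ξ : E) :
    𝓕 (dilate k j) ξ = 𝓕 k (((2 : ℝ) ^ j)⁻¹ • ξ) := by
  rw [Real.fourier_eq, Real.fourier_eq]
  set l : ℝ := 2 ^ j with hl
  have hl0 : 0 < l := by positivity
  have h := Measure.integral_comp_smul_of_nonneg (volume : Measure E)
    (fun v => 𝐞 (-⟪v, l⁻¹ • ξ⟫) • k v) l (hR := hl0.le)
  rw [eq_comm, inv_smul_eq_iff₀ (by positivity)] at h
  rw [h, ← integral_smul]
  congr 1 with v
  rw [inner_smul_left, inner_smul_right, dilate, ← hl]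
  simp only [conj_trivial, mul_inv_cancel_left₀ hl0.ne', Circle.smul_def, smul_eq_mul,
    Complex.real_smul]
  ring

lemma exists_norm_le_min (m : 𝓢(E, ℂ)) (h0 : m 0 = 0) :
    ∃ C : ℝ, 0 < C ∧ ∀ ξ, ‖m ξ‖ ≤ C * min ‖ξ‖ ‖ξ‖⁻¹ := by
  set m' : 𝓢(E, E →L[ℝ] ℂ) := SchwartzMap.fderivCLM ℝ E ℂ m with hm'
  obtain ⟨C₁, h1⟩ : ∃ C : ℝ, ∀ x, ‖m' x‖ ≤ C :=
    ⟨_, fun x => SchwartzMap.norm_le_seminorm ℝ m' x⟩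
  obtain ⟨C₂, hC₂, h2⟩ := exists_decay m 1
  have h3 : ∀ ξ, ‖m ξ‖ ≤ C₁ * ‖ξ‖ := fun ξ => by
    have := Convex.norm_image_sub_le_of_norm_fderiv_le (𝕜 := ℝ) (f := m) (s := univ) (x := 0)
      (y := ξ) (C := C₁) (fun x _ => m.differentiableAt) (fun x _ => h1 x) convex_univ
      (mem_univ _) (mem_univ _)
    simpa [h0] using this
  refine ⟨max C₁ C₂, lt_max_of_lt_right hC₂, fun ξ => ?_⟩
  rcases eq_or_ne ξ 0 with rfl | hξ
  · simp [h0]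
  have hξ' : 0 < ‖ξ‖ := norm_pos_iff.2 hξ
  rcases min_choice ‖ξ‖ ‖ξ‖⁻¹ with h | h <;> rw [h]
  · exact (h3 ξ).trans (by gcongr; exact le_max_left _ _)
  · rw [← div_eq_mul_inv, le_div_iff₀ hξ']
    have := h2 ξ
    rw [pow_one] at this
    nlinarith [norm_nonneg (m ξ), le_max_right C₁ C₂]

lemma exists_sum_norm_sq_le (m : 𝓢(E, ℂ)) (h0 : m 0 = 0) :
    ∃ C : ℝ, 0 < C ∧ ∀ (J : Finset ℤ) ξ, ∑ j ∈ J, ‖m (((2 : ℝ) ^ j)⁻¹ • ξ)‖ ^ 2 ≤ C := by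
  obtain ⟨C, hC, h⟩ := exists_norm_le_min m h0
  obtain ⟨D, hD, hs⟩ := exists_sum_min_le
  refine ⟨C ^ 2 * D, by positivity, fun J ξ => ?_⟩
  rcases eq_or_ne ξ 0 with rfl | hξ
  · simp [h0]
    positivity
  have hξ' : 0 < ‖ξ‖ := norm_pos_iff.2 hξ
  calc _ ≤ ∑ j ∈ J, C ^ 2 * min ((2 : ℝ) ^ j * ‖ξ‖⁻¹) ((2 : ℝ) ^ j * ‖ξ‖⁻¹)⁻¹ := by
        refine Finset.sum_le_sum fun j _ => ?_
        have h1 := h (((2 : ℝ) ^ j)⁻¹ • ξ)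
        have h2 : min ‖((2 : ℝ) ^ j)⁻¹ • ξ‖ ‖((2 : ℝ) ^ j)⁻¹ • ξ‖⁻¹ =
            min ((2 : ℝ) ^ j * ‖ξ‖⁻¹) ((2 : ℝ) ^ j * ‖ξ‖⁻¹)⁻¹ := by
          rw [norm_smul, Real.norm_of_nonneg (by positivity), min_comm, mul_inv, mul_inv, inv_inv,
            inv_inv]
        rw [h2] at h1
        set b := (2 : ℝ) ^ j * ‖ξ‖⁻¹
        have hb : 0 < b := by positivity
        have h3 : min b b⁻¹ ≤ 1 := by
          rcases le_total b 1 with h | h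
          · exact (min_le_left _ _).trans h
          · exact (min_le_right _ _).trans (inv_le_one_of_one_le₀ h)
        have h4 : 0 ≤ min b b⁻¹ := by positivity
        calc _ ≤ (C * min b b⁻¹) ^ 2 := by gcongr
          _ = C ^ 2 * (min b b⁻¹ * min b b⁻¹) := by ring
          _ ≤ C ^ 2 * (min b b⁻¹ * 1) := by gcongr
          _ = _ := by ring
    _ = C ^ 2 * ∑ j ∈ J, min ((2 : ℝ) ^ j * ‖ξ‖⁻¹) ((2 : ℝ) ^ j * ‖ξ‖⁻¹)⁻¹ := by
        rw [Finset.mul_sum]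
    _ ≤ _ := by gcongr; exact hs J _ (by positivity)

lemma lintegral_enorm_sq (f : 𝓢(E, ℂ)) :
    ∫⁻ x, ‖f x‖ₑ ^ (2 : ℝ) = ENNReal.ofReal (∫ x, ‖f x‖ ^ 2) := by
  have hi : Integrable fun x => ‖f x‖ ^ 2 := by
    simpa using (f.memLp 2 volume).integrable_norm_pow (by norm_num)
  rw [ofReal_integral_eq_lintegral_ofReal hi (ae_of_all _ fun x => by positivity)]
  congr 1 with x
  rw [ENNReal.ofReal_pow (norm_nonneg _), ofReal_norm, ENNReal.rpow_ofNat]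

lemma exists_conv_eq (k f : 𝓢(E, ℂ)) (j : ℤ) : ∃ g : 𝓢(E, ℂ), ⇑g = conv k j f ∧
    ∀ ξ, 𝓕 g ξ = 𝓕 k (((2 : ℝ) ^ j)⁻¹ • ξ) * 𝓕 f ξ := by
  obtain ⟨k', hk'⟩ := exists_dilate_eq k j
  refine ⟨SchwartzMap.convolution (ContinuousLinearMap.mul ℂ ℂ) k' f, ?_, fun ξ => ?_⟩
  · ext x
    rw [SchwartzMap.convolution_apply, convolution_eq_swap, conv, ← hk']
    rfl
  · rw [SchwartzMap.fourier_convolution_apply,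
      Real.fourier_mul_convolution_eq k'.integrable f.integrable, hk', fourier_dilate]
    simp only [fourier_coe]

lemma exists_sum_lintegral_conv_sq_le_schwartz (k : 𝓢(E, ℂ)) (h0 : 𝓕 k 0 = 0) :
    ∃ C : ℝ≥0∞, C ≠ ⊤ ∧ ∀ (J : Finset ℤ) (f : 𝓢(E, ℂ)),
      ∑ j ∈ J, ∫⁻ x, ‖conv k j f x‖ₑ ^ (2 : ℝ) ≤ C * ∫⁻ x, ‖f x‖ₑ ^ (2 : ℝ) := by
  obtain ⟨C, hC, h⟩ := exists_sum_norm_sq_le (𝓕 k) h0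
  refine ⟨ENNReal.ofReal C, by finiteness, fun J f => ?_⟩
  have h1 : ∀ j, ∫⁻ x, ‖conv k j f x‖ₑ ^ (2 : ℝ) =
      ∫⁻ ξ, (‖𝓕 k (((2 : ℝ) ^ j)⁻¹ • ξ)‖ₑ * ‖𝓕 f ξ‖ₑ) ^ (2 : ℝ) := by
    intro j
    obtain ⟨g, hg, hg'⟩ := exists_conv_eq k f j
    rw [← hg, lintegral_enorm_sq, ← SchwartzMap.integral_norm_sq_fourier, ← lintegral_enorm_sq]
    simp_rw [hg', enorm_mul]
  have hm : ∀ j : ℤ, Measurable fun ξ => ‖𝓕 k (((2 : ℝ) ^ j)⁻¹ • ξ)‖ₑ := fun j =>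
    ((𝓕 k).continuous.comp (continuous_const_smul _)).enorm.measurable
  rw [lintegral_enorm_sq f, ← SchwartzMap.integral_norm_sq_fourier, ← lintegral_enorm_sq]
  simp_rw [h1]
  rw [← lintegral_finsetSum J fun j _ => show Measurable fun ξ =>
      (‖𝓕 k (((2 : ℝ) ^ j)⁻¹ • ξ)‖ₑ * ‖𝓕 f ξ‖ₑ) ^ (2 : ℝ) from
    ((hm j).mul (𝓕 f).continuous.enorm.measurable).pow_const _,
    ← lintegral_const_mul' _ _ ENNReal.ofReal_ne_top]
  refine lintegral_mono fun ξ => ?_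
  simp_rw [ENNReal.mul_rpow_of_nonneg _ _ zero_le_two]
  rw [← Finset.sum_mul]
  refine mul_le_mul_left ?_ _
  refine le_trans (le_of_eq ?_) (ENNReal.ofReal_le_ofReal (h J ξ))
  rw [ENNReal.ofReal_sum_of_nonneg fun j _ => by positivity]
  refine Finset.sum_congr rfl fun j _ => ?_
  rw [ENNReal.ofReal_pow (norm_nonneg _), ofReal_norm, ENNReal.rpow_ofNat]

lemma tendsto_conv (k : 𝓢(E, ℂ)) (j : ℤ) {f : E → ℂ} (hf : MemLp f 2)
    {g : ℕ → E → ℂ} (hg : ∀ n, MemLp (g n) 2)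
    (h : Tendsto (fun n => eLpNorm (f - g n) 2 volume) atTop (𝓝 0)) (x : E) :
    Tendsto (fun n => conv k j (g n) x) atTop (𝓝 (conv k j f x)) := by
  obtain ⟨k', hk'⟩ := exists_dilate_eq k j
  have hkm : MemLp (fun y => dilate k j (x - y)) 2 := by
    rw [← hk']
    exact (k'.memLp 2 volume).comp_measurePreserving (Measure.measurePreserving_sub_left volume x)
  have hi : ∀ {u : E → ℂ}, MemLp u 2 → Integrable fun y => dilate k j (x - y) * u y := fun hu =>
    hkm.integrable_mul hu
  rw [tendsto_iff_edist_tendsto_0]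
  have hb : Tendsto (fun n => eLpNorm (fun y => dilate k j (x - y)) 2 volume *
      eLpNorm (f - g n) 2 volume) atTop (𝓝 0) := by
    simpa using ENNReal.Tendsto.const_mul h (Or.inr hkm.2.ne)
  refine tendsto_of_tendsto_of_tendsto_of_le_of_le tendsto_const_nhds hb (fun n => zero_le)
    fun n => ?_
  rw [edist_comm, edist_eq_enorm_sub, conv, conv, ← integral_sub (hi hf) (hi (hg n))]
  refine (enorm_integral_le_lintegral_enorm _).trans ?_
  rw [← eLpNorm_one_eq_lintegral_enorm]
  have : (fun y => dilate k j (x - y) * f y - dilate k j (x - y) * g n y) =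
      (fun y => dilate k j (x - y)) • (f - g n) := by
    ext y; simp [mul_sub]
  rw [this]
  exact eLpNorm_smul_le_mul_eLpNorm (hf.sub (hg n)).1 hkm.1

theorem exists_lintegral_sum_conv_sq_le (k : 𝓢(E, ℂ)) (h0 : 𝓕 k 0 = 0) :
    ∃ C : ℝ≥0∞, C ≠ ⊤ ∧ ∀ (J : Finset ℤ) (f : E → ℂ), StronglyMeasurable f →
      ∫⁻ x, ∑ j ∈ J, ‖conv k j f x‖ₑ ^ (2 : ℝ) ≤ C * ∫⁻ x, ‖f x‖ₑ ^ (2 : ℝ) := by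
  obtain ⟨C, hC, h⟩ := exists_sum_lintegral_conv_sq_le_schwartz k h0
  refine ⟨C + 1, by finiteness, fun J f hf => ?_⟩
  rcases eq_or_ne (∫⁻ x, ‖f x‖ₑ ^ (2 : ℝ)) ⊤ with ht | ht
  · rw [ht, ENNReal.mul_top (by simp)]; exact le_top
  have he : ∀ u : E → ℂ, eLpNorm u 2 volume = (∫⁻ x, ‖u x‖ₑ ^ (2 : ℝ)) ^ (1 / 2 : ℝ) := fun u => by
    simp [eLpNorm_eq_lintegral_rpow_enorm_toReal two_ne_zero ENNReal.ofNat_ne_top]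
  have hfm : MemLp f 2 := ⟨hf.aestronglyMeasurable, by
    rw [he]; exact ENNReal.rpow_lt_top_of_nonneg (by norm_num) ht⟩
  have hex : ∀ n : ℕ, ∃ g : 𝓢(E, ℂ), eLpNorm (f - ⇑g) 2 volume ≤ ENNReal.ofReal (1 / (n + 1)) := by
    intro n
    obtain ⟨g, hg₁, hg₂, hg₃⟩ := MemLp.exist_eLpNorm_sub_le (by simp) one_le_two hfm
      (ε := 1 / ((n : ℝ) + 1)) (by positivity)
    exact ⟨hg₁.toSchwartzMap hg₂, hg₃⟩
  choose g hg using hex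
  have hlim : Tendsto (fun n => eLpNorm (f - ⇑(g n)) 2 volume) atTop (𝓝 0) := by
    refine tendsto_of_tendsto_of_tendsto_of_le_of_le tendsto_const_nhds ?_ (fun n => zero_le) hg
    rw [← ENNReal.ofReal_zero]
    exact ENNReal.tendsto_ofReal tendsto_one_div_add_atTop_nhds_zero_nat
  have hlimn : Tendsto (fun n => eLpNorm (⇑(g n)) 2 volume) atTop (𝓝 (eLpNorm f 2 volume)) := by
    have h1 : ∀ n, eLpNorm (⇑(g n)) 2 volume ≤ eLpNorm f 2 volume + eLpNorm (f - ⇑(g n)) 2 volume :=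
      fun n => by
        have := eLpNorm_sub_le (p := 2) (μ := (volume : Measure E)) hfm.1
          (hfm.sub ((g n).memLp 2)).1 one_le_two
        simpa using this
    have h2 : ∀ n, eLpNorm f 2 volume - eLpNorm (f - ⇑(g n)) 2 volume ≤ eLpNorm (⇑(g n)) 2 volume :=
      fun n => by
        have := eLpNorm_add_le (p := 2) (μ := (volume : Measure E))
          (hfm.sub ((g n).memLp 2)).1 ((g n).memLp 2).1 one_le_two
        rw [tsub_le_iff_left]
        simpa using this
    refine tendsto_of_tendsto_of_tendsto_of_le_of_le ?_ ?_ h2 h1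
    · simpa using ENNReal.Tendsto.sub tendsto_const_nhds hlim (Or.inl hfm.2.ne)
    · simpa using tendsto_const_nhds.add hlim
  have hlims : Tendsto (fun n => ∫⁻ x, ‖g n x‖ₑ ^ (2 : ℝ)) atTop
      (𝓝 (∫⁻ x, ‖f x‖ₑ ^ (2 : ℝ))) := by
    have := ((ENNReal.continuous_rpow_const (y := 2)).tendsto _).comp hlimn
    simp only [he, Function.comp_def, ← ENNReal.rpow_mul] at this
    simpa using this
  have hpt : ∀ x, Tendsto (fun n => ∑ j ∈ J, ‖conv k j (g n) x‖ₑ ^ (2 : ℝ)) atTop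
      (𝓝 (∑ j ∈ J, ‖conv k j f x‖ₑ ^ (2 : ℝ))) := fun x =>
    tendsto_finsetSum _ fun j _ => ((ENNReal.continuous_rpow_const).tendsto _).comp
      ((continuous_enorm.tendsto _).comp (tendsto_conv k j hfm (fun n => (g n).memLp 2) hlim x))
  have hcm : ∀ n j, Measurable fun x => ‖conv k j (g n) x‖ₑ ^ (2 : ℝ) := fun n j => by
    obtain ⟨u, hu, -⟩ := exists_conv_eq k (g n) j
    rw [← hu]
    exact u.continuous.enorm.measurable.pow_const _
  calc _ = ∫⁻ x, liminf (fun n => ∑ j ∈ J, ‖conv k j (g n) x‖ₑ ^ (2 : ℝ)) atTop := by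
        congr 1 with x
        exact (hpt x).liminf_eq.symm
    _ ≤ liminf (fun n => ∫⁻ x, ∑ j ∈ J, ‖conv k j (g n) x‖ₑ ^ (2 : ℝ)) atTop :=
        lintegral_liminf_le fun n => Finset.measurable_sum _ fun j _ => hcm n j
    _ ≤ liminf (fun n => C * ∫⁻ x, ‖g n x‖ₑ ^ (2 : ℝ)) atTop := by
        refine liminf_le_liminf (Eventually.of_forall fun n => ?_)
        rw [lintegral_finsetSum _ fun j _ => hcm n j]
        exact h J (g n)
    _ = C * ∫⁻ x, ‖f x‖ₑ ^ (2 : ℝ) := (ENNReal.Tendsto.const_mul hlims (Or.inr hC)).liminf_eq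
    _ ≤ _ := mul_le_mul_left le_self_add _

end Plancherel

section Duality

open Set Metric Module Filter Topology

/-- The `L^p` norm of a nonnegative function. -/
noncomputable def lpn {α : Type*} [MeasureSpace α] (p : ℝ) (u : α → ℝ≥0∞) : ℝ≥0∞ :=
  (∫⁻ x, u x ^ p) ^ (1 / p)

variable {α : Type*} [MeasureSpace α] {p q : ℝ}

lemma lpn_ne_top (hp : 0 < p) {u : α → ℝ≥0∞} : lpn p u ≠ ⊤ ↔ ∫⁻ x, u x ^ p ≠ ⊤ := by
  rw [lpn, ne_eq, ENNReal.rpow_eq_top_iff_of_pos (by positivity)]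

lemma lpn_rpow (hp : 0 < p) (u : α → ℝ≥0∞) : lpn p u ^ p = ∫⁻ x, u x ^ p := by
  rw [lpn, ← ENNReal.rpow_mul, one_div_mul_cancel hp.ne', ENNReal.rpow_one]

lemma lpn_mono (hp : 0 < p) {u v : α → ℝ≥0∞} (h : ∀ x, u x ≤ v x) : lpn p u ≤ lpn p v :=
  ENNReal.rpow_le_rpow (lintegral_mono fun x => ENNReal.rpow_le_rpow (h x) hp.le) (by positivity)

lemma lpn_const_mul (hp : 0 < p) {c : ℝ≥0∞} (hc : c ≠ ⊤) (u : α → ℝ≥0∞) :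
    lpn p (fun x => c * u x) = c * lpn p u := by
  simp_rw [lpn, ENNReal.mul_rpow_of_nonneg _ _ hp.le]
  rw [lintegral_const_mul' _ _ (ENNReal.rpow_ne_top_of_nonneg hp.le hc),
    ENNReal.mul_rpow_of_nonneg _ _ (by positivity), ← ENNReal.rpow_mul, mul_one_div_cancel hp.ne',
    ENNReal.rpow_one]

lemma lpn_le_const_mul (hp : 0 < p) {c : ℝ≥0∞} {u v : α → ℝ≥0∞}
    (h : ∫⁻ x, u x ^ p ≤ c * ∫⁻ x, v x ^ p) : lpn p u ≤ c ^ (1 / p) * lpn p v := by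
  rw [lpn, lpn, ← ENNReal.mul_rpow_of_nonneg _ _ (by positivity)]
  exact ENNReal.rpow_le_rpow h (by positivity)

lemma lintegral_mul_le_lpn (hpq : p.HolderConjugate q) {u v : α → ℝ≥0∞} (hu : Measurable u)
    (hv : Measurable v) : ∫⁻ x, u x * v x ≤ lpn p u * lpn q v :=
  ENNReal.lintegral_mul_le_Lp_mul_Lq volume hpq hu.aemeasurable hv.aemeasurable

/-- The `L^p` norm is computed by duality. -/
theorem lpn_le_of_forall_inner {H : Type*} [NormedAddCommGroup H] [InnerProductSpace ℂ H]
    (hpq : p.HolderConjugate q) {u : α → H} (hu : StronglyMeasurable u)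
    (hup : lpn p (fun x => ‖u x‖ₑ) ≠ ⊤) {M : ℝ≥0∞}
    (h : ∀ w : α → H, StronglyMeasurable w → lpn q (fun x => ‖w x‖ₑ) ≠ ⊤ →
      ‖∫ x, inner ℂ (w x) (u x)‖ₑ ≤ M * lpn q (fun x => ‖w x‖ₑ)) :
    lpn p (fun x => ‖u x‖ₑ) ≤ M := by
  have hp := hpq.pos
  have hq := hpq.symm.pos
  set w : α → H := fun x => ((‖u x‖ ^ (p - 2) : ℝ) : ℂ) • u x with hw
  have hwm : StronglyMeasurable w :=
    (Complex.measurable_ofReal.comp (hu.norm.measurable.pow_const _)).stronglyMeasurable.smul hu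
  have hnw : ∀ x, ‖w x‖ₑ ^ q = ‖u x‖ₑ ^ p := fun x => by
    rw [hw]
    by_cases hx : u x = 0
    · simp [hx, hp, hq]
    have h0 : 0 < ‖u x‖ := norm_pos_iff.2 hx
    simp only [← ofReal_norm]
    rw [norm_smul, Complex.norm_real, Real.norm_of_nonneg (by positivity),
      ENNReal.ofReal_rpow_of_nonneg (by positivity) hq.le,
      ENNReal.ofReal_rpow_of_nonneg (by positivity) hp.le]
    congr 1
    nth_rewrite 2 [← Real.rpow_one ‖u x‖]
    rw [← Real.rpow_add h0, ← Real.rpow_mul h0.le]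
    congr 1
    have := hpq.symm.sub_one_mul_conj
    have := hpq.sub_one_mul_conj
    linarith
  have hin : ∀ x, inner ℂ (w x) (u x) = ((‖u x‖ ^ p : ℝ) : ℂ) := fun x => by
    rw [hw]
    by_cases hx : u x = 0
    · simp [hx, hp.ne']
    have h0 : 0 < ‖u x‖ := norm_pos_iff.2 hx
    have h1 : ‖u x‖ ^ (p - 2) * ‖u x‖ ^ 2 = ‖u x‖ ^ p := by
      rw [← Real.rpow_natCast, ← Real.rpow_add h0]
      congr 1
      push_cast
      ring
    rw [inner_smul_left, Complex.conj_ofReal, inner_self_eq_norm_sq_to_K, ← h1]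
    push_cast
    rfl
  have hN := (lpn_ne_top hp).1 hup
  set N := ∫⁻ x, ‖u x‖ₑ ^ p with hNdef
  have hlq : lpn q (fun x => ‖w x‖ₑ) = N ^ (1 / q) := by
    simp_rw [lpn, hnw, hNdef]
  have hinn : ‖∫ x, inner ℂ (w x) (u x)‖ₑ = N := by
    simp_rw [hin]
    rw [integral_complex_ofReal, ← ofReal_norm, Complex.norm_real, Real.norm_of_nonneg
      (integral_nonneg fun x => by positivity), integral_eq_lintegral_of_nonneg_ae
      (ae_of_all _ fun x => by positivity)
      (hu.norm.measurable.pow_const _).aestronglyMeasurable, ENNReal.ofReal_toReal]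
    · rw [hNdef]
      congr 1 with x
      rw [← ofReal_norm, ENNReal.ofReal_rpow_of_nonneg (by positivity) hp.le]
    · convert hN using 3 with x
      rw [← ofReal_norm, ENNReal.ofReal_rpow_of_nonneg (by positivity) hp.le]
  have key := h w hwm (by rw [hlq]; finiteness)
  rw [hinn, hlq] at key
  change N ^ (1 / p) ≤ M
  rcases eq_or_ne N 0 with h0 | h0
  · rw [h0, ENNReal.zero_rpow_of_pos (by positivity)]; exact zero_le
  have h1 : N ^ (1 / p) * N ^ (1 / q) = N := by
    rw [← ENNReal.rpow_add _ _ h0 hN, one_div, one_div, hpq.inv_add_inv_eq_one, ENNReal.rpow_one]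
  have h2 : N ^ (1 / q) ≠ 0 := by simp [h0, hN]
  have h3 : N ^ (1 / q) ≠ ⊤ := by finiteness
  exact (ENNReal.mul_le_mul_iff_left h2 h3).1 (h1.le.trans key)

end Duality

section Adjoint

open Set Metric Module Filter Topology

variable {E : Type*} [NormedAddCommGroup E] [InnerProductSpace ℝ E] [FiniteDimensional ℝ E]
  [MeasurableSpace E] [BorelSpace E] {p q : ℝ}

lemma exists_lpn_maximal_le [Nontrivial E] (hp : 1 < p) : ∃ C : ℝ≥0∞, C ≠ ⊤ ∧
    ∀ f : E → ℂ, Measurable f → lpn p (maximal fun y => ‖f y‖ₑ) ≤ C * lpn p fun x => ‖f x‖ₑ := by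
  obtain ⟨C, hC, h⟩ := exists_lintegral_maximal_rpow_le (E := E) hp
  refine ⟨C ^ (1 / p), by finiteness, fun f hf => lpn_le_const_mul (by linarith) ?_⟩
  simpa only [ofReal_norm] using h (fun x => ‖f x‖) hf.norm fun x => norm_nonneg _

lemma memLp_of_lpn_ne_top (hp : 0 < p) {V : Type*} [NormedAddCommGroup V] {f : E → V}
    (hf : StronglyMeasurable f) (h : lpn p (fun x => ‖f x‖ₑ) ≠ ⊤) :
    MemLp f (ENNReal.ofReal p) := by
  refine ⟨hf.aestronglyMeasurable, ?_⟩
  rw [eLpNorm_eq_lintegral_rpow_enorm_toReal (by simpa using hp) ENNReal.ofReal_ne_top,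
    ENNReal.toReal_ofReal hp.le]
  exact lt_top_iff_ne_top.2 h

lemma integrable_dilate_mul (k : 𝓢(E, ℂ)) (j : ℤ) (hp : 1 < p) {f : E → ℂ}
    (hf : StronglyMeasurable f) (hfp : lpn p (fun x => ‖f x‖ₑ) ≠ ⊤) (x : E) :
    Integrable fun y => dilate k j (x - y) * f y := by
  obtain ⟨k', hk'⟩ := exists_dilate_eq k j
  have hpq := Real.HolderConjugate.conjExponent hp
  have := hpq.symm.ennrealOfReal
  have hkm : MemLp (fun y => dilate k j (x - y)) (ENNReal.ofReal p.conjExponent) := by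
    rw [← hk']
    exact (k'.memLp _ volume).comp_measurePreserving (Measure.measurePreserving_sub_left volume x)
  exact hkm.integrable_mul (memLp_of_lpn_ne_top (by linarith) hf hfp)

/-- The reflected kernel. -/
noncomputable def reflect (k : 𝓢(E, ℂ)) : 𝓢(E, ℂ) :=
  compCLMOfContinuousLinearEquiv ℂ (LinearIsometryEquiv.neg ℝ (E := E)) k

lemma reflect_apply (k : 𝓢(E, ℂ)) (x : E) : reflect k x = k (-x) := rfl

lemma fourier_reflect_zero (k : 𝓢(E, ℂ)) : 𝓕 (reflect k) 0 = 𝓕 k 0 := by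
  rw [fourier_coe, fourier_coe, Real.fourier_eq, Real.fourier_eq]
  simp only [reflect_apply, inner_zero_right, neg_zero, AddChar.map_zero_eq_one, one_smul]
  exact integral_neg_eq_self k volume

lemma dilate_reflect (k : 𝓢(E, ℂ)) (j : ℤ) (x : E) :
    dilate (reflect k) j x = dilate k j (-x) := by
  simp [dilate, reflect_apply]

lemma stronglyMeasurable_conv {k : E → ℂ} (hk : Continuous k) (j : ℤ) {f : E → ℂ}
    (hf : StronglyMeasurable f) : StronglyMeasurable (conv k j f) := by
  have : StronglyMeasurable fun p : E × E => dilate k j (p.1 - p.2) * f p.2 :=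
    ((continuous_dilate hk j).comp (continuous_fst.sub continuous_snd)).stronglyMeasurable.mul
      (hf.comp_measurable measurable_snd)
  exact this.integral_prod_right

lemma exists_lpn_conv_le [Nontrivial E] (k : 𝓢(E, ℂ)) (hp : 1 < p) : ∃ C : ℝ≥0∞, C ≠ ⊤ ∧
    ∀ (j : ℤ) (f : E → ℂ), Measurable f →
      lpn p (fun x => ‖conv k j f x‖ₑ) ≤ C * lpn p fun x => ‖f x‖ₑ := by
  obtain ⟨A, hA, h⟩ := exists_enorm_conv_le_maximal k
  obtain ⟨C, hC, h'⟩ := exists_lpn_maximal_le (E := E) hp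
  refine ⟨A * C, by finiteness, fun j f hf => (lpn_mono (by linarith) (h j f hf)).trans ?_⟩
  rw [lpn_const_mul (by linarith) hA, mul_assoc]
  exact mul_le_mul_right (h' f hf) _

theorem integral_conv_mul [Nontrivial E] (k : 𝓢(E, ℂ)) (j : ℤ) (hpq : p.HolderConjugate q)
    {f g : E → ℂ} (hf : StronglyMeasurable f) (hg : StronglyMeasurable g)
    (hfp : lpn p (fun x => ‖f x‖ₑ) ≠ ⊤) (hgq : lpn q (fun x => ‖g x‖ₑ) ≠ ⊤) :
    ∫ x, conv k j f x * g x = ∫ x, f x * conv (reflect k) j g x := by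
  obtain ⟨A, hA, h⟩ := exists_lintegral_dilate_le_maximal k
  obtain ⟨C, hC, h'⟩ := exists_lpn_maximal_le (E := E) hpq.lt
  have hm : StronglyMeasurable fun z : E × E => dilate k j (z.1 - z.2) * f z.2 * g z.1 :=
    (((continuous_dilate k.continuous j).comp
      (continuous_fst.sub continuous_snd)).stronglyMeasurable.mul
      (hf.comp_measurable measurable_snd)).mul (hg.comp_measurable measurable_fst)
  have hi : Integrable (Function.uncurry fun x y => dilate k j (x - y) * f y * g x)
      (volume.prod volume) := by
    refine ⟨hm.aestronglyMeasurable, ?_⟩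
    change ∫⁻ z : E × E, ‖dilate k j (z.1 - z.2) * f z.2 * g z.1‖ₑ ∂_ < ⊤
    rw [lintegral_prod _ hm.enorm.aemeasurable]
    calc _ ≤ ∫⁻ x, A * (maximal (fun y => ‖f y‖ₑ) x * ‖g x‖ₑ) := by
          refine lintegral_mono fun x => ?_
          simp only [enorm_mul]
          rw [lintegral_mul_const' _ _ enorm_ne_top, ← mul_assoc]
          exact mul_le_mul_left (h j _ hf.enorm x) _
      _ = A * ∫⁻ x, maximal (fun y => ‖f y‖ₑ) x * ‖g x‖ₑ := lintegral_const_mul' _ _ hA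
      _ ≤ A * (lpn p (maximal fun y => ‖f y‖ₑ) * lpn q fun x => ‖g x‖ₑ) :=
          mul_le_mul_right (lintegral_mul_le_lpn hpq (measurable_maximal _) hg.enorm) _
      _ ≤ A * (C * lpn p (fun y => ‖f y‖ₑ) * lpn q fun x => ‖g x‖ₑ) :=
          mul_le_mul_right (mul_le_mul_left (h' f hf.measurable) _) _
      _ < ⊤ := by finiteness
  calc _ = ∫ x, ∫ y, dilate k j (x - y) * f y * g x := by
        congr 1 with x
        rw [conv, integral_mul_const]
    _ = ∫ y, ∫ x, dilate k j (x - y) * f y * g x := integral_integral_swap hi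
    _ = _ := by
        congr 1 with y
        rw [conv, ← integral_const_mul]
        congr 1 with x
        rw [dilate_reflect, neg_sub]
        ring

end Adjoint

section SquareFunction

open Set Metric Module Filter Topology

variable {E : Type*} [NormedAddCommGroup E] [InnerProductSpace ℝ E] [FiniteDimensional ℝ E]
  [MeasurableSpace E] [BorelSpace E]
  {V : Type*} [NormedAddCommGroup V] [NormedSpace ℂ V]
  {W : Type*} [NormedAddCommGroup W] [NormedSpace ℂ W] {p q : ℝ}

/-- The operator-valued kernel combining the dilations of `k` at the scales in `J`. -/
noncomputable def sumKernel (k : E → ℂ) (J : Finset ℤ) (T : J → V →L[ℂ] W) (x : E) : V →L[ℂ] W :=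
  ∑ j : J, dilate k j x • T j

/-- The constant in the `L^p` bound for Calderón–Zygmund operators on a space of dimension `n`. -/
noncomputable def czConst (p : ℝ) (n : ℕ) (A : ℝ≥0∞) : ℝ≥0∞ :=
  2 ^ p * ENNReal.ofReal p *
      ((50 ^ n + 16 * 15 ^ n * A + 4 * A) * ENNReal.ofReal (p - 1)⁻¹ + A * ENNReal.ofReal (2 - p)⁻¹)

lemma czConst_ne_top (hp : 0 < p) {n : ℕ} {A : ℝ≥0∞} (hA : A ≠ ⊤) : czConst p n A ≠ ⊤ := by
  have : (2 : ℝ≥0∞) ^ p ≠ ⊤ := ENNReal.rpow_ne_top_of_nonneg hp.le (by simp)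
  unfold czConst
  finiteness

lemma integrable_dilate (k : 𝓢(E, ℂ)) (j : ℤ) : Integrable (dilate k j) := by
  obtain ⟨k', hk'⟩ := exists_dilate_eq k j
  rw [← hk']
  exact k'.integrable

lemma continuous_sumKernel {k : E → ℂ} (hk : Continuous k) (J : Finset ℤ) (T : J → V →L[ℂ] W) :
    Continuous (sumKernel k J T) :=
  continuous_finsetSum _ fun j _ => (continuous_dilate hk j).smul continuous_const

lemma integrable_sumKernel (k : 𝓢(E, ℂ)) (J : Finset ℤ) (T : J → V →L[ℂ] W) :
    Integrable (sumKernel k J T) := by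
  have hi : Integrable fun x => ∑ j : J, ‖dilate k j x‖ * ‖T j‖ :=
    integrable_finsetSum _ fun j _ => (integrable_dilate k j).norm.mul_const _
  refine hi.mono' (continuous_sumKernel k.continuous J T).aestronglyMeasurable
    (ae_of_all _ fun x => (norm_sum_le _ _).trans (Finset.sum_le_sum fun j _ => ?_))
  rw [norm_smul]

theorem lintegral_convOp_sumKernel_rpow_le [Nontrivial E] [CompleteSpace V] [CompleteSpace W]
    (k : 𝓢(E, ℂ)) {A : ℝ≥0∞}
    (hA : ∀ (J : Finset ℤ) (y : E), ∑ j ∈ J, ∫⁻ x in {x | 2 * ‖y‖ < ‖x‖},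
      ‖dilate k j (x - y) - dilate k j x‖ₑ ≤ A)
    {J : Finset ℤ} {T : J → V →L[ℂ] W} (hT : ∀ j, ‖T j‖ ≤ 1)
    (hL : ∀ f : E → V, StronglyMeasurable f →
      ∫⁻ x, ‖convOp (sumKernel k J T) f x‖ₑ ^ (2 : ℝ) ≤ A * ∫⁻ x, ‖f x‖ₑ ^ (2 : ℝ))
    (hp : 1 < p) (hp2 : p < 2) {f : E → V} (hf : StronglyMeasurable f)
    (hfp : ∫⁻ x, ‖f x‖ₑ ^ p ≠ ⊤) :
    ∫⁻ x, ‖convOp (sumKernel k J T) f x‖ₑ ^ p ≤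
      czConst p (finrank ℝ E) A * ∫⁻ x, ‖f x‖ₑ ^ p := by
  choose k' hk' using exists_dilate_eq k
  refine lintegral_convOp_rpow_le (continuous_sumKernel k.continuous J T)
    (B := ∑ j : J, SchwartzMap.seminorm ℝ 0 0 (k' j)) (fun x => ?_) ?_
      (fun y => ?_) hL hp hp2 hf hfp
  · refine (norm_sum_le _ _).trans (Finset.sum_le_sum fun j _ => ?_)
    rw [norm_smul, ← hk']
    exact (mul_le_of_le_one_right (norm_nonneg _) (hT j)).trans
      (SchwartzMap.norm_le_seminorm ℝ (k' j) x)
  · exact integrable_sumKernel k J T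
  · refine le_trans ?_ (hA J y)
    have hm : ∀ j : ℤ, Measurable fun x => ‖dilate k j (x - y) - dilate k j x‖ₑ := fun j => by
      have := continuous_dilate k.continuous j
      exact (by fun_prop : Continuous fun x => dilate k j (x - y) - dilate k j x).enorm.measurable
    rw [← lintegral_finsetSum _ fun j _ => hm j]
    refine lintegral_mono fun x => ?_
    rw [sumKernel, sumKernel, ← Finset.sum_sub_distrib,
      ← Finset.sum_coe_sort J fun j => ‖dilate k j (x - y) - dilate k j x‖ₑ]
    refine (enorm_sum_le Finset.univ fun j : J =>
      dilate k j (x - y) • T j - dilate k j x • T j).trans (Finset.sum_le_sum fun j _ => ?_)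
    rw [← sub_smul, enorm_smul]
    refine mul_le_of_le_one_right zero_le ?_
    rw [← ofReal_norm, ← ENNReal.ofReal_one]
    exact ENNReal.ofReal_le_ofReal (hT j)

lemma convOp_sumKernel [CompleteSpace W] {k : E → ℂ} {J : Finset ℤ} {T : J → V →L[ℂ] W} {f : E → V}
    {g : J → E → ℂ} {e : J → W} (h : ∀ j y, T j (f y) = g j y • e j) {x : E}
    (hi : ∀ j : J, Integrable fun y => dilate k j (x - y) * g j y) :
    convOp (sumKernel k J T) f x = ∑ j : J, conv k j (g j) x • e j := by
  simp only [convOp, sumKernel, sum_apply, smul_apply, h, smul_smul]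
  rw [integral_finsetSum _ fun j _ => (hi j).smul_const (e j)]
  refine Finset.sum_congr rfl fun j _ => ?_
  rw [integral_smul_const, conv]

lemma enorm_euclidean_sq {ι : Type*} [Fintype ι] (x : EuclideanSpace ℂ ι) :
    ‖x‖ₑ ^ (2 : ℝ) = ∑ i, ‖x i‖ₑ ^ (2 : ℝ) := by
  simp only [ENNReal.rpow_ofNat, ← ofReal_norm, ← ENNReal.ofReal_pow (norm_nonneg _)]
  rw [EuclideanSpace.norm_sq_eq, ENNReal.ofReal_sum_of_nonneg fun i _ => by positivity]

/-- The square function of a family of dilated kernels at the scales in `J`. -/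
noncomputable def sq (k : E → ℂ) (J : Finset ℤ) (f : E → ℂ) (x : E) : ℝ≥0∞ :=
  (∑ j ∈ J, ‖conv k j f x‖ₑ ^ (2 : ℝ)) ^ (1 / 2 : ℝ)

lemma enorm_toLp_conv (k : E → ℂ) (J : Finset ℤ) (f : E → ℂ) (x : E) :
    ‖(WithLp.toLp 2 fun j : J => conv k j f x : EuclideanSpace ℂ J)‖ₑ = sq k J f x := by
  rw [sq, ← Finset.sum_coe_sort J fun j => ‖conv k j f x‖ₑ ^ (2 : ℝ),
    ← enorm_euclidean_sq (WithLp.toLp 2 fun j : J => conv k j f x : EuclideanSpace ℂ J),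
    ← ENNReal.rpow_mul]
  simp

lemma measurable_sq {k : E → ℂ} (hk : Continuous k) (J : Finset ℤ) {f : E → ℂ}
    (hf : StronglyMeasurable f) : Measurable (sq k J f) :=
  (Finset.measurable_sum _ fun j _ =>
    (stronglyMeasurable_conv hk j hf).enorm.pow_const _).pow_const _

/-- The vector-valued kernel whose operator is the square function. -/
noncomputable def sqMap (J : Finset ℤ) (j : J) : ℂ →L[ℂ] EuclideanSpace ℂ J :=
  ContinuousLinearMap.toSpanSingleton ℂ (EuclideanSpace.single j 1)

lemma enorm_convOp_sqMap (k : 𝓢(E, ℂ)) (J : Finset ℤ) (hp : 1 < p) {f : E → ℂ}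
    (hf : StronglyMeasurable f) (hfp : lpn p (fun x => ‖f x‖ₑ) ≠ ⊤) (x : E) :
    ‖convOp (sumKernel k J (sqMap J)) f x‖ₑ = sq k J f x := by
  rw [convOp_sumKernel (g := fun _ => f) (e := fun j => EuclideanSpace.single j 1)
    (fun j y => rfl) fun j => integrable_dilate_mul k j hp hf hfp x, ← enorm_toLp_conv]
  congr 1
  ext i
  simp [Finset.sum_apply, Pi.single_apply]

lemma lpn_two_sq_le {k : 𝓢(E, ℂ)} {C : ℝ≥0∞} (hC : ∀ (J : Finset ℤ) (f : E → ℂ),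
    StronglyMeasurable f → ∫⁻ x, ∑ j ∈ J, ‖conv k j f x‖ₑ ^ (2 : ℝ) ≤ C * ∫⁻ x, ‖f x‖ₑ ^ (2 : ℝ))
    (J : Finset ℤ) {f : E → ℂ} (hf : StronglyMeasurable f) :
    lpn 2 (sq k J f) ≤ C ^ (1 / 2 : ℝ) * lpn 2 fun x => ‖f x‖ₑ := by
  refine lpn_le_const_mul two_pos ((le_of_eq ?_).trans (hC J f hf))
  congr 1 with x
  rw [sq, ← ENNReal.rpow_mul]
  norm_num

lemma lpn_eq_eLpNorm (hp : 0 < p) (f : E → V) :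
    lpn p (fun x => ‖f x‖ₑ) = eLpNorm f (ENNReal.ofReal p) volume := by
  rw [eLpNorm_eq_lintegral_rpow_enorm_toReal (by simpa using hp) ENNReal.ofReal_ne_top,
    ENNReal.toReal_ofReal hp.le, lpn]

lemma memLp_conv [Nontrivial E] (k : 𝓢(E, ℂ)) (j : ℤ) (hp : 1 < p) {f : E → ℂ}
    (hf : StronglyMeasurable f) (hfp : lpn p (fun x => ‖f x‖ₑ) ≠ ⊤) :
    MemLp (conv k j f) (ENNReal.ofReal p) := by
  obtain ⟨C, hC, h⟩ := exists_lpn_conv_le k hp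
  exact memLp_of_lpn_ne_top (by linarith) (stronglyMeasurable_conv k.continuous j hf)
    (ne_top_of_le_ne_top (by finiteness) (h j f hf.measurable))

lemma integral_sum_conv_mul [Nontrivial E] (k : 𝓢(E, ℂ)) (J : Finset ℤ) (hpq : p.HolderConjugate q)
    {f : E → ℂ} {g : J → E → ℂ} (hf : StronglyMeasurable f) (hg : ∀ j, StronglyMeasurable (g j))
    (hfp : lpn p (fun x => ‖f x‖ₑ) ≠ ⊤) (hgq : ∀ j, lpn q (fun x => ‖g j x‖ₑ) ≠ ⊤) :
    ∫ x, ∑ j : J, conv k j f x * g j x = ∫ x, f x * ∑ j : J, conv (reflect k) j (g j) x := by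
  have := hpq.ennrealOfReal
  simp_rw [Finset.mul_sum]
  rw [integral_finsetSum, integral_finsetSum]
  · exact Finset.sum_congr rfl fun j _ => integral_conv_mul k j hpq hf (hg j) hfp (hgq j)
  · exact fun j _ => (memLp_of_lpn_ne_top hpq.pos hf hfp).integrable_mul
      (memLp_conv (reflect k) j hpq.symm.lt (hg j) (hgq j))
  · exact fun j _ => (memLp_conv k j hpq.lt hf hfp).integrable_mul
      (memLp_of_lpn_ne_top hpq.symm.pos (hg j) (hgq j))

lemma lintegral_enorm_sum_mul_le {ι : Type*} [Fintype ι] (u v : ι → E → ℂ) :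
    ‖∫ x, ∑ i, u i x * v i x‖ₑ ≤ ∫⁻ x, (∑ i, ‖u i x‖ₑ ^ (2 : ℝ)) ^ (1 / 2 : ℝ) *
      (∑ i, ‖v i x‖ₑ ^ (2 : ℝ)) ^ (1 / 2 : ℝ) := by
  refine (enorm_integral_le_lintegral_enorm _).trans (lintegral_mono fun x => ?_)
  refine (enorm_sum_le _ _).trans ?_
  simp_rw [enorm_mul]
  exact ENNReal.inner_le_Lp_mul_Lq _ _ _ Real.HolderConjugate.two_two

lemma lpn_coord_ne_top {ι : Type*} [Fintype ι] (hp : 0 < p) {w : E → EuclideanSpace ℂ ι}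
    (h : lpn p (fun x => ‖w x‖ₑ) ≠ ⊤) (i : ι) : lpn p (fun x => ‖w x i‖ₑ) ≠ ⊤ := by
  refine ne_top_of_le_ne_top h (lpn_mono hp fun x => ?_)
  rw [enorm_le_iff_norm_le]
  exact PiLp.norm_apply_le (w x) i

lemma stronglyMeasurable_coord {ι : Type*} [Fintype ι] {w : E → EuclideanSpace ℂ ι}
    (h : StronglyMeasurable w) (i : ι) : StronglyMeasurable fun x => w x i :=
  (EuclideanSpace.proj (𝕜 := ℂ) i).continuous.comp_stronglyMeasurable h

lemma convOp_proj (k : 𝓢(E, ℂ)) (J : Finset ℤ) (hp : 1 < p) {w : E → EuclideanSpace ℂ J}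
    (hw : StronglyMeasurable w) (hwp : lpn p (fun x => ‖w x‖ₑ) ≠ ⊤) (x : E) :
    convOp (sumKernel k J fun j => (EuclideanSpace.proj j : EuclideanSpace ℂ J →L[ℂ] ℂ)) w x =
      ∑ j : J, conv k j (fun y => w y j) x := by
  rw [convOp_sumKernel (g := fun j y => w y j) (e := fun _ => (1 : ℂ)) (fun j y => by simp)
    fun j => integrable_dilate_mul k j hp (stronglyMeasurable_coord hw j)
      (lpn_coord_ne_top (by linarith) hwp j) x]
  simp

/-- The adjoint of the square function is bounded on `L²`. -/
lemma lpn_two_convOp_proj_le [Nontrivial E] {k : 𝓢(E, ℂ)} {C : ℝ≥0∞}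
    (hC : ∀ (J : Finset ℤ) (f : E → ℂ), StronglyMeasurable f →
      ∫⁻ x, ∑ j ∈ J, ‖conv k j f x‖ₑ ^ (2 : ℝ) ≤ C * ∫⁻ x, ‖f x‖ₑ ^ (2 : ℝ))
    (J : Finset ℤ) {w : E → EuclideanSpace ℂ J}
    (hw : StronglyMeasurable w) (hwp : lpn 2 (fun x => ‖w x‖ₑ) ≠ ⊤) :
    lpn 2 (fun x => ‖∑ j : J, conv (reflect k) j (fun y => w y j) x‖ₑ) ≤
      C ^ (1 / 2 : ℝ) * lpn 2 fun x => ‖w x‖ₑ := by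
  have hpq : (2 : ℝ).HolderConjugate 2 := Real.HolderConjugate.two_two
  have hwj := stronglyMeasurable_coord hw
  have hwpj := lpn_coord_ne_top two_pos hwp
  have hmem : MemLp (fun x => ∑ j : J, conv (reflect k) j (fun y => w y j) x)
      (ENNReal.ofReal 2) := memLp_finsetSum _ fun (j : J) _ =>
    memLp_conv (reflect k) j one_lt_two (hwj j) (hwpj j)
  refine lpn_le_of_forall_inner hpq (Finset.stronglyMeasurable_fun_sum _ fun (j : J) _ =>
    stronglyMeasurable_conv (reflect k).continuous j (hwj j)) ?_ fun h hh hhq => ?_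
  · rw [lpn_eq_eLpNorm two_pos]
    exact hmem.2.ne
  have hn : ∀ x, ‖(starRingEnd ℂ) (h x)‖ₑ = ‖h x‖ₑ := fun x => by simp [← ofReal_norm]
  have hsm : StronglyMeasurable fun x => (starRingEnd ℂ) (h x) :=
    Complex.continuous_conj.comp_stronglyMeasurable hh
  have := integral_sum_conv_mul k J hpq (f := fun x => starRingEnd ℂ (h x)) hsm hwj
    (by simpa only [hn] using hhq) hwpj
  simp only [RCLike.inner_apply']
  rw [← this]
  refine (lintegral_enorm_sum_mul_le _ _).trans ?_
  simp_rw [← enorm_euclidean_sq, ← ENNReal.rpow_mul]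
  rw [mul_assoc, mul_comm (lpn 2 fun x => ‖w x‖ₑ), ← mul_assoc]
  have h2 := lpn_two_sq_le hC J hsm
  simp only [hn] at h2
  refine le_trans (le_of_eq ?_) ((lintegral_mul_le_lpn hpq
    (measurable_sq k.continuous J hsm) hw.enorm).trans (mul_le_mul_left h2 _))
  congr 1 with x
  rw [sq, ← Finset.sum_coe_sort J]
  simp

end SquareFunction

section SquareFunctionBounds

open Set Metric Module Filter Topology

variable {E : Type*} [NormedAddCommGroup E] [InnerProductSpace ℝ E] [FiniteDimensional ℝ E]
  [MeasurableSpace E] [BorelSpace E] [Nontrivial E] {p q : ℝ}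

lemma norm_sqMap_le (J : Finset ℤ) (j : J) : ‖sqMap J j‖ ≤ 1 := by
  simp [sqMap]

lemma norm_proj_le (J : Finset ℤ) (j : J) :
    ‖(EuclideanSpace.proj j : EuclideanSpace ℂ J →L[ℂ] ℂ)‖ ≤ 1 :=
  ContinuousLinearMap.opNorm_le_bound _ zero_le_one fun x => by
    simpa using PiLp.norm_apply_le x j

lemma exists_lpn_sq_le_of_lt_two (k : 𝓢(E, ℂ)) (h0 : 𝓕 k 0 = 0) (hp : 1 < p) (hp2 : p < 2) :
    ∃ C : ℝ≥0∞, C ≠ ⊤ ∧ ∀ (J : Finset ℤ) (f : E → ℂ), StronglyMeasurable f →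
      lpn p (fun x => ‖f x‖ₑ) ≠ ⊤ → lpn p (sq k J f) ≤ C * lpn p fun x => ‖f x‖ₑ := by
  obtain ⟨A, hA, hAk⟩ := exists_sum_lintegral_dilate_sub_le k
  obtain ⟨B, hB, hBk⟩ := exists_lintegral_sum_conv_sq_le k h0
  have hp0 : 0 < p := by linarith
  have hcz := czConst_ne_top hp0 (n := finrank ℝ E) (A := A + B + 1) (by finiteness)
  refine ⟨czConst p (finrank ℝ E) (A + B + 1) ^ (1 / p), by finiteness, fun J f hf hfp => ?_⟩
  have := lintegral_convOp_sumKernel_rpow_le k (A := A + B + 1) (T := sqMap J)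
    (fun J y => (hAk J y).trans (by rw [add_assoc]; exact le_self_add)) (norm_sqMap_le J)
    (fun g hg => ?_) hp hp2 hf ((lpn_ne_top hp0).1 hfp)
  · simp_rw [enorm_convOp_sqMap k J hp hf hfp] at this
    exact lpn_le_const_mul hp0 this
  · rcases eq_or_ne (∫⁻ x, ‖g x‖ₑ ^ (2 : ℝ)) ⊤ with ht | ht
    · rw [ht, ENNReal.mul_top (by simp)]; exact le_top
    simp_rw [enorm_convOp_sqMap k J one_lt_two hg ((lpn_ne_top two_pos).2 ht)]
    refine (le_of_eq ?_).trans ((hBk J g hg).trans (mul_le_mul_left ?_ _))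
    · congr 1 with x
      rw [sq, ← ENNReal.rpow_mul]
      norm_num
    · rw [add_right_comm]; exact le_add_self

/-- The adjoint of the square function is bounded on `L^p` for `1 < p < 2`. -/
lemma exists_lpn_sum_conv_le_of_lt_two (k : 𝓢(E, ℂ)) (h0 : 𝓕 k 0 = 0) (hp : 1 < p) (hp2 : p < 2) :
    ∃ C : ℝ≥0∞, C ≠ ⊤ ∧ ∀ (J : Finset ℤ) (w : E → EuclideanSpace ℂ J), StronglyMeasurable w →
      lpn p (fun x => ‖w x‖ₑ) ≠ ⊤ →
      lpn p (fun x => ‖∑ j : J, conv (reflect k) j (fun y => w y j) x‖ₑ) ≤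
        C * lpn p fun x => ‖w x‖ₑ := by
  obtain ⟨A, hA, hAk⟩ := exists_sum_lintegral_dilate_sub_le (reflect k)
  obtain ⟨B, hB, hBk⟩ := exists_lintegral_sum_conv_sq_le k h0
  have hp0 : 0 < p := by linarith
  have hcz := czConst_ne_top hp0 (n := finrank ℝ E) (A := A + B + 1) (by finiteness)
  refine ⟨czConst p (finrank ℝ E) (A + B + 1) ^ (1 / p), by finiteness, fun J w hw hwp => ?_⟩
  have := lintegral_convOp_sumKernel_rpow_le (reflect k) (A := A + B + 1)
    (fun J y => (hAk J y).trans (by rw [add_assoc]; exact le_self_add)) (norm_proj_le J)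
    (fun g hg => ?_) hp hp2 hw ((lpn_ne_top hp0).1 hwp)
  · simp_rw [convOp_proj (reflect k) J hp hw hwp] at this
    exact lpn_le_const_mul hp0 this
  · rcases eq_or_ne (∫⁻ x, ‖g x‖ₑ ^ (2 : ℝ)) ⊤ with ht | ht
    · rw [ht, ENNReal.mul_top (by simp)]; exact le_top
    have ht' := (lpn_ne_top two_pos).2 ht
    simp_rw [convOp_proj (reflect k) J one_lt_two hg ht']
    have h2 := ENNReal.rpow_le_rpow (lpn_two_convOp_proj_le hBk J hg ht') zero_le_two
    rw [ENNReal.mul_rpow_of_nonneg _ _ zero_le_two, lpn_rpow two_pos, lpn_rpow two_pos,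
      ← ENNReal.rpow_mul, one_div_mul_cancel two_ne_zero, ENNReal.rpow_one] at h2
    refine h2.trans (mul_le_mul_left ?_ _)
    rw [add_right_comm]; exact le_add_self

lemma exists_lpn_sq_le_of_two_lt (k : 𝓢(E, ℂ)) (h0 : 𝓕 k 0 = 0) (hp2 : 2 < p) :
    ∃ C : ℝ≥0∞, C ≠ ⊤ ∧ ∀ (J : Finset ℤ) (f : E → ℂ), StronglyMeasurable f →
      lpn p (fun x => ‖f x‖ₑ) ≠ ⊤ → lpn p (sq k J f) ≤ C * lpn p fun x => ‖f x‖ₑ := by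
  have hp : 1 < p := by linarith
  have hpq := Real.HolderConjugate.conjExponent hp
  set q := p.conjExponent
  have hq2 : q < 2 := by
    have := hpq.sub_one_mul_conj
    nlinarith [hpq.symm.pos, hpq.symm.lt]
  obtain ⟨C, hC, h⟩ := exists_lpn_sum_conv_le_of_lt_two k h0 hpq.symm.lt hq2
  refine ⟨C, hC, fun J f hf hfp => ?_⟩
  have hfm := memLp_of_lpn_ne_top hpq.pos hf hfp
  have hum : StronglyMeasurable fun x =>
      (WithLp.toLp 2 fun j : J => conv k j f x : EuclideanSpace ℂ J) :=
    (PiLp.continuous_toLp 2 _).comp_stronglyMeasurable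
      (measurable_pi_lambda _ fun j : J =>
        (stronglyMeasurable_conv k.continuous j hf).measurable).stronglyMeasurable
  have hup : lpn p (fun x => ‖(WithLp.toLp 2 fun j : J => conv k j f x : EuclideanSpace ℂ J)‖ₑ)
      ≠ ⊤ := by
    have hb : MemLp (fun x => ∑ j : J, ‖conv k j f x‖) (ENNReal.ofReal p) :=
      memLp_finsetSum _ fun (j : J) _ => (memLp_conv k j hp hf hfp).norm
    rw [lpn_eq_eLpNorm hpq.pos]
    refine (hb.mono hum.aestronglyMeasurable (ae_of_all _ fun x => ?_)).2.ne
    rw [Real.norm_of_nonneg (by positivity), EuclideanSpace.norm_eq]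
    refine Real.sqrt_le_iff.2 ⟨by positivity, ?_⟩
    exact Finset.sum_sq_le_sq_sum_of_nonneg fun i _ => norm_nonneg _
  have key := lpn_le_of_forall_inner hpq hum hup (M := C * lpn p fun x => ‖f x‖ₑ)
    fun w hw hwq => ?_
  · simpa only [enorm_toLp_conv] using key
  set v : E → EuclideanSpace ℂ J := fun x => WithLp.toLp 2 fun j => (starRingEnd ℂ) (w x j) with hv
  have hvn : ∀ x, ‖v x‖ₑ = ‖w x‖ₑ := fun x => by
    rw [enorm_eq_iff_norm_eq, EuclideanSpace.norm_eq, EuclideanSpace.norm_eq]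
    simp [hv]
  have hvm : StronglyMeasurable v := by
    refine (PiLp.continuous_toLp 2 _).comp_stronglyMeasurable (measurable_pi_lambda _
      fun j : J => ?_).stronglyMeasurable
    exact (Complex.continuous_conj.comp_stronglyMeasurable
      (stronglyMeasurable_coord hw j)).measurable
  have hvq : lpn q (fun x => ‖v x‖ₑ) ≠ ⊤ := by simpa only [hvn] using hwq
  have h1 : ∀ x, inner ℂ (w x) (WithLp.toLp 2 fun j : J => conv k j f x : EuclideanSpace ℂ J) =
      ∑ j : J, conv k j f x * v x j := fun x => by
    rw [PiLp.inner_apply]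
    rfl
  simp_rw [h1]
  rw [integral_sum_conv_mul k J hpq (g := fun j x => v x j) hf (stronglyMeasurable_coord hvm) hfp
    (lpn_coord_ne_top hpq.symm.pos hvq)]
  refine (enorm_integral_le_lintegral_enorm _).trans ?_
  simp_rw [enorm_mul]
  refine (lintegral_mul_le_lpn hpq hf.enorm (Finset.stronglyMeasurable_fun_sum _
    fun (j : J) _ => stronglyMeasurable_conv (reflect k).continuous j
      (stronglyMeasurable_coord hvm j)).enorm).trans ?_
  refine (mul_le_mul_right (h J v hvm hvq) _).trans (le_of_eq ?_)
  simp_rw [hvn]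
  ring

/-- The square function associated with a mean-zero Schwartz kernel is bounded on `L^p`,
`1 < p < ∞`, uniformly in the finite set of scales. -/
theorem exists_lpn_sq_le (k : 𝓢(E, ℂ)) (h0 : 𝓕 k 0 = 0) (hp : 1 < p) :
    ∃ C : ℝ≥0∞, C ≠ ⊤ ∧ ∀ (J : Finset ℤ) (f : E → ℂ), StronglyMeasurable f →
      lpn p (sq k J f) ≤ C * lpn p fun x => ‖f x‖ₑ := by
  obtain ⟨C, hC, h⟩ : ∃ C : ℝ≥0∞, C ≠ ⊤ ∧ ∀ (J : Finset ℤ) (f : E → ℂ), StronglyMeasurable f →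
      lpn p (fun x => ‖f x‖ₑ) ≠ ⊤ → lpn p (sq k J f) ≤ C * lpn p fun x => ‖f x‖ₑ := by
    rcases lt_trichotomy p 2 with hp2 | rfl | hp2
    · exact exists_lpn_sq_le_of_lt_two k h0 hp hp2
    · obtain ⟨B, hB, hBk⟩ := exists_lintegral_sum_conv_sq_le k h0
      exact ⟨B ^ (1 / 2 : ℝ), by finiteness, fun J f hf _ => lpn_two_sq_le hBk J hf⟩
    · exact exists_lpn_sq_le_of_two_lt k h0 hp2
  refine ⟨C + 1, by finiteness, fun J f hf => ?_⟩
  rcases eq_or_ne (lpn p fun x => ‖f x‖ₑ) ⊤ with ht | ht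
  · rw [ht, ENNReal.mul_top (by simp)]; exact le_top
  · exact (h J f hf ht).trans (mul_le_mul_left le_self_add _)

end SquareFunctionBounds

section SchwartzMultipliers

open Set Metric Module Filter Topology

variable {E : Type*} [NormedAddCommGroup E] [InnerProductSpace ℝ E] [FiniteDimensional ℝ E]
  [MeasurableSpace E] [BorelSpace E]

/-- The pointwise product of two Schwartz functions. -/
noncomputable def mulS (f g : 𝓢(E, ℂ)) : 𝓢(E, ℂ) :=
  SchwartzMap.pairing (ContinuousLinearMap.mul ℂ ℂ) f g

@[simp] lemma mulS_apply (f g : 𝓢(E, ℂ)) (x : E) : mulS f g x = f x * g x := rfl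

/-- `conv k j f` as a Schwartz function. -/
noncomputable def convS (k : 𝓢(E, ℂ)) (j : ℤ) (f : 𝓢(E, ℂ)) : 𝓢(E, ℂ) :=
  (exists_conv_eq k f j).choose

@[simp] lemma coe_convS (k : 𝓢(E, ℂ)) (j : ℤ) (f : 𝓢(E, ℂ)) : ⇑(convS k j f) = conv k j f :=
  (exists_conv_eq k f j).choose_spec.1

lemma fourier_convS (k : 𝓢(E, ℂ)) (j : ℤ) (f : 𝓢(E, ℂ)) (ξ : E) :
    𝓕 (convS k j f) ξ = 𝓕 k (((2 : ℝ) ^ j)⁻¹ • ξ) * 𝓕 f ξ :=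
  (exists_conv_eq k f j).choose_spec.2 ξ

lemma ext_fourier {f g : 𝓢(E, ℂ)} (h : ∀ ξ, 𝓕 f ξ = 𝓕 g ξ) : f = g := by
  have hfg : 𝓕 f = 𝓕 g := SchwartzMap.ext h
  have := congrArg (fun u : 𝓢(E, ℂ) => (𝓕⁻ u : 𝓢(E, ℂ))) hfg
  simpa using this

lemma fourier_mulS (f g : 𝓢(E, ℂ)) (ζ : E) :
    𝓕 (mulS f g) ζ = ∫ η, 𝓕 f η * 𝓕 g (ζ - η) := by
  have h : mulS f g = 𝓕⁻ (SchwartzMap.convolution (ContinuousLinearMap.mul ℂ ℂ) (𝓕 f) (𝓕 g)) := by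
    have h' : ∀ (u : 𝓢(E, ℂ)) (x : E), 𝓕 (𝓕 u) (-x) = u x := fun u x => by
      change (𝓕⁻ (𝓕 u)) x = u x
      simp
    ext x
    change f x * g x =
      𝓕 (SchwartzMap.convolution (ContinuousLinearMap.mul ℂ ℂ) (𝓕 f) (𝓕 g)) (-x)
    rw [SchwartzMap.fourier_convolution, ← h' f, ← h' g]
    rfl
  rw [h, FourierTransform.fourier_fourierInv_eq, SchwartzMap.convolution_apply]
  rfl

lemma exists_fourier_eq {m : E → ℂ} (hm : ContDiff ℝ (↑(⊤ : ℕ∞)) m) (hc : HasCompactSupport m) :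
    ∃ k : 𝓢(E, ℂ), ∀ ξ, 𝓕 k ξ = m ξ :=
  ⟨𝓕⁻ (hc.toSchwartzMap hm), fun ξ => by rw [FourierTransform.fourier_fourierInv_eq]; rfl⟩

end SchwartzMultipliers

section Cutoffs

open Set Metric Module Filter Topology

variable {E : Type*} [NormedAddCommGroup E] [InnerProductSpace ℝ E] [FiniteDimensional ℝ E]
  [MeasurableSpace E] [BorelSpace E]

/-- A smooth cutoff equal to `1` on the unit ball and supported in the ball of radius `2`. -/
noncomputable def phi (ξ : E) : ℝ := (⟨1, 2, one_pos, one_lt_two⟩ : ContDiffBump (0 : E)) ξ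

/-- A smooth cutoff to the annulus `1 ≤ ‖ξ‖ ≤ 4`. -/
noncomputable def psi (ξ : E) : ℝ := phi ((2 : ℝ)⁻¹ • ξ) - phi ξ

lemma contDiff_phi : ContDiff ℝ (↑(⊤ : ℕ∞)) (phi : E → ℝ) := ContDiffBump.contDiff _

lemma contDiff_psi : ContDiff ℝ (↑(⊤ : ℕ∞)) (psi : E → ℝ) :=
  (contDiff_phi.comp (contDiff_const_smul _)).sub contDiff_phi

lemma phi_nonneg (ξ : E) : 0 ≤ phi ξ := ContDiffBump.nonneg _

lemma phi_le_one (ξ : E) : phi ξ ≤ 1 := ContDiffBump.le_one _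

lemma phi_eq_one {ξ : E} (h : ‖ξ‖ ≤ 1) : phi ξ = 1 :=
  ContDiffBump.one_of_mem_closedBall _ (by simpa using h)

lemma phi_eq_zero {ξ : E} (h : 2 ≤ ‖ξ‖) : phi ξ = 0 :=
  ContDiffBump.zero_of_le_dist _ (by simpa using h)

lemma psi_eq_zero_of_le {ξ : E} (h : ‖ξ‖ ≤ 1) : psi ξ = 0 := by
  rw [psi, phi_eq_one h, phi_eq_one, sub_self]
  rw [norm_smul, norm_inv, Real.norm_two]
  linarith [norm_nonneg ξ]

lemma psi_eq_zero_of_ge {ξ : E} (h : 4 ≤ ‖ξ‖) : psi ξ = 0 := by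
  rw [psi, phi_eq_zero, phi_eq_zero (by linarith), sub_self]
  rw [norm_smul, norm_inv, Real.norm_two]
  linarith

lemma contDiff_norm_rpow_mul_psi (s : ℝ) :
    ContDiff ℝ (↑(⊤ : ℕ∞)) fun ξ : E => ‖ξ‖ ^ s * psi ξ := by
  refine contDiff_iff_contDiffAt.2 fun ξ => ?_
  rcases eq_or_ne ξ 0 with rfl | hξ
  · refine (contDiffAt_const (c := (0 : ℝ))).congr_of_eventuallyEq ?_
    filter_upwards [closedBall_mem_nhds (0 : E) one_pos] with y hy
    rw [psi_eq_zero_of_le (by simpa using hy), mul_zero]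
  · exact ((contDiffAt_norm ℝ hξ).rpow_const_of_ne (by simpa using hξ)).mul contDiff_psi.contDiffAt

lemma hasCompactSupport_of_forall_norm {m : E → ℂ} (R : ℝ) (h : ∀ ξ, R ≤ ‖ξ‖ → m ξ = 0) :
    HasCompactSupport m :=
  HasCompactSupport.intro (isCompact_closedBall (0 : E) R) fun ξ hξ => h ξ <| by
    simpa using (not_le.1 (by simpa using hξ) : R < ‖ξ‖).le

lemma exists_lowKer : ∃ k : 𝓢(E, ℂ), ∀ ξ, 𝓕 k ξ = (phi ξ : ℂ) :=
  exists_fourier_eq (Complex.ofRealCLM.contDiff.comp contDiff_phi)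
    (hasCompactSupport_of_forall_norm 2 fun ξ h => by simp [phi_eq_zero h])

lemma exists_lowKer' : ∃ k : 𝓢(E, ℂ), ∀ ξ, 𝓕 k ξ = (phi ((2 : ℝ)⁻¹ • ξ) : ℂ) :=
  exists_fourier_eq (Complex.ofRealCLM.contDiff.comp
    (contDiff_phi.comp (contDiff_const_smul _)))
    (hasCompactSupport_of_forall_norm 4 fun ξ h => by
      simp only [Complex.ofReal_eq_zero]
      refine phi_eq_zero ?_
      rw [norm_smul, norm_inv, Real.norm_two]
      linarith)

lemma exists_bandKer (s : ℝ) : ∃ k : 𝓢(E, ℂ), ∀ ξ, 𝓕 k ξ = ((‖ξ‖ ^ s * psi ξ : ℝ) : ℂ) :=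
  exists_fourier_eq (Complex.ofRealCLM.contDiff.comp (contDiff_norm_rpow_mul_psi s))
    (hasCompactSupport_of_forall_norm 4 fun ξ h => by simp [psi_eq_zero_of_ge h])

/-- The kernel with Fourier transform `phi`. -/
noncomputable def lowKer : 𝓢(E, ℂ) := exists_lowKer.choose

/-- The kernel with Fourier transform `phi (ξ / 2)`. -/
noncomputable def lowKer' : 𝓢(E, ℂ) := exists_lowKer'.choose

/-- The kernel with Fourier transform `‖ξ‖ ^ s * psi ξ`. -/
noncomputable def bandKer (s : ℝ) : 𝓢(E, ℂ) := (exists_bandKer s).choose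

lemma fourier_lowKer (ξ : E) : 𝓕 (lowKer : 𝓢(E, ℂ)) ξ = (phi ξ : ℂ) := exists_lowKer.choose_spec ξ

lemma fourier_lowKer' (ξ : E) : 𝓕 (lowKer' : 𝓢(E, ℂ)) ξ = (phi ((2 : ℝ)⁻¹ • ξ) : ℂ) :=
  exists_lowKer'.choose_spec ξ

lemma fourier_bandKer (s : ℝ) (ξ : E) : 𝓕 (bandKer s : 𝓢(E, ℂ)) ξ = ((‖ξ‖ ^ s * psi ξ : ℝ) : ℂ) :=
  (exists_bandKer s).choose_spec ξ

lemma fourier_bandKer_zero (s : ℝ) : 𝓕 (bandKer s : 𝓢(E, ℂ)) 0 = 0 := by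
  rw [fourier_bandKer, psi_eq_zero_of_le (by simp)]
  simp

/-- The Riesz derivative of order `s`. -/
noncomputable def riesz (s : ℝ) (h : E → ℂ) : E → ℂ :=
  𝓕⁻ fun ξ : E => ((‖ξ‖ ^ s : ℝ) : ℂ) * 𝓕 h ξ

lemma fourier_comp_add (f : E → ℂ) (v ξ : E) :
    𝓕 (fun y => f (y + v)) ξ = 𝐞 ⟪v, ξ⟫ • 𝓕 f ξ :=
  congrFun (VectorFourier.fourierIntegral_comp_add_right 𝐞 volume (innerₗ E) f v) ξ

lemma conv_fourierInv (k : 𝓢(E, ℂ)) (j : ℤ) {H : E → ℂ} (hH : Integrable H) (x : E) :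
    conv k j (𝓕⁻ H) x = 𝓕⁻ (fun ξ => 𝓕 k (((2 : ℝ) ^ j)⁻¹ • ξ) * H ξ) x := by
  obtain ⟨k', hk'⟩ := exists_dilate_eq k j
  have h1 : conv k j (𝓕⁻ H) x = ∫ y, k' (y + x) * 𝓕 H y := by
    rw [conv, ← integral_neg_eq_self]
    congr 1 with y
    rw [hk', Real.fourierInv_eq_fourier_neg]
    simp [add_comm]
  have hi : Integrable fun y => k' (y + x) := k'.integrable.comp_add_right x
  have h2 := VectorFourier.integral_fourierIntegral_smul_eq_flip (L := innerₗ E)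
    Real.continuous_fourierChar continuous_inner hi hH
  have h3 : ∀ y, VectorFourier.fourierIntegral 𝐞 volume (innerₗ E).flip H y = 𝓕 H y := by
    intro y
    rw [flip_innerₗ]
    rfl
  simp_rw [h3] at h2
  rw [h1]
  simp_rw [smul_eq_mul] at h2
  rw [← h2, Real.fourierInv_eq]
  congr 1 with ξ
  change 𝓕 (fun y => k' (y + x)) ξ * H ξ = _
  rw [fourier_comp_add (⇑k') x ξ, hk', fourier_dilate, real_inner_comm, smul_mul_assoc]
  rfl

lemma integrable_one_add_norm_rpow_mul (f : 𝓢(E, ℂ)) {s : ℝ} :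
    Integrable fun ξ : E => (1 + ‖ξ‖) ^ s * ‖f ξ‖ := by
  have h := ((f.integrable_pow_mul volume 0).add (f.integrable_pow_mul volume ⌈s⌉₊)).const_mul
    (2 ^ (⌈s⌉₊ - 1))
  refine h.mono' (Continuous.aestronglyMeasurable ?_) (ae_of_all _ fun ξ => ?_)
  · exact ((continuous_const.add continuous_norm).rpow_const fun ξ =>
      Or.inl (show 1 + ‖ξ‖ ≠ 0 by positivity)).mul f.continuous.norm
  · rw [Real.norm_of_nonneg (by positivity)]
    have h1 : (1 + ‖ξ‖) ^ s ≤ (1 + ‖ξ‖) ^ ⌈s⌉₊ := by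
      rw [← Real.rpow_natCast]
      exact Real.rpow_le_rpow_of_exponent_le (by linarith [norm_nonneg ξ]) (Nat.le_ceil s)
    refine (mul_le_mul_of_nonneg_right (h1.trans (add_pow_le zero_le_one (norm_nonneg ξ) _))
      (norm_nonneg _)).trans (le_of_eq ?_)
    simp
    ring

lemma integrable_norm_rpow_mul (f : 𝓢(E, ℂ)) {s : ℝ} (hs : 0 ≤ s) :
    Integrable fun ξ : E => ((‖ξ‖ ^ s : ℝ) : ℂ) * f ξ := by
  refine (integrable_one_add_norm_rpow_mul f (s := s)).mono' (Continuous.aestronglyMeasurable ?_)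
    (ae_of_all _ fun ξ => ?_)
  · exact (Complex.continuous_ofReal.comp
      (continuous_norm.rpow_const fun ξ => Or.inr hs)).mul f.continuous
  · rw [norm_mul, Complex.norm_real, Real.norm_of_nonneg (by positivity)]
    gcongr
    linarith

lemma conv_riesz (k : 𝓢(E, ℂ)) (j : ℤ) {s : ℝ} (hs : 0 ≤ s) (f : 𝓢(E, ℂ)) (x : E) :
    conv k j (riesz s f) x =
      𝓕⁻ (fun ξ => 𝓕 k (((2 : ℝ) ^ j)⁻¹ • ξ) * (((‖ξ‖ ^ s : ℝ) : ℂ) * 𝓕 f ξ)) x :=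
  conv_fourierInv k j (integrable_norm_rpow_mul (𝓕 f) hs) x

lemma norm_inv_zpow_smul (j : ℤ) (ξ : E) : ‖((2 : ℝ) ^ j)⁻¹ • ξ‖ = ((2 : ℝ) ^ j)⁻¹ * ‖ξ‖ := by
  rw [norm_smul, norm_inv, Real.norm_of_nonneg (by positivity)]

lemma conv_bandKer_eq (j : ℤ) {s : ℝ} (hs : 0 ≤ s) (f : 𝓢(E, ℂ)) (x : E) :
    conv (bandKer 0) j f x =
      (((((2 : ℝ) ^ j) ^ s)⁻¹ : ℝ) : ℂ) * conv (bandKer (-s)) j (riesz s f) x := by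
  have h : conv (bandKer 0) j f x = 𝓕⁻ (⇑(𝓕 (convS (bandKer 0) j f) : 𝓢(E, ℂ))) x := by
    rw [← fourierInv_coe]
    simp
  rw [conv_riesz _ _ hs, h, Real.fourierInv_eq, Real.fourierInv_eq, ← integral_const_mul]
  congr 1 with ξ
  rw [fourier_convS, fourier_bandKer, fourier_bandKer, norm_inv_zpow_smul]
  rcases eq_or_ne ξ 0 with rfl | hξ
  · rw [psi_eq_zero_of_le (by simp)]
    simp
  · have hξ' : 0 < ‖ξ‖ := norm_pos_iff.2 hξ
    rw [Real.rpow_zero, Real.mul_rpow (by positivity) hξ'.le, Real.inv_rpow (by positivity),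
      Real.rpow_neg (by positivity), Real.rpow_neg hξ'.le]
    have h1 : ((‖ξ‖ ^ s : ℝ) : ℂ) ≠ 0 := Complex.ofReal_ne_zero.2 (by positivity)
    have h2 : ((((2 : ℝ) ^ j) ^ s : ℝ) : ℂ) ≠ 0 := Complex.ofReal_ne_zero.2 (by positivity)
    simp only [Circle.smul_def, smul_eq_mul]
    push_cast
    field_simp

end Cutoffs

section SchurTest

open Set Metric Module Filter Topology

/-- Schur's test for a convolution-type matrix over `ℤ`. -/
lemma sum_sum_mul_le (J K : Finset ℤ) (c a b : ℤ → ℝ≥0∞) :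
    ∑ j ∈ J, ∑ k ∈ K, c (k - j) * (a j * b k) ≤ (∑' m, c m) *
      ((∑ j ∈ J, a j ^ (2 : ℝ)) ^ (1 / 2 : ℝ) * (∑ k ∈ K, b k ^ (2 : ℝ)) ^ (1 / 2 : ℝ)) := by
  have hc : ∀ x : ℝ≥0∞, x ^ (1 / 2 : ℝ) * x ^ (1 / 2 : ℝ) = x := fun x => by
    rw [← ENNReal.rpow_add_of_nonneg _ _ (by positivity) (by positivity)]
    norm_num
  have hc2 : ∀ x : ℝ≥0∞, (x ^ (1 / 2 : ℝ)) ^ (2 : ℝ) = x := fun x => by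
    rw [← ENNReal.rpow_mul]
    norm_num
  have h1 : ∑ z ∈ J ×ˢ K, (c (z.2 - z.1) ^ (1 / 2 : ℝ) * a z.1) ^ (2 : ℝ) ≤
      (∑' m, c m) * ∑ j ∈ J, a j ^ (2 : ℝ) := by
    rw [Finset.sum_product, Finset.mul_sum]
    refine Finset.sum_le_sum fun j _ => ?_
    simp_rw [ENNReal.mul_rpow_of_nonneg _ _ zero_le_two, hc2]
    rw [← Finset.sum_mul]
    refine mul_le_mul_left ((ENNReal.sum_le_tsum K).trans (le_of_eq ?_)) _
    exact (Equiv.subRight j).tsum_eq c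
  have h2 : ∑ z ∈ J ×ˢ K, (c (z.2 - z.1) ^ (1 / 2 : ℝ) * b z.2) ^ (2 : ℝ) ≤
      (∑' m, c m) * ∑ k ∈ K, b k ^ (2 : ℝ) := by
    rw [Finset.sum_product_right, Finset.mul_sum]
    refine Finset.sum_le_sum fun k _ => ?_
    simp_rw [ENNReal.mul_rpow_of_nonneg _ _ zero_le_two, hc2]
    rw [← Finset.sum_mul]
    refine mul_le_mul_left ((ENNReal.sum_le_tsum J).trans (le_of_eq ?_)) _
    exact (Equiv.subLeft k).tsum_eq c
  calc ∑ j ∈ J, ∑ k ∈ K, c (k - j) * (a j * b k)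
      = ∑ z ∈ J ×ˢ K, (c (z.2 - z.1) ^ (1 / 2 : ℝ) * a z.1) *
          (c (z.2 - z.1) ^ (1 / 2 : ℝ) * b z.2) := by
        rw [Finset.sum_product]
        refine Finset.sum_congr rfl fun j _ => Finset.sum_congr rfl fun k _ => ?_
        rw [mul_mul_mul_comm, hc]
    _ ≤ _ := ENNReal.inner_le_Lp_mul_Lq _ _ _ Real.HolderConjugate.two_two
    _ ≤ ((∑' m, c m) * ∑ j ∈ J, a j ^ (2 : ℝ)) ^ (1 / 2 : ℝ) *
        ((∑' m, c m) * ∑ k ∈ K, b k ^ (2 : ℝ)) ^ (1 / 2 : ℝ) :=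
        mul_le_mul' (ENNReal.rpow_le_rpow h1 (by positivity))
          (ENNReal.rpow_le_rpow h2 (by positivity))
    _ = _ := by
        rw [ENNReal.mul_rpow_of_nonneg _ _ (by positivity),
          ENNReal.mul_rpow_of_nonneg _ _ (by positivity), mul_mul_mul_comm, hc]

/-- The weights coupling the output frequency `2 ^ (j + m)` to the input frequency `2 ^ j`. -/
noncomputable def weight (s : ℝ) (m : ℤ) : ℝ≥0∞ :=
  if m ≤ 2 then ENNReal.ofReal (((2 : ℝ) ^ m) ^ s) else 0

lemma tsum_weight_ne_top {s : ℝ} (hs : 0 < s) : ∑' m, weight s m ≠ ⊤ := by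
  have hi : Function.Injective fun n : ℕ => (2 : ℤ) - n := fun a b h => by simpa using h
  have hsupp : Function.support (weight s) ⊆ range fun n : ℕ => (2 : ℤ) - n := fun m hm => by
    have hm2 : m ≤ 2 := by
      by_contra h
      exact hm (if_neg h)
    exact ⟨(2 - m).toNat, by simp only; omega⟩
  rw [← hi.tsum_eq hsupp]
  have h : ∀ n : ℕ, weight s (2 - n) =
      ENNReal.ofReal (((2 : ℝ) ^ (2 : ℤ)) ^ s) * ENNReal.ofReal ((2 : ℝ) ^ (-s)) ^ n := fun n => by
    rw [weight, if_pos (by omega), ← ENNReal.ofReal_pow (by positivity),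
      ← ENNReal.ofReal_mul (by positivity)]
    congr 1
    rw [zpow_sub₀ two_ne_zero, div_eq_mul_inv, Real.mul_rpow (by positivity) (by positivity),
      zpow_natCast, Real.inv_rpow (by positivity), ← Real.rpow_natCast, ← Real.rpow_natCast,
      ← Real.rpow_mul zero_le_two, ← Real.rpow_mul zero_le_two, ← Real.rpow_neg zero_le_two]
    ring_nf
  simp_rw [h]
  rw [ENNReal.tsum_mul_left, ENNReal.tsum_geometric]
  refine ENNReal.mul_ne_top ENNReal.ofReal_ne_top (ENNReal.inv_ne_top.2 ?_)
  refine (tsub_pos_iff_lt.2 ?_).ne'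
  rw [ENNReal.ofReal_lt_one]
  exact Real.rpow_lt_one_of_one_lt_of_neg one_lt_two (by linarith)

lemma lpn_mul_le {α : Type*} [MeasureSpace α] {p q r : ℝ} (hp : 0 < p) (hr : 0 < r)
    (h : 1 / p = 1 / q + 1 / r) (hq : 0 < q) {u v : α → ℝ≥0∞} (hu : Measurable u)
    (hv : Measurable v) : lpn p (fun x => u x * v x) ≤ lpn q u * lpn r v := by
  refine ENNReal.lintegral_Lp_mul_le_Lq_mul_Lr hp ?_ h volume hu.aemeasurable hv.aemeasurable
  have : 1 / q < 1 / p := by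
    rw [h]
    linarith [one_div_pos.2 hr]
  exact lt_of_one_div_lt_one_div hq this

end SchurTest

section Paraproduct

open Set Metric Module Filter Topology

variable {E : Type*} [NormedAddCommGroup E] [InnerProductSpace ℝ E] [FiniteDimensional ℝ E]
  [MeasurableSpace E] [BorelSpace E] {p q p₁ q₁ s : ℝ}

/-- The part of `Λ^s` at output frequency `2 ^ k` of the product of the part of `f` at frequency
`2 ^ j` with a part of `g` at frequencies at most `2 ^ j`. -/
noncomputable def block (s : ℝ) (k₀ : 𝓢(E, ℂ)) (j k : ℤ) (f g : 𝓢(E, ℂ)) : 𝓢(E, ℂ) :=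
  ((((2 : ℝ) ^ k) ^ s : ℝ) : ℂ) •
    convS (bandKer s) k (mulS (convS (bandKer 0) j f) (convS k₀ j g))

lemma block_eq_zero {k₀ : 𝓢(E, ℂ)} (h₀ : ∀ ξ, 4 ≤ ‖ξ‖ → 𝓕 k₀ ξ = 0) {j k : ℤ} (hjk : j + 3 ≤ k)
    (f g : 𝓢(E, ℂ)) : block s k₀ j k f g = 0 := by
  rw [block, ext_fourier (f := convS _ _ _) (g := 0) fun ζ => ?_, smul_zero]
  rw [FourierTransform.fourier_zero, fourier_convS, zero_apply]
  rcases le_or_gt ‖((2 : ℝ) ^ k)⁻¹ • ζ‖ 1 with h | h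
  · rw [fourier_bandKer, psi_eq_zero_of_le h]
    simp
  rw [fourier_mulS, integral_eq_zero_of_ae, mul_zero]
  refine ae_of_all _ fun η => ?_
  simp only [fourier_convS, Pi.zero_apply]
  rcases le_or_gt 4 ‖((2 : ℝ) ^ j)⁻¹ • η‖ with h1 | h1
  · rw [fourier_bandKer, psi_eq_zero_of_ge h1]
    simp
  rcases le_or_gt 4 ‖((2 : ℝ) ^ j)⁻¹ • (ζ - η)‖ with h2 | h2
  · rw [h₀ _ h2]
    simp
  exfalso
  have hj : (0 : ℝ) < 2 ^ j := by positivity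
  have hk : (0 : ℝ) < 2 ^ k := by positivity
  rw [norm_inv_zpow_smul, inv_mul_lt_iff₀ hj] at h1 h2
  rw [norm_inv_zpow_smul, lt_inv_mul_iff₀ hk] at h
  have h3 : (2 : ℝ) ^ (j + 3) ≤ 2 ^ k := zpow_le_zpow_right₀ one_le_two hjk
  rw [zpow_add₀ two_ne_zero] at h3
  norm_num at h3
  have h4 : ‖ζ‖ ≤ ‖η‖ + ‖ζ - η‖ := by simpa using norm_add_le η (ζ - η)
  linarith

lemma continuous_riesz (hs : 0 ≤ s) (f : 𝓢(E, ℂ)) : Continuous (riesz s f) := by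
  have h : Continuous (𝓕 fun ξ : E => ((‖ξ‖ ^ s : ℝ) : ℂ) * 𝓕 f ξ) :=
    VectorFourier.fourierIntegral_continuous Real.continuous_fourierChar (L := innerₗ E)
      continuous_inner (integrable_norm_rpow_mul (𝓕 f) hs)
  have h' : riesz s f = fun x => 𝓕 (fun ξ : E => ((‖ξ‖ ^ s : ℝ) : ℂ) * 𝓕 f ξ) (-x) := by
    ext x
    exact Real.fourierInv_eq_fourier_neg _ x
  rw [h']
  exact h.comp continuous_neg

lemma lpn_schwartz_ne_top (hp : 0 < p) (f : 𝓢(E, ℂ)) : lpn p (fun x => ‖f x‖ₑ) ≠ ⊤ := by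
  rw [lpn_eq_eLpNorm hp]
  exact (f.memLp _ volume).2.ne

lemma enorm_integral_mul_block_le [Nontrivial E] (hs : 0 ≤ s) (hpq : p.HolderConjugate q)
    {k₀ : 𝓢(E, ℂ)} (h₀ : ∀ ξ, 4 ≤ ‖ξ‖ → 𝓕 k₀ ξ = 0) {A : ℝ≥0∞}
    (hA : ∀ (j : ℤ) (f : E → ℂ), Measurable f → ∀ x,
      ‖conv k₀ j f x‖ₑ ≤ A * maximal (fun y => ‖f y‖ₑ) x) (f g : 𝓢(E, ℂ)) {v : E → ℂ}
    (hv : StronglyMeasurable v) (hvq : lpn q (fun x => ‖v x‖ₑ) ≠ ⊤) (j k : ℤ) :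
    ‖∫ x, block s k₀ j k f g x * v x‖ₑ ≤
      ∫⁻ x, weight s (k - j) * (‖conv (bandKer (-s)) j (riesz s f) x‖ₑ *
        ‖conv (reflect (bandKer s)) k v x‖ₑ) * (A * maximal (fun y => ‖g y‖ₑ) x) := by
  rcases le_or_gt (j + 3) k with hjk | hjk
  · simp [block_eq_zero h₀ hjk]
  have h1 : ∫ x, block s k₀ j k f g x * v x = ((((2 : ℝ) ^ k) ^ s : ℝ) : ℂ) *
      ∫ x, conv (bandKer 0) j f x * conv k₀ j g x * conv (reflect (bandKer s)) k v x := by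
    have := integral_conv_mul (bandKer s) k hpq
      (mulS (convS (bandKer 0) j f) (convS k₀ j g)).continuous.stronglyMeasurable hv
      (lpn_schwartz_ne_top hpq.pos _) hvq
    simp only [mulS_apply, coe_convS] at this
    rw [← this, ← integral_const_mul]
    simp only [block, smul_apply, coe_convS, smul_eq_mul, mul_assoc]
  rw [h1, enorm_mul]
  refine (mul_le_mul_right (enorm_integral_le_lintegral_enorm _) _).trans ?_
  rw [← lintegral_const_mul' _ _ enorm_ne_top]
  refine lintegral_mono fun x => ?_
  rw [conv_bandKer_eq j hs, enorm_mul, enorm_mul, enorm_mul]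
  have hw : ‖((((2 : ℝ) ^ k) ^ s : ℝ) : ℂ)‖ₑ * ‖(((((2 : ℝ) ^ j) ^ s)⁻¹ : ℝ) : ℂ)‖ₑ =
      weight s (k - j) := by
    rw [weight, if_pos (by omega), ← enorm_mul, ← Complex.ofReal_mul, ← ofReal_norm,
      Complex.norm_real, Real.norm_of_nonneg (by positivity), zpow_sub₀ two_ne_zero,
      Real.div_rpow (by positivity) (by positivity), div_eq_mul_inv]
  rw [← hw]
  refine le_trans (le_of_eq ?_) (mul_le_mul_right (hA j g g.continuous.measurable x) _)
  ring

/-- The paraproduct estimate. -/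
theorem exists_lpn_sum_block_le [Nontrivial E] (hs : 0 < s) (hp : 1 < p) (hp₁ : 1 < p₁)
    (hq₁ : 1 < q₁) (h : 1 / p = 1 / p₁ + 1 / q₁) {k₀ : 𝓢(E, ℂ)}
    (h₀ : ∀ ξ, 4 ≤ ‖ξ‖ → 𝓕 k₀ ξ = 0) :
    ∃ C : ℝ≥0∞, C ≠ ⊤ ∧ ∀ (J K : Finset ℤ) (f g : 𝓢(E, ℂ)),
      lpn p (fun x => ‖(∑ j ∈ J, ∑ k ∈ K, block s k₀ j k f g) x‖ₑ) ≤
        C * ((lpn p₁ fun x => ‖riesz s f x‖ₑ) * lpn q₁ fun x => ‖g x‖ₑ) := by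
  have hpq := Real.HolderConjugate.conjExponent hp
  set q := p.conjExponent
  obtain ⟨A, hA, hAk⟩ := exists_enorm_conv_le_maximal k₀
  obtain ⟨C₁, hC₁, hS₁⟩ := exists_lpn_sq_le (bandKer (-s) : 𝓢(E, ℂ)) (fourier_bandKer_zero _) hp₁
  obtain ⟨C₂, hC₂, hS₂⟩ := exists_lpn_sq_le (reflect (bandKer s) : 𝓢(E, ℂ))
    (by rw [fourier_reflect_zero, fourier_bandKer_zero]) hpq.symm.lt
  obtain ⟨C₃, hC₃, hM⟩ := exists_lpn_maximal_le (E := E) hq₁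
  have hW := tsum_weight_ne_top hs
  set W := ∑' m, weight s m
  refine ⟨W * A * C₁ * C₂ * C₃, by finiteness, fun J K f g => ?_⟩
  set u := ∑ j ∈ J, ∑ k ∈ K, block s k₀ j k f g with hu
  refine lpn_le_of_forall_inner hpq u.continuous.stronglyMeasurable
    (lpn_schwartz_ne_top hpq.pos u) fun w hw hwq => ?_
  set v : E → ℂ := fun x => (starRingEnd ℂ) (w x) with hv
  have hvn : ∀ x, ‖v x‖ₑ = ‖w x‖ₑ := fun x => by simp [hv]
  have hvm : StronglyMeasurable v := Complex.continuous_conj.comp_stronglyMeasurable hw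
  have hvq : lpn q (fun x => ‖v x‖ₑ) ≠ ⊤ := by simpa only [hvn] using hwq
  have hR := (continuous_riesz hs.le f).stronglyMeasurable
  have hinn : ∀ j k, Integrable fun x => block s k₀ j k f g x * v x := fun j k => by
    have := hpq.ennrealOfReal
    exact ((block s k₀ j k f g).memLp (ENNReal.ofReal p) volume).integrable_mul
      (memLp_of_lpn_ne_top hpq.symm.pos hvm hvq)
  have h1 : ∫ x, inner ℂ (w x) (u x) = ∑ j ∈ J, ∑ k ∈ K, ∫ x, block s k₀ j k f g x * v x := by
    simp_rw [← integral_finsetSum K fun k _ => hinn _ k]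
    rw [← integral_finsetSum J fun j _ => integrable_finsetSum K fun k _ => hinn j k]
    congr 1 with x
    rw [RCLike.inner_apply', mul_comm, hu]
    simp only [sum_apply, Finset.sum_mul]
    rfl
  have hmeas : ∀ j k, Measurable fun x => weight s (k - j) *
      (‖conv (bandKer (-s)) j (riesz s f) x‖ₑ * ‖conv (reflect (bandKer s)) k v x‖ₑ) *
        (A * maximal (fun y => ‖g y‖ₑ) x) := fun j k =>
    (((stronglyMeasurable_conv (bandKer (-s)).continuous j hR).enorm.mul
      (stronglyMeasurable_conv (reflect (bandKer s)).continuous k hvm).enorm).const_mul _).mul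
      ((measurable_maximal _).const_mul _)
  have hsq₁ := measurable_sq (bandKer (-s) : 𝓢(E, ℂ)).continuous J hR
  have hsq₂ := measurable_sq (reflect (bandKer s) : 𝓢(E, ℂ)).continuous K hvm
  have hmax := measurable_maximal fun y => ‖g y‖ₑ
  rw [h1]
  calc ‖∑ j ∈ J, ∑ k ∈ K, ∫ x, block s k₀ j k f g x * v x‖ₑ
      ≤ ∑ j ∈ J, ∑ k ∈ K, ∫⁻ x, weight s (k - j) *
        (‖conv (bandKer (-s)) j (riesz s f) x‖ₑ * ‖conv (reflect (bandKer s)) k v x‖ₑ) *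
          (A * maximal (fun y => ‖g y‖ₑ) x) :=
        (enorm_sum_le _ _).trans <| Finset.sum_le_sum fun j _ =>
          (enorm_sum_le _ _).trans <| Finset.sum_le_sum fun k _ =>
            enorm_integral_mul_block_le hs.le hpq h₀ hAk f g hvm hvq j k
    _ = ∫⁻ x, (∑ j ∈ J, ∑ k ∈ K, weight s (k - j) *
        (‖conv (bandKer (-s)) j (riesz s f) x‖ₑ * ‖conv (reflect (bandKer s)) k v x‖ₑ)) *
          (A * maximal (fun y => ‖g y‖ₑ) x) := by
        simp_rw [← lintegral_finsetSum K fun k _ => hmeas _ k]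
        rw [← lintegral_finsetSum J fun j _ => Finset.measurable_fun_sum K fun k _ => hmeas j k]
        simp_rw [Finset.sum_mul]
    _ ≤ ∫⁻ x, (W * A) * ((sq (bandKer (-s)) J (riesz s f) x * maximal (fun y => ‖g y‖ₑ) x) *
          sq (reflect (bandKer s)) K v x) := by
        refine lintegral_mono fun x => ?_
        refine (mul_le_mul_left (sum_sum_mul_le J K (weight s) _ _) _).trans (le_of_eq ?_)
        simp only [sq]
        ring
    _ = (W * A) * ∫⁻ x, (sq (bandKer (-s)) J (riesz s f) x * maximal (fun y => ‖g y‖ₑ) x) *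
          sq (reflect (bandKer s)) K v x := lintegral_const_mul' _ _ (by finiteness)
    _ ≤ (W * A) * ((C₁ * lpn p₁ fun x => ‖riesz s f x‖ₑ) * (C₃ * lpn q₁ fun x => ‖g x‖ₑ) *
          (C₂ * lpn q fun x => ‖v x‖ₑ)) := by
        refine mul_le_mul_right ((lintegral_mul_le_lpn hpq (hsq₁.mul hmax) hsq₂).trans ?_) _
        refine mul_le_mul' ((lpn_mul_le (by linarith) (by linarith) h (by linarith) hsq₁
          hmax).trans ?_) (hS₂ K v hvm)
        exact mul_le_mul' (hS₁ J _ hR) (hM g g.continuous.measurable)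
    _ = _ := by
        simp_rw [hvn]
        ring

end Paraproduct

section Approximation

open Set Metric Module Filter Topology

lemma sum_Ico_int_sub {G : Type*} [AddCommGroup G] (F : ℤ → G) (N : ℕ) :
    ∑ j ∈ Finset.Ico (-(N : ℤ)) N, (F (j + 1) - F j) = F N - F (-N) := by
  have h : ∀ a b : ℤ, a ≤ b → ∑ j ∈ Finset.Ico a b, (F (j + 1) - F j) = F b - F a := by
    intro a b hab
    induction b, hab using Int.leInduction with
    | base => simp
    | succ b hab ih =>
      have : Finset.Ico a (b + 1) = insert b (Finset.Ico a b) := by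
        ext x
        simp only [Finset.mem_Ico, Finset.mem_insert]
        omega
      rw [this, Finset.sum_insert (by simp), ih]
      abel
  exact h _ _ (by omega)

variable {E : Type*} [NormedAddCommGroup E] [InnerProductSpace ℝ E] [FiniteDimensional ℝ E]
  [MeasurableSpace E] [BorelSpace E] {s : ℝ}

lemma psi_inv_zpow_smul (k : ℤ) (ξ : E) : psi (((2 : ℝ) ^ k)⁻¹ • ξ) =
    phi (((2 : ℝ) ^ (k + 1))⁻¹ • ξ) - phi (((2 : ℝ) ^ k)⁻¹ • ξ) := by
  rw [psi, smul_smul, zpow_add_one₀ two_ne_zero, mul_inv, mul_comm]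

lemma convS_lowKer_add_one (j : ℤ) (f : 𝓢(E, ℂ)) :
    convS lowKer (j + 1) f = convS lowKer' j f :=
  ext_fourier fun ξ => by
    rw [fourier_convS, fourier_convS, fourier_lowKer, fourier_lowKer', smul_smul,
      zpow_add_one₀ two_ne_zero, mul_inv, mul_comm (2 : ℝ)⁻¹]

lemma convS_bandKer (j : ℤ) (f : 𝓢(E, ℂ)) :
    convS (bandKer 0) j f = convS lowKer (j + 1) f - convS lowKer j f :=
  ext_fourier fun ξ => by
    have : 𝓕 (convS lowKer (j + 1) f - convS lowKer j f) ξ =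
        𝓕 (convS lowKer (j + 1) f) ξ - 𝓕 (convS lowKer j f) ξ :=
      congrArg (fun u : 𝓢(E, ℂ) => u ξ) (map_sub (fourierTransformCLM ℂ) _ _)
    rw [this, fourier_convS, fourier_convS, fourier_convS, fourier_lowKer, fourier_lowKer,
      fourier_bandKer, psi_inv_zpow_smul, Real.rpow_zero]
    push_cast
    ring

/-- The product of the parts of `f` and `g` at frequencies at most `2 ^ j`. -/
noncomputable def lowMul (f g : 𝓢(E, ℂ)) (j : ℤ) : 𝓢(E, ℂ) :=
  mulS (convS lowKer j f) (convS lowKer j g)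

lemma lowMul_sub (f g : 𝓢(E, ℂ)) (j : ℤ) : lowMul f g (j + 1) - lowMul f g j =
    mulS (convS (bandKer 0) j f) (convS lowKer' j g) +
      mulS (convS (bandKer 0) j g) (convS lowKer j f) := by
  ext x
  simp only [lowMul, convS_bandKer, ← convS_lowKer_add_one, sub_apply,
    add_apply, mulS_apply]
  ring

lemma fourier_block (k₀ : 𝓢(E, ℂ)) (j k : ℤ) (f g : 𝓢(E, ℂ)) (ζ : E) :
    𝓕 (block s k₀ j k f g) ζ = ((‖ζ‖ ^ s * psi (((2 : ℝ) ^ k)⁻¹ • ζ) : ℝ) : ℂ) *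
      𝓕 (mulS (convS (bandKer 0) j f) (convS k₀ j g)) ζ := by
  have : 𝓕 (block s k₀ j k f g) ζ = ((((2 : ℝ) ^ k) ^ s : ℝ) : ℂ) *
      𝓕 (convS (bandKer s) k (mulS (convS (bandKer 0) j f) (convS k₀ j g))) ζ :=
    congrArg (fun u : 𝓢(E, ℂ) => u ζ) (map_smul (fourierTransformCLM ℂ) _ _)
  rw [this, fourier_convS, fourier_bandKer, ← mul_assoc, ← Complex.ofReal_mul, ← mul_assoc,
    norm_inv_zpow_smul, ← Real.mul_rpow (by positivity) (by positivity),
    mul_inv_cancel_left₀ (by positivity)]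

/-- A frequency-truncated version of `Λ^s (f * g)`. -/
noncomputable def approx (s : ℝ) (f g : 𝓢(E, ℂ)) (N : ℕ) : 𝓢(E, ℂ) :=
  (∑ j ∈ Finset.Ico (-(N : ℤ)) N, ∑ k ∈ Finset.Ico (-(N : ℤ)) N, block s lowKer' j k f g) +
    ∑ j ∈ Finset.Ico (-(N : ℤ)) N, ∑ k ∈ Finset.Ico (-(N : ℤ)) N, block s lowKer j k g f

lemma fourier_approx (f g : 𝓢(E, ℂ)) (N : ℕ) (ζ : E) :
    𝓕 (approx s f g N) ζ = ((‖ζ‖ ^ s : ℝ) : ℂ) *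
      ((phi (((2 : ℝ) ^ (N : ℤ))⁻¹ • ζ) - phi (((2 : ℝ) ^ (-(N : ℤ)))⁻¹ • ζ) : ℝ) : ℂ) *
        (𝓕 (lowMul f g N) ζ - 𝓕 (lowMul f g (-N)) ζ) := by
  set T : 𝓢(E, ℂ) →+ ℂ :=
    { toFun := fun u => (𝓕 u : 𝓢(E, ℂ)) ζ
      map_zero' := by
        exact congrArg (fun u : 𝓢(E, ℂ) => u ζ) (map_zero (fourierTransformCLM ℂ))
      map_add' := fun u v =>
        congrArg (fun u : 𝓢(E, ℂ) => u ζ) (map_add (fourierTransformCLM ℂ) u v) } with hT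
  have hT' : ∀ u : 𝓢(E, ℂ), (𝓕 u : 𝓢(E, ℂ)) ζ = T u := fun u => rfl
  have hsum : ∀ (h₁ h₂ k₀ : 𝓢(E, ℂ)),
      T (∑ j ∈ Finset.Ico (-(N : ℤ)) N, ∑ k ∈ Finset.Ico (-(N : ℤ)) N, block s k₀ j k h₁ h₂) =
      (∑ j ∈ Finset.Ico (-(N : ℤ)) N, T (mulS (convS (bandKer 0) j h₁) (convS k₀ j h₂))) *
        ∑ k ∈ Finset.Ico (-(N : ℤ)) N,
          ((‖ζ‖ ^ s * psi (((2 : ℝ) ^ k)⁻¹ • ζ) : ℝ) : ℂ) := fun h₁ h₂ k₀ => by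
    rw [Finset.sum_mul_sum]
    simp only [map_sum]
    refine Finset.sum_congr rfl fun j _ => Finset.sum_congr rfl fun k _ => ?_
    rw [← hT', fourier_block, hT', mul_comm]
  have hlow : T (lowMul f g N) - T (lowMul f g (-N)) =
      (∑ j ∈ Finset.Ico (-(N : ℤ)) N, T (mulS (convS (bandKer 0) j f) (convS lowKer' j g))) +
        ∑ j ∈ Finset.Ico (-(N : ℤ)) N, T (mulS (convS (bandKer 0) j g) (convS lowKer j f)) := by
    rw [← map_sub, ← sum_Ico_int_sub, map_sum, ← Finset.sum_add_distrib]
    exact Finset.sum_congr rfl fun j _ => by rw [lowMul_sub, map_add]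
  have hpsi : ∑ k ∈ Finset.Ico (-(N : ℤ)) N, ((‖ζ‖ ^ s * psi (((2 : ℝ) ^ k)⁻¹ • ζ) : ℝ) : ℂ) =
      ((‖ζ‖ ^ s : ℝ) : ℂ) *
      ((phi (((2 : ℝ) ^ (N : ℤ))⁻¹ • ζ) - phi (((2 : ℝ) ^ (-(N : ℤ)))⁻¹ • ζ) : ℝ) : ℂ) := by
    rw [← sum_Ico_int_sub fun k => phi (((2 : ℝ) ^ k)⁻¹ • ζ), ← Complex.ofReal_mul,
      Finset.mul_sum, Complex.ofReal_sum]
    simp_rw [psi_inv_zpow_smul]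
  simp only [hT', approx]
  rw [map_add, hsum, hsum, ← add_mul, ← hlow, hpsi, mul_comm]

lemma fourier_lowMul (f g : 𝓢(E, ℂ)) (j : ℤ) (ζ : E) :
    𝓕 (lowMul f g j) ζ = ∫ η, ((phi (((2 : ℝ) ^ j)⁻¹ • η) * phi (((2 : ℝ) ^ j)⁻¹ • (ζ - η)) : ℝ)
      : ℂ) * (𝓕 f η * 𝓕 g (ζ - η)) := by
  rw [lowMul, fourier_mulS]
  congr 1 with η
  rw [fourier_convS, fourier_convS, fourier_lowKer, fourier_lowKer]
  push_cast
  ring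

lemma norm_phi_mul_le (a b : E) (z : ℂ) : ‖((phi a * phi b : ℝ) : ℂ) * z‖ ≤ ‖z‖ := by
  rw [norm_mul, Complex.norm_real, Real.norm_of_nonneg (mul_nonneg (phi_nonneg _) (phi_nonneg _))]
  exact mul_le_of_le_one_left (norm_nonneg _)
    (mul_le_one₀ (phi_le_one _) (phi_nonneg _) (phi_le_one _))

lemma integrable_mul_sub (f g : 𝓢(E, ℂ)) (ζ : E) : Integrable fun η => f η * g (ζ - η) :=
  (f.memLp 2 volume).integrable_mul ((g.memLp 2 volume).comp_measurePreserving
    (Measure.measurePreserving_sub_left volume ζ))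

lemma norm_fourier_lowMul_le (f g : 𝓢(E, ℂ)) (j : ℤ) (ζ : E) :
    ‖𝓕 (lowMul f g j) ζ‖ ≤ ∫ η, ‖𝓕 f η * 𝓕 g (ζ - η)‖ := by
  rw [fourier_lowMul]
  exact norm_integral_le_of_norm_le (integrable_mul_sub (𝓕 f) (𝓕 g) ζ).norm
    (ae_of_all _ fun η => norm_phi_mul_le _ _ _)

lemma tendsto_phi_nat (ξ : E) :
    Tendsto (fun N : ℕ => phi (((2 : ℝ) ^ (N : ℤ))⁻¹ • ξ)) atTop (𝓝 1) := by
  have h : Tendsto (fun N : ℕ => (((2 : ℝ) ^ (N : ℤ))⁻¹ • ξ)) atTop (𝓝 ((0 : ℝ) • ξ)) := by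
    refine Tendsto.smul_const ?_ ξ
    simp only [zpow_natCast]
    exact tendsto_inv_atTop_zero.comp (tendsto_pow_atTop_atTop_of_one_lt one_lt_two)
  have := (contDiff_phi.continuous.tendsto ((0 : ℝ) • ξ)).comp h
  rwa [phi_eq_one (by simp)] at this

lemma tendsto_phi_neg_nat {ξ : E} (hξ : ξ ≠ 0) :
    Tendsto (fun N : ℕ => phi (((2 : ℝ) ^ (-(N : ℤ)))⁻¹ • ξ)) atTop (𝓝 0) := by
  have h : Tendsto (fun N : ℕ => (2 : ℝ) ^ N * ‖ξ‖) atTop atTop :=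
    (tendsto_pow_atTop_atTop_of_one_lt one_lt_two).atTop_mul_const (norm_pos_iff.2 hξ)
  refine tendsto_const_nhds.congr' ?_
  filter_upwards [h.eventually_ge_atTop 2] with N hN
  rw [phi_eq_zero]
  rw [norm_inv_zpow_smul, zpow_neg, inv_inv]
  exact_mod_cast hN

lemma tendsto_fourier_lowMul_of {f g : 𝓢(E, ℂ)} {a : ℕ → ℤ} {c : ℝ} {ζ : E}
    (h : ∀ᵐ η : E, Tendsto (fun N => phi (((2 : ℝ) ^ a N)⁻¹ • η) *
      phi (((2 : ℝ) ^ a N)⁻¹ • (ζ - η))) atTop (𝓝 c)) :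
    Tendsto (fun N => 𝓕 (lowMul f g (a N)) ζ) atTop (𝓝 (c * 𝓕 (mulS f g) ζ)) := by
  simp_rw [fourier_lowMul, fourier_mulS]
  rw [← integral_const_mul]
  refine tendsto_integral_of_dominated_convergence (fun η => ‖𝓕 f η * 𝓕 g (ζ - η)‖)
    (fun N => Continuous.aestronglyMeasurable ?_) (integrable_mul_sub (𝓕 f) (𝓕 g) ζ).norm
    (fun N => ae_of_all _ fun η => norm_phi_mul_le _ _ _) ?_
  · have h1 := (contDiff_phi (E := E)).continuous
    have h2 := (𝓕 f).continuous
    have h3 := (𝓕 g).continuous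
    fun_prop
  · filter_upwards [h] with η hη
    exact ((Complex.continuous_ofReal.tendsto _).comp hη).mul_const _

lemma ae_ne [Nontrivial E] (ζ : E) : ∀ᵐ η : E, η ≠ ζ := by
  simp [ae_iff]

lemma tendsto_fourier_approx [Nontrivial E] (f g : 𝓢(E, ℂ)) {ζ : E} (hζ : ζ ≠ 0) :
    Tendsto (fun N => 𝓕 (approx s f g N) ζ) atTop
      (𝓝 (((‖ζ‖ ^ s : ℝ) : ℂ) * 𝓕 (mulS f g) ζ)) := by
  simp_rw [fourier_approx]
  have h1 : Tendsto (fun N : ℕ => 𝓕 (lowMul f g N) ζ) atTop (𝓝 ((1 : ℝ) * 𝓕 (mulS f g) ζ)) :=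
    tendsto_fourier_lowMul_of <| ae_of_all _ fun η => by
      simpa using (tendsto_phi_nat η).mul (tendsto_phi_nat (ζ - η))
  have h2 : Tendsto (fun N : ℕ => 𝓕 (lowMul f g (-N)) ζ) atTop
      (𝓝 ((0 : ℝ) * 𝓕 (mulS f g) ζ)) :=
    tendsto_fourier_lowMul_of <| by
      filter_upwards [ae_ne (0 : E), ae_ne ζ] with η h0 hne
      simpa using (tendsto_phi_neg_nat h0).mul (tendsto_phi_neg_nat (sub_ne_zero.2 hne.symm))
  have h3 := ((Complex.continuous_ofReal.tendsto _).comp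
    ((tendsto_phi_nat ζ).sub (tendsto_phi_neg_nat hζ))).const_mul ((‖ζ‖ ^ s : ℝ) : ℂ)
  simpa using h3.mul (h1.sub h2)

lemma norm_fourier_approx_le (f g : 𝓢(E, ℂ)) (N : ℕ) (ζ : E) :
    ‖𝓕 (approx s f g N) ζ‖ ≤ 2 * (‖ζ‖ ^ s * ∫ η, ‖𝓕 f η * 𝓕 g (ζ - η)‖) := by
  rw [fourier_approx, norm_mul, norm_mul, Complex.norm_real, Complex.norm_real,
    Real.norm_of_nonneg (by positivity)]
  have h1 : ‖phi (((2 : ℝ) ^ (N : ℤ))⁻¹ • ζ) - phi (((2 : ℝ) ^ (-(N : ℤ)))⁻¹ • ζ)‖ ≤ 1 := by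
    rw [Real.norm_eq_abs, abs_le]
    constructor <;> linarith [phi_nonneg (((2 : ℝ) ^ (N : ℤ))⁻¹ • ζ),
      phi_le_one (((2 : ℝ) ^ (N : ℤ))⁻¹ • ζ), phi_nonneg (((2 : ℝ) ^ (-(N : ℤ)))⁻¹ • ζ),
      phi_le_one (((2 : ℝ) ^ (-(N : ℤ)))⁻¹ • ζ)]
  have h2 := (norm_sub_le (𝓕 (lowMul f g N) ζ) (𝓕 (lowMul f g (-N)) ζ)).trans
    (add_le_add (norm_fourier_lowMul_le f g N ζ) (norm_fourier_lowMul_le f g (-N) ζ))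
  calc _ ≤ ‖ζ‖ ^ s * 1 * ((∫ η, ‖𝓕 f η * 𝓕 g (ζ - η)‖) + ∫ η, ‖𝓕 f η * 𝓕 g (ζ - η)‖) := by
        gcongr
    _ = _ := by ring

lemma exists_integrable_bound (hs : 0 ≤ s) (f g : 𝓢(E, ℂ)) : ∃ B : E → ℝ, Integrable B ∧
    ∀ᵐ ζ : E, ‖ζ‖ ^ s * ∫ η, ‖f η * g (ζ - η)‖ ≤ B ζ := by
  have ha := integrable_one_add_norm_rpow_mul f (s := s)
  have hb := integrable_one_add_norm_rpow_mul g (s := s)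
  refine ⟨_, ha.integrable_convolution (ContinuousLinearMap.mul ℝ ℝ) hb, ?_⟩
  filter_upwards [ha.ae_convolution_exists (ContinuousLinearMap.mul ℝ ℝ) hb] with ζ hζ
  rw [← integral_const_mul]
  refine integral_mono_of_nonneg (ae_of_all _ fun η => by positivity) hζ
    (ae_of_all _ fun η => ?_)
  simp only [ContinuousLinearMap.mul_apply']
  rw [norm_mul, mul_mul_mul_comm, ← Real.mul_rpow (by positivity) (by positivity)]
  gcongr
  have h4 : ‖ζ‖ ≤ ‖η‖ + ‖ζ - η‖ := by simpa using norm_add_le η (ζ - η)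
  nlinarith [norm_nonneg η, norm_nonneg (ζ - η)]

lemma tendsto_approx [Nontrivial E] (hs : 0 ≤ s) (f g : 𝓢(E, ℂ)) (x : E) :
    Tendsto (fun N => approx s f g N x) atTop (𝓝 (riesz s (mulS f g) x)) := by
  have h : ∀ u : 𝓢(E, ℂ), u x = 𝓕⁻ (⇑(𝓕 u : 𝓢(E, ℂ))) x := fun u => by
    rw [← fourierInv_coe]
    simp
  simp_rw [h, riesz, Real.fourierInv_eq]
  obtain ⟨B, hB, hBle⟩ := exists_integrable_bound hs (𝓕 f) (𝓕 g)
  refine tendsto_integral_of_dominated_convergence (fun ζ => 2 * B ζ)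
    (fun N => Continuous.aestronglyMeasurable ?_) (hB.const_mul 2) (fun N => ?_) ?_
  · exact (Real.continuous_fourierChar.comp (continuous_id.inner continuous_const)).smul
      (𝓕 (approx s f g N)).continuous
  · filter_upwards [hBle] with ζ hζ
    rw [Circle.norm_smul]
    exact (norm_fourier_approx_le f g N ζ).trans (by gcongr)
  · filter_upwards [ae_ne (0 : E)] with ζ hζ
    exact (tendsto_fourier_approx f g hζ).const_smul _

end Approximation

section KatoPonce

open Set Metric Module Filter Topology

variable {E : Type*} [NormedAddCommGroup E] [InnerProductSpace ℝ E] [FiniteDimensional ℝ E]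
  [MeasurableSpace E] [BorelSpace E] {s : ℝ}

theorem exists_eLpNorm_riesz_mulS_le [Nontrivial E] (hs : 0 < s) {p p₁ q₁ p₂ q₂ : ℝ}
    (hp : 1 < p) (hp₁ : 1 < p₁) (hq₁ : 1 < q₁) (hp₂ : 1 < p₂) (hq₂ : 1 < q₂)
    (h₁ : 1 / p = 1 / p₁ + 1 / q₁) (h₂ : 1 / p = 1 / p₂ + 1 / q₂) :
    ∃ C : ℝ≥0∞, C ≠ ⊤ ∧ ∀ f g : 𝓢(E, ℂ),
      eLpNorm (riesz s (mulS f g)) (ENNReal.ofReal p) volume ≤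
        C * (eLpNorm (riesz s f) (ENNReal.ofReal p₁) volume *
            eLpNorm g (ENNReal.ofReal q₁) volume +
          eLpNorm f (ENNReal.ofReal p₂) volume *
            eLpNorm (riesz s g) (ENNReal.ofReal q₂) volume) := by
  have hlow' : ∀ ξ : E, 4 ≤ ‖ξ‖ → 𝓕 (lowKer' : 𝓢(E, ℂ)) ξ = 0 := fun ξ hξ => by
    rw [fourier_lowKer', phi_eq_zero, Complex.ofReal_zero]
    rw [norm_smul, norm_inv, Real.norm_ofNat]
    linarith
  have hlow : ∀ ξ : E, 4 ≤ ‖ξ‖ → 𝓕 (lowKer : 𝓢(E, ℂ)) ξ = 0 := fun ξ hξ => by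
    rw [fourier_lowKer, phi_eq_zero (by linarith), Complex.ofReal_zero]
  obtain ⟨A, hA, hAle⟩ := exists_lpn_sum_block_le hs hp hp₁ hq₁ h₁ hlow'
  obtain ⟨B, hB, hBle⟩ := exists_lpn_sum_block_le hs hp hq₂ hp₂ (h₂.trans (add_comm _ _)) hlow
  have hpos : ∀ {r : ℝ}, 1 < r → 0 < r := one_pos.trans
  simp only [lpn_eq_eLpNorm (hpos hp), lpn_eq_eLpNorm (hpos hp₁), lpn_eq_eLpNorm (hpos hq₁)]
    at hAle
  simp only [lpn_eq_eLpNorm (hpos hp), lpn_eq_eLpNorm (hpos hp₂), lpn_eq_eLpNorm (hpos hq₂)]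
    at hBle
  refine ⟨A + B, by finiteness, fun f g => ?_⟩
  refine (Lp.eLpNorm_lim_le_liminf_eLpNorm
    (fun N => (approx s f g N).continuous.aestronglyMeasurable) _
    (ae_of_all _ fun x => tendsto_approx hs.le f g x)).trans ?_
  refine liminf_le_of_le (by isBoundedDefault) fun b hb => ?_
  obtain ⟨N, hN⟩ := hb.exists
  refine hN.trans ?_
  have hp' : (1 : ℝ≥0∞) ≤ ENNReal.ofReal p := by simpa using hp.le
  refine (eLpNorm_add_le (SchwartzMap.continuous _).aestronglyMeasurable
    (SchwartzMap.continuous _).aestronglyMeasurable hp').trans ?_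
  refine (add_le_add (hAle _ _ f g) (hBle _ _ g f)).trans ?_
  rw [mul_add]
  refine add_le_add (mul_le_mul_left le_self_add _) ?_
  rw [mul_comm (eLpNorm (riesz s g) _ _)]
  exact mul_le_mul_left le_add_self _

lemma lam_eq_riesz (d : ℕ) (s : ℝ) (h : EuclideanSpace ℝ (Fin d) → ℂ) : lam d s h = riesz s h := by
  ext x
  rw [lam, riesz, Real.fourierInv_eq']
  congr 1 with ξ
  rw [real_inner_comm, smul_eq_mul, mul_assoc]

lemma riesz_zero (f : 𝓢(E, ℂ)) : riesz 0 f = f := by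
  have : ⇑(𝓕⁻ (𝓕 f) : 𝓢(E, ℂ)) = f := by simp
  rw [fourierInv_coe, fourier_coe] at this
  simpa [riesz] using this

lemma one_div_toReal {p q r : ℝ≥0∞} (hq : 1 < q) (hr : 1 < r)
    (h : 1 / p = 1 / q + 1 / r) : 1 / p.toReal = 1 / q.toReal + 1 / r.toReal := by
  have hne : ∀ {a : ℝ≥0∞}, 1 < a → 1 / a ≠ ⊤ := fun ha => by
    simpa using (zero_lt_one.trans ha).ne'
  have := congrArg ENNReal.toReal h
  rw [ENNReal.toReal_add (hne hq) (hne hr)] at this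
  simpa using this

end KatoPonce

end KatoPonce

open KatoPonce

/-- Kato–Ponce inequality (5.2): for `s ≥ 0` and
`1/p = 1/p₁ + 1/q₁ = 1/p₂ + 1/q₂` with all exponents in `(1,∞)`, there is `C`
(depending only on `d`, `s` and the exponents) such that for all Schwartz `f, g`:
`‖Λ^s(fg)‖_{L^p} ≤ C (‖Λ^s f‖_{L^{p₁}} ‖g‖_{L^{q₁}} + ‖f‖_{L^{p₂}} ‖Λ^s g‖_{L^{q₂}})`. -/
theorem stmt9 (d : ℕ) (hd : 1 ≤ d) (s : ℝ) (hs : 0 ≤ s)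
    (p p₁ q₁ p₂ q₂ : ℝ≥0∞)
    (hp : 1 < p) (hp' : p < ⊤) (hp₁ : 1 < p₁) (hp₁' : p₁ < ⊤)
    (hq₁ : 1 < q₁) (hq₁' : q₁ < ⊤) (hp₂ : 1 < p₂) (hp₂' : p₂ < ⊤)
    (hq₂ : 1 < q₂) (hq₂' : q₂ < ⊤)
    (h1 : 1 / p = 1 / p₁ + 1 / q₁) (h2 : 1 / p = 1 / p₂ + 1 / q₂) :
    ∃ C : ℝ, 0 < C ∧
      ∀ f g : SchwartzMap (EuclideanSpace ℝ (Fin d)) ℂ,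
        eLpNorm (lam d s fun x => f x * g x) p volume ≤
          ENNReal.ofReal C *
            (eLpNorm (lam d s ⇑f) p₁ volume * eLpNorm (⇑g) q₁ volume +
              eLpNorm (⇑f) p₂ volume * eLpNorm (lam d s ⇑g) q₂ volume) := by
  have : NeZero d := ⟨by omega⟩
  have hone : ∀ {r : ℝ≥0∞}, 1 < r → r < ⊤ → 1 < r.toReal := fun h h' => by
    simpa using (ENNReal.toReal_lt_toReal ENNReal.one_ne_top h'.ne).2 h
  have key : ∃ C : ℝ≥0∞, C ≠ ⊤ ∧ ∀ f g : SchwartzMap (EuclideanSpace ℝ (Fin d)) ℂ,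
      eLpNorm (riesz s (mulS f g)) p volume ≤
        C * (eLpNorm (riesz s f) p₁ volume * eLpNorm g q₁ volume +
          eLpNorm f p₂ volume * eLpNorm (riesz s g) q₂ volume) := by
    rw [← ENNReal.ofReal_toReal hp'.ne, ← ENNReal.ofReal_toReal hp₁'.ne,
      ← ENNReal.ofReal_toReal hq₁'.ne, ← ENNReal.ofReal_toReal hp₂'.ne,
      ← ENNReal.ofReal_toReal hq₂'.ne]
    have h1' := one_div_toReal hp₁ hq₁ h1
    obtain rfl | hs := hs.eq_or_lt
    · refine ⟨1, ENNReal.one_ne_top, fun f g => ?_⟩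
      have hpos : ∀ {r : ℝ≥0∞}, 1 < r → r < ⊤ → 0 < r.toReal := fun h h' =>
        one_pos.trans (hone h h')
      simp only [riesz_zero, one_mul]
      refine le_trans ?_ le_self_add
      rw [← lpn_eq_eLpNorm (hpos hp hp'), ← lpn_eq_eLpNorm (hpos hp₁ hp₁'),
        ← lpn_eq_eLpNorm (hpos hq₁ hq₁')]
      simp only [mulS_apply, enorm_mul]
      exact lpn_mul_le (hpos hp hp') (hpos hq₁ hq₁') h1' (hpos hp₁ hp₁')
        f.continuous.enorm.measurable g.continuous.enorm.measurable
    · exact exists_eLpNorm_riesz_mulS_le hs (hone hp hp') (hone hp₁ hp₁') (hone hq₁ hq₁')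
        (hone hp₂ hp₂') (hone hq₂ hq₂') h1' (one_div_toReal hp₂ hq₂ h2)
  obtain ⟨C, hC, hle⟩ := key
  refine ⟨C.toReal + 1, by positivity, fun f g => ?_⟩
  simp only [lam_eq_riesz]
  refine (hle f g).trans (mul_le_mul_left ?_ _)
  rw [ENNReal.le_ofReal_iff_toReal_le hC (by positivity)]
  linarith
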